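/- arXiv:2110.06749 — 2 statements merged into one kernel-verified Lean document; each statement's English description precedes it below -/
import Mathlib

section
/- For any canonical module ω_R of R, the socle Hom_R(𝕜, H^0_𝔪(H^{m+n−2}_I(ω_R))) is an infinite-dimensional 𝕜-vector space. -/
open CategoryTheory Opposite MvPowerSeries

set_option synthInstance.maxHeartbeats 1000000
set_option maxHeartbeats 1000000

noncomputable section

/-- The grade of an ideal: the maximal length of a regular sequence contained in it. -/
def idealGrade {A : Type} [CommRing A] (J : Ideal A) : ℕ∞ :=
  sSup {c : ℕ∞ | ∃ rs : List A, (∀ r ∈ rs, r ∈ J) ∧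
    RingTheory.Sequence.IsRegular A rs ∧ (rs.length : ℕ∞) = c}

/-- The height of an ideal: the infimum of heights of primes containing it. -/
def idealHeight {A : Type} [CommRing A] (J : Ideal A) : ℕ∞ :=
  sInf {h : ℕ∞ | ∃ p : PrimeSpectrum A, J ≤ p.asIdeal ∧ Order.height p = h}

/-- A canonical module of a `d`-dimensional local ring `A`: a finitely generated module `ω`
with `Ext_A^i(𝕜, ω) = 0` for `i ≠ d` and `Ext_A^d(𝕜, ω)` a one-dimensional `𝕜`-vector space
(equivalently, isomorphic to `𝕜` as an `A`-module), where `𝕜` is the residue field. -/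
def IsCanonicalModule (A : Type) [CommRing A] [IsLocalRing A] (d : ℕ)
    (ω : ModuleCat A) : Prop :=
  Module.Finite A ω ∧
  (∀ i : ℕ, i ≠ d → Subsingleton
    (((Ext A (ModuleCat A) i).obj
      (op (ModuleCat.of A (IsLocalRing.ResidueField A)))).obj ω)) ∧
  Nonempty ((((Ext A (ModuleCat A) d).obj
      (op (ModuleCat.of A (IsLocalRing.ResidueField A)))).obj ω)
    ≃ₗ[A] IsLocalRing.ResidueField A)

variable (𝕜 : Type) [Field 𝕜] (m n : ℕ)

/-- The formal power series ring `P` in the entries of an `m × n` matrix of variables. -/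
abbrev DetP := MvPowerSeries (Fin m × Fin n) 𝕜

/-- The ideal of `P` generated by the `2 × 2` minors of the matrix of variables. -/
def detI2 : Ideal (DetP 𝕜 m n) :=
  Ideal.span {f | ∃ (i k : Fin m) (j l : Fin n), i < k ∧ j < l ∧
    f = X (i, j) * X (k, l) - X (i, l) * X (k, j)}

/-- The complete determinantal ring `R = P/I₂(X)`. -/
abbrev DetR := DetP 𝕜 m n ⧸ detI2 𝕜 m n

/-- The residue class in `R` of the variable `x_{ij}`. -/
def detx (i : Fin m) (j : Fin n) : DetR 𝕜 m n :=
  Ideal.Quotient.mk (detI2 𝕜 m n) (X (i, j))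

/-- The ideal `I` of `R` generated by the entries of the first `n - 1` columns. -/
def detJ : Ideal (DetR 𝕜 m n) :=
  Ideal.span {x | ∃ (i : Fin m) (j : Fin n), (j : ℕ) < n - 1 ∧ x = detx 𝕜 m n i j}

/-- The formal power series ring `S = 𝕜[[x_1, …, x_m, a_1, …, a_{n-1}]]`. -/
abbrev DetS := MvPowerSeries (Fin m ⊕ Fin (n - 1)) 𝕜

/-- The ideal `𝔞 = (a_1, …, a_{n-1})S`. -/
def detA : Ideal (DetS 𝕜 m n) :=
  Ideal.span {f | ∃ j : Fin (n - 1), f = X (Sum.inr j)}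

/-- The property pinning down the local `𝕜`-algebra homomorphism `φ : R → S`:
`x_{ij} ↦ a_j·x_i` for `1 ≤ j ≤ n-1` and `x_{in} ↦ x_i` (in `0`-based indexing, the last
column is `j = n-1`).  Any `𝕜`-algebra homomorphism `R → S` with these values on the
variables automatically maps the maximal ideal into the maximal ideal, hence is continuous
and is uniquely determined by these values; so this predicate characterizes `φ`. -/
def IsDetPhi (φ : DetR 𝕜 m n →ₐ[𝕜] DetS 𝕜 m n) : Prop :=
  ∀ (i : Fin m) (j : Fin n),
    φ (detx 𝕜 m n i j) =
      if h : (j : ℕ) < n - 1 then X (Sum.inr (⟨j, h⟩ : Fin (n - 1))) * X (Sum.inl i)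
      else X (Sum.inl i)

namespace ExtBridge
variable {R : Type} [CommRing R] {X X' : ModuleCat.{0} R} (Y : ModuleCat.{0} R)

/-- The functor whose left derived functors define `CategoryTheory.Ext`. -/
abbrev homFunctor : ModuleCat.{0} R ⥤ (ModuleCat.{0} R)ᵒᵖ :=
  ((linearYoneda R (ModuleCat.{0} R)).obj Y).rightOp

/-- The complex computing the left derived functors of `homFunctor Y`. -/
abbrev homComplex (P : ProjectiveResolution X) : ChainComplex (ModuleCat.{0} R)ᵒᵖ ℕ :=
  ((homFunctor Y).mapHomologicalComplex _).obj P.complex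

/-- Cocycles of degree `n` in `Hom(P, Y)`. -/
abbrev cocyc (P : ProjectiveResolution X) (n : ℕ) : ModuleCat.{0} R :=
  ((homComplex Y P).opcycles n).unop

/-- The class of a cocycle in cohomology. -/
def cocycClass (P : ProjectiveResolution X) (n : ℕ) :
    cocyc Y P n ⟶ ((homComplex Y P).homology n).unop := ((homComplex Y P).homologyι n).unop

/-- The cochain underlying a cocycle. -/
def cocycVal (P : ProjectiveResolution X) (n : ℕ) :
    cocyc Y P n →ₗ[R] (P.complex.X n ⟶ Y) :=
  ((homComplex Y P).pOpcycles n).unop.hom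

variable (P : ProjectiveResolution X) (n : ℕ)

lemma cocycClass_surjective : Function.Surjective (cocycClass Y P n) := by
  rw [← ModuleCat.epi_iff_surjective]
  unfold cocycClass; infer_instance

lemma cocycVal_injective : Function.Injective (cocycVal Y P n) := by
  have : Mono ((homComplex Y P).pOpcycles n).unop := by
    have h : Epi ((homComplex Y P).pOpcycles n) := inferInstance
    revert h
    generalize (homComplex Y P).pOpcycles n = q
    intro h
    infer_instance
  exact (ModuleCat.mono_iff_injective _).1 this

lemma d_comp_cocycVal (z : cocyc Y P n) (m : ℕ) :
    P.complex.d m n ≫ cocycVal Y P n z = 0 := by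
  have h := congrArg Quiver.Hom.unop ((homComplex Y P).d_pOpcycles m n)
  exact DFunLike.congr_fun (congrArg ModuleCat.Hom.hom h) z

lemma exists_cocycVal_eq (f : P.complex.X n ⟶ Y) (h : P.complex.d (n+1) n ≫ f = 0) :
    ∃ z : cocyc Y P n, cocycVal Y P n z = f := by
  have h0 : (ShortComplex.mk _ _ ((homComplex Y P).d_pOpcycles (n+1) n)).Exact :=
    ShortComplex.exact_of_g_is_cokernel _ ((homComplex Y P).opcyclesIsCokernel (n+1) n (by simp))
  have := h0.unop
  rw [ShortComplex.moduleCat_exact_iff] at this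
  exact this f h

lemma exists_of_cocycClass_eq_zero (z : cocyc Y P (n+1)) (h : cocycClass Y P (n+1) z = 0) :
    ∃ g : P.complex.X n ⟶ Y, P.complex.d (n+1) n ≫ g = cocycVal Y P (n+1) z := by
  have h0 : (ShortComplex.mk _ _
      ((homComplex Y P).homologyι_comp_fromOpcycles (n+1) n)).Exact :=
    ShortComplex.exact_of_f_is_kernel _ ((homComplex Y P).homologyIsKernel (n+1) n (by simp))
  have := h0.unop
  rw [ShortComplex.moduleCat_exact_iff] at this
  obtain ⟨g, hg⟩ := this z h
  refine ⟨g, ?_⟩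
  have h2 := congrArg Quiver.Hom.unop ((homComplex Y P).p_fromOpcycles (n+1) n)
  have h3 := DFunLike.congr_fun (congrArg ModuleCat.Hom.hom h2) g
  rw [← hg]
  exact h3.symm

lemma cocycClass_eq_zero (z : cocyc Y P (n+1)) (g : P.complex.X n ⟶ Y)
    (hg : P.complex.d (n+1) n ≫ g = cocycVal Y P (n+1) z) : cocycClass Y P (n+1) z = 0 := by
  let w : cocyc Y P (n+1) := ((homComplex Y P).fromOpcycles (n+1) n).unop.hom g
  have h2 := congrArg Quiver.Hom.unop ((homComplex Y P).p_fromOpcycles (n+1) n)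
  have h3 := DFunLike.congr_fun (congrArg ModuleCat.Hom.hom h2) g
  have hw : w = z := cocycVal_injective Y P (n+1) (by rw [← hg]; exact h3)
  have h4 := congrArg Quiver.Hom.unop ((homComplex Y P).homologyι_comp_fromOpcycles (n+1) n)
  rw [← hw]
  exact DFunLike.congr_fun (congrArg ModuleCat.Hom.hom h4) g

/-- The extension class of a cocycle. -/
def cocycExt : cocyc Y P n →ₗ[R] Abelian.Ext X Y n where
  toFun z := P.extMk (cocycVal Y P n z) (n+1) rfl (d_comp_cocycVal Y P n z _)
  map_add' a b := by
    rw [ProjectiveResolution.add_extMk]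
    congr 1
    exact map_add (cocycVal Y P n) a b
  map_smul' r a := by
    dsimp only [RingHom.id_apply]
    rw [Abelian.Ext.smul_eq_comp_mk₀, ProjectiveResolution.extMk_comp_mk₀]
    congr 1
    rw [map_smul]
    simp

lemma cocycExt_surjective : Function.Surjective (cocycExt Y P n) := by
  intro e
  obtain ⟨f, h, rfl⟩ := P.extMk_surjective e (n+1) rfl
  obtain ⟨z, hz⟩ := exists_cocycVal_eq Y P n f h
  refine ⟨z, ?_⟩
  subst hz
  rfl

lemma ker_cocycExt :
    LinearMap.ker (cocycExt Y P (n+1)) = LinearMap.ker (cocycClass Y P (n+1)).hom := by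
  ext z
  rw [LinearMap.mem_ker, LinearMap.mem_ker]
  refine (P.extMk_eq_zero_iff _ _ rfl (d_comp_cocycVal Y P _ z _) n rfl).trans ⟨?_, ?_⟩
  · rintro ⟨g, hg⟩
    exact cocycClass_eq_zero Y P n z g hg
  · exact exists_of_cocycClass_eq_zero Y P n z

/-- The comparison between the cohomology of `Hom(P, Y)` and extension groups. -/
def homologyEquiv :
    ((homComplex Y P).homology (n+1)).unop ≃ₗ[R] Abelian.Ext X Y (n+1) :=
  ((cocycClass Y P (n+1)).hom.quotKerEquivOfSurjective (cocycClass_surjective Y P (n+1))).symm ≪≫ₗ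
    (Submodule.quotEquivOfEq _ _ (ker_cocycExt Y P n).symm) ≪≫ₗ
    (cocycExt Y P (n+1)).quotKerEquivOfSurjective (cocycExt_surjective Y P (n+1))

lemma homologyEquiv_cocycClass (z : cocyc Y P (n+1)) :
    homologyEquiv Y P n (cocycClass Y P (n+1) z) = cocycExt Y P (n+1) z := by
  unfold homologyEquiv
  simp only [LinearEquiv.trans_apply]
  have : ((cocycClass Y P (n+1)).hom.quotKerEquivOfSurjective
      (cocycClass_surjective Y P (n+1))).symm (cocycClass Y P (n+1) z) =
      Submodule.Quotient.mk z := by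
    rw [LinearEquiv.symm_apply_eq]; rfl
  rw [this]
  rfl

variable {P} {P' : ProjectiveResolution X'} {f : X ⟶ X'} (φ : ProjectiveResolution.Hom P P' f)

lemma homologyEquiv_naturality (x : ((homComplex Y P').homology (n+1)).unop) :
    homologyEquiv Y P n ((HomologicalComplex.homologyMap
      (((homFunctor Y).mapHomologicalComplex _).map φ.hom) (n+1)).unop x) =
      (Abelian.Ext.mk₀ f).comp (homologyEquiv Y P' n x) (zero_add _) := by
  obtain ⟨z, rfl⟩ := cocycClass_surjective Y P' (n+1) x
  set ψ := ((homFunctor Y).mapHomologicalComplex _).map φ.hom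
  have h1 := congrArg Quiver.Hom.unop (HomologicalComplex.homologyι_naturality ψ (i := n+1))
  have h1' := DFunLike.congr_fun (congrArg ModuleCat.Hom.hom h1) z
  have h2 := congrArg Quiver.Hom.unop (HomologicalComplex.p_opcyclesMap ψ (i := n+1))
  have h2' := DFunLike.congr_fun (congrArg ModuleCat.Hom.hom h2) z
  rw [homologyEquiv_cocycClass]
  refine (congrArg (homologyEquiv Y P n) h1').trans ?_
  refine (homologyEquiv_cocycClass Y P n
    ((HomologicalComplex.opcyclesMap ψ (n+1)).unop z)).trans ?_
  refine Eq.trans ?_ (ProjectiveResolution.mk₀_comp_extMk (cocycVal Y P' (n+1) z) _ rfl (d_comp_cocycVal Y P' _ z _) φ).symm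
  unfold cocycExt
  dsimp only [LinearMap.coe_mk, AddHom.coe_mk]
  congr 1

variable (X) in
/-- Comparison of the two definitions of extension groups in positive degrees. -/
def extEquiv : ((Ext R (ModuleCat.{0} R) (n+1)).obj (op X)).obj Y ≃ₗ[R] Abelian.Ext X Y (n+1) :=
  (((projectiveResolution X).isoLeftDerivedObj (homFunctor Y) (n+1)).unop.toLinearEquiv).symm ≪≫ₗ
    homologyEquiv Y (projectiveResolution X) n

lemma extEquiv_naturality (f : X ⟶ X')
    (x : ((Ext R (ModuleCat.{0} R) (n+1)).obj (op X')).obj Y) :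
    extEquiv X Y n (((Ext R (ModuleCat.{0} R) (n+1)).map f.op).app Y x) =
      (Abelian.Ext.mk₀ f).comp (extEquiv X' Y n x) (zero_add _) := by
  let P := projectiveResolution X
  let P' := projectiveResolution X'
  let φ : ProjectiveResolution.Hom P P' f := ⟨ProjectiveResolution.lift f P P',
    by simpa using ProjectiveResolution.lift_commutes_zero f P P'⟩
  have h := congrArg Quiver.Hom.unop
    (ProjectiveResolution.isoLeftDerivedObj_inv_naturality f P P' φ.hom
      (ProjectiveResolution.lift_commutes_zero f P P')
      (homFunctor Y) (n+1))
  have h' := DFunLike.congr_fun (congrArg ModuleCat.Hom.hom h) x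
  have h2 := homologyEquiv_naturality Y n φ
    ((P'.isoLeftDerivedObj (homFunctor Y) (n+1)).unop.inv x)
  exact (congrArg (homologyEquiv Y P n) h').trans h2

instance : Limits.PreservesFiniteColimits (homFunctor Y) := by
  have : Limits.PreservesLimitsOfSize.{0, 0} ((linearYoneda R (ModuleCat.{0} R)).obj Y) :=
    have : Limits.PreservesLimitsOfSize.{0, 0}
      ((linearYoneda R (ModuleCat.{0} R)).obj Y ⋙ forget _) :=
      (inferInstance : Limits.PreservesLimitsOfSize.{0, 0} (yoneda.obj Y))
    Limits.preservesLimits_of_reflects_of_preserves _ (forget _)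
  apply Limits.preservesFiniteColimits_rightOp

variable (X) in
/-- `Ext⁰` is `Hom`. -/
def extZeroEquiv : ((Ext R (ModuleCat.{0} R) 0).obj (op X)).obj Y ≃ₗ[R] (X ⟶ Y) :=
  (((homFunctor Y).leftDerivedZeroIsoSelf.app X).unop.toLinearEquiv).symm

lemma extZeroEquiv_naturality (f : X ⟶ X')
    (x : ((Ext R (ModuleCat.{0} R) 0).obj (op X')).obj Y) :
    extZeroEquiv X Y (((Ext R (ModuleCat.{0} R) 0).map f.op).app Y x) =
      f ≫ extZeroEquiv X' Y x := by
  have h := congrArg Quiver.Hom.unop ((homFunctor Y).leftDerivedZeroIsoSelf.inv.naturality f)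
  exact (DFunLike.congr_fun (congrArg ModuleCat.Hom.hom h) x).symm

end ExtBridge

namespace ExtBridge
variable {R : Type} [CommRing R] (J : Ideal R) (M : ModuleCat.{0} R)

/-- The projection `R/J^s → R/J^t` for `t ≤ s`. -/
def powProj {t s : ℕ} (h : t ≤ s) :
    ModuleCat.of R (R ⧸ J ^ s) ⟶ ModuleCat.of R (R ⧸ J ^ t) :=
  ModuleCat.ofHom (Submodule.mapQ _ _ LinearMap.id (Ideal.pow_le_pow_right h))

/-- The map from a term of the direct system to local cohomology. -/
def toLocalCohomology (i t : ℕ) :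
    (((Ext R (ModuleCat.{0} R) i).obj (op (ModuleCat.of R (R ⧸ J ^ t)))).obj M) →ₗ[R]
      ((localCohomology J i).obj M) :=
  ((Limits.colimit.ι (localCohomology.diagram (localCohomology.idealPowersDiagram J) i)
    (op (op t))).app M).hom

lemma toLocalCohomology_injective (i t : ℕ)
    (h : ∀ s (hs : t ≤ s), Function.Injective
      (((Ext R (ModuleCat.{0} R) i).map (powProj J hs).op).app M)) :
    Function.Injective (toLocalCohomology J M i t) := by
  let D := localCohomology.diagram (localCohomology.idealPowersDiagram J) i
  let E := (evaluation (ModuleCat.{0} R) (ModuleCat.{0} R)).obj M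
  rw [injective_iff_map_eq_zero]
  intro x hx
  have h0 := Limits.colimitObjIsoColimitCompEvaluation_ι_app_hom D (op (op t)) M
  have h1 : Limits.colimit.ι (D ⋙ E) (op (op t)) x = 0 := by
    refine (DFunLike.congr_fun (congrArg ModuleCat.Hom.hom h0) x).symm.trans ?_
    exact (congrArg (Limits.colimitObjIsoColimitCompEvaluation D M).hom.hom hx).trans (map_zero _)
  obtain ⟨⟨⟨s⟩⟩, g, hg⟩ := Limits.Concrete.colimit_rep_eq_zero R (D ⋙ E) (op (op t)) x h1
  have hs : t ≤ s := leOfHom g.unop.unop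
  refine h s hs ?_
  rw [map_zero]
  exact hg

lemma exists_ext_to_localCohomology (n t : ℕ)
    (h : ∀ s (hs : t ≤ s), Function.Injective
      (fun x : Abelian.Ext (ModuleCat.of R (R ⧸ J ^ t)) M (n+1) =>
        (Abelian.Ext.mk₀ (powProj J hs)).comp x (zero_add _))) :
    ∃ f : Abelian.Ext (ModuleCat.of R (R ⧸ J ^ t)) M (n+1) →ₗ[R]
      ((localCohomology J (n+1)).obj M), Function.Injective f := by
  refine ⟨toLocalCohomology J M (n+1) t ∘ₗ
    (extEquiv (ModuleCat.of R (R ⧸ J ^ t)) M n).symm.toLinearMap, ?_⟩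
  refine (toLocalCohomology_injective J M (n+1) t fun s hs x y hxy => ?_).comp
    (LinearEquiv.injective _)
  apply (extEquiv (ModuleCat.of R (R ⧸ J ^ t)) M n).injective
  apply h s hs
  dsimp only
  rw [← extEquiv_naturality, ← extEquiv_naturality, hxy]

lemma exists_hom_to_localCohomology (t : ℕ) :
    ∃ f : (ModuleCat.of R (R ⧸ J ^ t) ⟶ M) →ₗ[R]
      ((localCohomology J 0).obj M), Function.Injective f := by
  refine ⟨toLocalCohomology J M 0 t ∘ₗ
    (extZeroEquiv (ModuleCat.of R (R ⧸ J ^ t)) M).symm.toLinearMap, ?_⟩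
  refine (toLocalCohomology_injective J M 0 t fun s hs x y hxy => ?_).comp
    (LinearEquiv.injective _)
  apply (extZeroEquiv (ModuleCat.of R (R ⧸ J ^ t)) M).injective
  have : Epi (powProj J hs) := by
    rw [ModuleCat.epi_iff_surjective]
    intro a
    obtain ⟨a, rfl⟩ := Submodule.Quotient.mk_surjective _ a
    exact ⟨Submodule.Quotient.mk a, rfl⟩
  rw [← cancel_epi (powProj J hs)]
  rw [← extZeroEquiv_naturality, ← extZeroEquiv_naturality, hxy]

lemma isSimpleModule_residueField [IsLocalRing R] :
    IsSimpleModule R (IsLocalRing.ResidueField R) :=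
  isSimpleModule_iff_quot_maximal.2
    ⟨IsLocalRing.maximalIdeal R, inferInstance, ⟨LinearEquiv.refl R _⟩⟩

/-- If a module contains arbitrarily large powers of the residue field, the socle of its
zeroth local cohomology at the maximal ideal is not finitely generated. -/
theorem not_finite_socle [IsLocalRing R] 
    (h : ∀ N : ℕ, ∃ f : (Fin N → IsLocalRing.ResidueField R) →ₗ[R] M, Function.Injective f) :
    ¬ Module.Finite R (IsLocalRing.ResidueField R →ₗ[R]
        ((localCohomology (IsLocalRing.maximalIdeal R) 0).obj M)) := by
  intro hfin
  set k := IsLocalRing.ResidueField R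
  set H := (localCohomology (IsLocalRing.maximalIdeal R) 0).obj M
  obtain ⟨ι, hι⟩ := exists_hom_to_localCohomology (IsLocalRing.maximalIdeal R) M 1
  -- the socle of `M` embeds in the zeroth local cohomology
  have key : ∀ N : ℕ, ∃ f : (Fin N → k) →ₗ[R] (k →ₗ[R] H), Function.Injective f := by
    intro N
    obtain ⟨f, hf⟩ := h N
    have e : (R ⧸ IsLocalRing.maximalIdeal R ^ 1) ≃ₗ[R] k :=
      Submodule.quotEquivOfEq _ _ (pow_one (IsLocalRing.maximalIdeal R))
    let c : (Fin N → k) →ₗ[R] (ModuleCat.of R (R ⧸ IsLocalRing.maximalIdeal R ^ 1) ⟶ M) :=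
      { toFun := fun v => ModuleCat.ofHom (f ∘ₗ (LinearMap.toSpanSingleton k (Fin N → k) v).restrictScalars R ∘ₗ e.toLinearMap)
        map_add' := fun a b => by ext; simp
        map_smul' := fun a b => by ext; simp [smul_comm _ a b] }
    have hc : Function.Injective c := by
      rw [injective_iff_map_eq_zero]
      intro v hv
      have := DFunLike.congr_fun (congrArg ModuleCat.Hom.hom hv) (e.symm 1)
      simp [c] at this
      exact hf (by simpa using this)
    let q := ι ∘ₗ c
    have hq : Function.Injective q := hι.comp hc
    refine ⟨{ toFun := fun v => q ∘ₗ (LinearMap.toSpanSingleton k (Fin N → k) v).restrictScalars R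
              map_add' := fun a b => by ext; simp
              map_smul' := fun a b => by ext; simp [smul_comm _ a b] }, ?_⟩
    rw [injective_iff_map_eq_zero]
    intro v hv
    have := LinearMap.congr_fun hv 1
    simp at this
    exact hq (by simpa using this)
  obtain ⟨g, s, hs⟩ := Module.Finite.exists_fin' R (k →ₗ[R] H)
  have hk : Module.length R k = 1 := by
    rw [Module.length_eq_one_iff]
    exact isSimpleModule_residueField
  -- each generator factors through the residue field
  have hs' : ∃ s' : (Fin g → k) →ₗ[R] (k →ₗ[R] H), Function.Surjective s' := by
    let s0 : Fin g → k →ₗ[R] (k →ₗ[R] H) := fun i =>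
      { toFun := fun a => s (Pi.single i 1) ∘ₗ (LinearMap.toSpanSingleton k k a).restrictScalars R
        map_add' := fun a b => by ext; simp [mul_add]
        map_smul' := fun a b => by ext; simp }
    refine ⟨LinearMap.lsum R (fun _ => k) R s0, ?_⟩
    rw [← LinearMap.range_eq_top, eq_top_iff, ← LinearMap.range_eq_top.2 hs]
    rintro _ ⟨v, rfl⟩
    refine ⟨fun i => algebraMap R k (v i), ?_⟩
    have hv : v = ∑ i, v i • (Pi.single i 1 : Fin g → R) := by
      ext j; simp [Finset.sum_apply, Pi.single_apply]
    conv_rhs => rw [hv]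
    rw [map_sum, LinearMap.lsum_apply]
    simp only [LinearMap.sum_apply, LinearMap.comp_apply, LinearMap.proj_apply, map_smul]
    refine Finset.sum_congr rfl fun i _ => ?_
    ext
    simp [s0, Algebra.algebraMap_eq_smul_one]
  obtain ⟨s', hs'⟩ := hs'
  obtain ⟨f, hf⟩ := key (g+1)
  have h1 := Module.length_le_of_injective f hf
  have h2 := Module.length_le_of_surjective s' hs'
  have h3 := h1.trans h2
  rw [Module.length_pi_of_fintype, Module.length_pi_of_fintype] at h3
  simp [hk] at h3
  exact absurd (by exact_mod_cast h3 : g + 1 ≤ g) (by omega)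

end ExtBridge

namespace ExtBridge
open Abelian IsLocalRing
variable {R : Type} [CommRing R] (ω : ModuleCat.{0} R)

section General

variable {ω}

lemma subsingleton_ext_middle {S : ShortComplex (ModuleCat.{0} R)} (hS : S.ShortExact) (i : ℕ)
    [Subsingleton (Abelian.Ext S.X₁ ω i)] [Subsingleton (Abelian.Ext S.X₃ ω i)] :
    Subsingleton (Abelian.Ext S.X₂ ω i) := by
  refine subsingleton_of_forall_eq 0 fun x => ?_
  obtain ⟨y, hy⟩ := Abelian.Ext.contravariant_sequence_exact₂ hS ω x (Subsingleton.elim _ _)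
  rw [← hy, Subsingleton.elim y 0, Abelian.Ext.comp_zero]

lemma mk₀_comp_injective {S : ShortComplex (ModuleCat.{0} R)} (hS : S.ShortExact) (i : ℕ)
    [Subsingleton (Abelian.Ext S.X₁ ω i)] :
    Function.Injective (fun x : Abelian.Ext S.X₃ ω (i+1) =>
      (Abelian.Ext.mk₀ S.g).comp x (zero_add _)) := by
  refine (injective_iff_map_eq_zero (AddMonoidHom.mk' (fun x : Abelian.Ext S.X₃ ω (i+1) =>
      (Abelian.Ext.mk₀ S.g).comp x (zero_add _)) (fun a b => Abelian.Ext.comp_add _ _ _ _))).2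
      fun x hx => ?_
  obtain ⟨y, hy⟩ := Abelian.Ext.contravariant_sequence_exact₃ hS ω x hx (add_comm 1 i)
  rw [← hy, Subsingleton.elim y 0, Abelian.Ext.comp_zero]

lemma subsingleton_ext_of_iso {X X' : ModuleCat.{0} R} (e : X ≅ X') (i : ℕ)
    [Subsingleton (Abelian.Ext X' ω i)] : Subsingleton (Abelian.Ext X ω i) := by
  refine subsingleton_of_forall_eq 0 fun x => ?_
  have : x = (Abelian.Ext.mk₀ e.hom).comp ((Abelian.Ext.mk₀ e.inv).comp x (zero_add _))
      (zero_add _) := by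
    rw [Abelian.Ext.mk₀_comp_mk₀_assoc]; simp
  rw [this, Subsingleton.elim ((Abelian.Ext.mk₀ e.inv).comp x (zero_add _)) 0,
    Abelian.Ext.comp_zero]

/-- The short exact sequence of a surjection. -/
lemma shortExact_of_surjective {L L' : Type} [AddCommGroup L] [Module R L] [AddCommGroup L']
    [Module R L'] (f : L →ₗ[R] L') (hf : Function.Surjective f) :
    (f.shortComplexKer).ShortExact := LinearMap.shortExact_shortComplexKer hf

end General

lemma isFiniteLength_of_pow_smul_eq_zero [IsLocalRing R] [IsNoetherianRing R] {L : Type}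
    [AddCommGroup L] [Module R L]
    [Module.Finite R L] (N : ℕ) (h : ∀ r ∈ maximalIdeal R ^ N, ∀ x : L, r • x = 0) :
    IsFiniteLength R L := by
  rw [isFiniteLength_iff_isNoetherian_isArtinian]
  refine ⟨inferInstance, ?_⟩
  set J := maximalIdeal R ^ N
  have hJ : Module.IsTorsionBySet R L J := fun x a => h a a.2 x
  let := hJ.module
  have : IsScalarTower R (R ⧸ J) L := hJ.isScalarTower
  have : Module.Finite (R ⧸ J) L := Module.Finite.of_restrictScalars_finite R _ _
  have : IsArtinianRing (R ⧸ J) := by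
    rw [isArtinianRing_iff_isNoetherianRing_krullDimLE_zero]
    refine ⟨inferInstance, ?_⟩
    rw [Ring.krullDimLE_zero_iff]
    intro I hI
    have hIc : maximalIdeal R ≤ I.comap (Ideal.Quotient.mk J) := by
      have : J ≤ I.comap (Ideal.Quotient.mk J) := by
        intro x hx
        rw [Ideal.mem_comap, Ideal.Quotient.eq_zero_iff_mem.2 hx]
        exact I.zero_mem
      exact Ideal.IsPrime.le_of_pow_le this
    have hmax : (I.comap (Ideal.Quotient.mk J)).IsMaximal := by
      rw [← (maximalIdeal.isMaximal R).eq_of_le (Ideal.IsPrime.ne_top inferInstance) hIc]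
      infer_instance
    have := Ideal.map_eq_top_or_isMaximal_of_surjective (Ideal.Quotient.mk J)
      Ideal.Quotient.mk_surjective hmax
    rw [Ideal.map_comap_of_surjective _ Ideal.Quotient.mk_surjective] at this
    exact this.resolve_left hI.ne_top
  have : IsArtinian (R ⧸ J) L := inferInstance
  exact isArtinian_of_surjective_algebraMap (R := R ⧸ J) (S := R) Ideal.Quotient.mk_surjective

variable [IsLocalRing R] {d : ℕ}

lemma subsingleton_ext_of_isFiniteLength
    (h : ∀ i, i ≠ d → Subsingleton (Abelian.Ext (ModuleCat.of R (ResidueField R)) ω i))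
    (i : ℕ) (hi : i ≠ d)
    {L : Type} [AddCommGroup L] [Module R L] (hL : IsFiniteLength R L) :
    Subsingleton (Abelian.Ext (ModuleCat.of R L) ω i) := by
  have := h i hi
  induction hL with
  | @of_subsingleton M _ _ _ =>
    refine subsingleton_of_forall_eq 0 fun x => ?_
    have h0 : 𝟙 (ModuleCat.of R M) = 0 := (ModuleCat.isZero_of_subsingleton _).eq_of_src _ _
    rw [← Abelian.Ext.mk₀_id_comp x, h0, Abelian.Ext.mk₀_zero, Abelian.Ext.zero_comp]
  | @of_simple_quotient M _ _ N hs hN ih =>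
    obtain ⟨J, hJ, ⟨e⟩⟩ := isSimpleModule_iff_quot_maximal.1 hs
    obtain rfl := IsLocalRing.eq_maximalIdeal hJ
    have e' : (M ⧸ N) ≃ₗ[R] ResidueField R := e
    have h3 := subsingleton_ext_of_iso (ω := ω) e'.toModuleIso i
    have hS := shortExact_of_surjective N.mkQ N.mkQ_surjective
    have e1 : LinearMap.ker N.mkQ ≃ₗ[R] N := LinearEquiv.ofEq _ _ N.ker_mkQ
    have h1 := subsingleton_ext_of_iso (ω := ω) e1.toModuleIso i
    exact @subsingleton_ext_middle _ _ _ _ hS i h1 h3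

variable [IsNoetherianRing R] [Module.Finite R ω]

/-- Extension groups vanish in degree `i` if they vanish in degree `i + 1` modulo a regular
element. -/
lemma subsingleton_ext_of_regular {L Q : Type} [AddCommGroup L] [Module R L] [AddCommGroup Q]
    [Module R Q] [Module.Finite R L] (q : L →ₗ[R] Q) (hq : Function.Surjective q) (x : R)
    (hx : x ∈ maximalIdeal R) (hreg : ∀ l : L, x • l = 0 → l = 0)
    (hker : ∀ l : L, q l = 0 ↔ ∃ l', x • l' = l) (i : ℕ)
    [Subsingleton (Abelian.Ext (ModuleCat.of R Q) ω (i+1))] :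
    Subsingleton (Abelian.Ext (ModuleCat.of R L) ω i) := by
  have hz : (x • 𝟙 (ModuleCat.of R L)) ≫ ModuleCat.ofHom q = 0 := by
    ext l
    exact (hker _).2 ⟨l, rfl⟩
  let S := ShortComplex.mk _ _ hz
  have hS : S.ShortExact := by
    refine @ShortComplex.ShortExact.mk _ _ _ S ?_ ?_ ?_
    · rw [ShortComplex.moduleCat_exact_iff]
      intro l hl
      obtain ⟨l', hl'⟩ := (hker l).1 hl
      exact ⟨l', hl'⟩
    · rw [ModuleCat.mono_iff_injective, injective_iff_map_eq_zero]
      exact hreg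
    · rw [ModuleCat.epi_iff_surjective]
      exact hq
  have : Module.Finite R (Abelian.Ext (ModuleCat.of R L) ω i) := ModuleCat.finite_ext ..
  have htop : (⊤ : Submodule R (Abelian.Ext (ModuleCat.of R L) ω i)) ≤ maximalIdeal R • ⊤ := by
    intro y _
    obtain ⟨z, hz⟩ := Abelian.Ext.contravariant_sequence_exact₁ hS ω y (add_comm 1 i)
      (Subsingleton.elim (α := Abelian.Ext (ModuleCat.of R Q) ω (i+1)) _ _)
    have : x • z = y := by
      rw [← hz]
      change _ = (Abelian.Ext.mk₀ (x • 𝟙 (ModuleCat.of R L))).comp z _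
      rw [Abelian.Ext.mk₀_smul, Abelian.Ext.smul_comp, Abelian.Ext.mk₀_id_comp]
    rw [← this]
    exact Submodule.smul_mem_smul hx trivial
  have := Submodule.eq_bot_of_le_smul_of_le_jacobson_bot (maximalIdeal R) ⊤ Module.Finite.fg_top htop
    (IsLocalRing.maximalIdeal_le_jacobson _)
  exact (Submodule.subsingleton_iff R).1 (subsingleton_of_bot_eq_top this.symm)

section Chain
variable {S : Type} [CommRing S] [Algebra R S]

lemma subsingleton_ext_of_chain
    (h : ∀ i, i ≠ d → Subsingleton (Abelian.Ext (ModuleCat.of R (ResidueField R)) ω i))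
    (m N : ℕ) (B : ℕ → Ideal S) (x : ℕ → R) [Module.Finite R (S ⧸ (B 0).restrictScalars R)]
    (hB : ∀ j < m, B (j+1) = B j ⊔ Ideal.span {algebraMap R S (x j)})
    (hx : ∀ j < m, x j ∈ maximalIdeal R)
    (hreg : ∀ j < m, ∀ s, algebraMap R S (x j) * s ∈ B j → s ∈ B j)
    (hN : ∀ r ∈ maximalIdeal R ^ N, algebraMap R S r ∈ B m) (i : ℕ) (hi : d < i + m) :
    Subsingleton (Abelian.Ext (ModuleCat.of R (S ⧸ (B 0).restrictScalars R)) ω i) := by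
  have hfin : ∀ l ≤ m, Module.Finite R (S ⧸ (B l).restrictScalars R) := by
    intro l
    induction l with
    | zero => intro; assumption
    | succ l ih =>
      intro hl
      have := ih (by omega)
      have hle : (B l).restrictScalars R ≤ (B (l+1)).restrictScalars R := by
        rw [hB l (by omega)]
        exact fun s hs => Ideal.mem_sup_left hs
      exact Module.Finite.of_surjective (Submodule.factor hle) (Submodule.factor_surjective hle)
  suffices H : ∀ j l, l + j = m → ∀ i, d < i + j →
      Subsingleton (Abelian.Ext (ModuleCat.of R (S ⧸ (B l).restrictScalars R)) ω i) from
    H m 0 (zero_add _) i hi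
  intro j
  induction j with
  | zero =>
    intro l hl i hi
    obtain rfl : l = m := hl
    have := hfin l le_rfl
    refine subsingleton_ext_of_isFiniteLength ω h i (by omega)
      (isFiniteLength_of_pow_smul_eq_zero N ?_)
    intro r hr s
    obtain ⟨s, rfl⟩ := Submodule.Quotient.mk_surjective _ s
    rw [← Submodule.Quotient.mk_smul, Submodule.Quotient.mk_eq_zero,
      Submodule.restrictScalars_mem, Algebra.smul_def]
    exact Ideal.mul_mem_right _ _ (hN r hr)
  | succ j ih =>
    intro l hl i hi
    have hlm : l < m := by omega
    have := hfin l hlm.le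
    have := ih (l+1) (by omega) (i+1) (by omega)
    have hle : (B l).restrictScalars R ≤ (B (l+1)).restrictScalars R := by
      rw [hB l hlm]
      exact fun s hs => Ideal.mem_sup_left hs
    refine subsingleton_ext_of_regular ω (Submodule.factor hle) (Submodule.factor_surjective hle)
      (x l) (hx l hlm) ?_ ?_ i
    · intro s hs
      obtain ⟨s, rfl⟩ := Submodule.Quotient.mk_surjective _ s
      rw [← Submodule.Quotient.mk_smul, Submodule.Quotient.mk_eq_zero,
        Submodule.restrictScalars_mem, Algebra.smul_def] at hs
      rw [Submodule.Quotient.mk_eq_zero]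
      exact hreg l hlm s hs
    · intro s
      obtain ⟨s, rfl⟩ := Submodule.Quotient.mk_surjective _ s
      change Submodule.Quotient.mk s = 0 ↔ _
      rw [Submodule.Quotient.mk_eq_zero, Submodule.restrictScalars_mem, hB l hlm,
        Submodule.mem_sup]
      constructor
      · rintro ⟨y, hy, z, hz, rfl⟩
        obtain ⟨c, rfl⟩ := Ideal.mem_span_singleton'.1 hz
        refine ⟨Submodule.Quotient.mk c, ?_⟩
        rw [← Submodule.Quotient.mk_smul, Submodule.Quotient.eq, Submodule.restrictScalars_mem,
          Algebra.smul_def]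
        rw [show algebraMap R S (x l) * c - (y + c * algebraMap R S (x l)) = -y by ring]
        exact neg_mem hy
      · rintro ⟨s', hs'⟩
        obtain ⟨s', rfl⟩ := Submodule.Quotient.mk_surjective _ s'
        rw [← Submodule.Quotient.mk_smul, eq_comm, Submodule.Quotient.eq,
          Submodule.restrictScalars_mem, Algebra.smul_def] at hs'
        exact ⟨_, hs', _, Ideal.mem_span_singleton'.2 ⟨s', mul_comm _ _⟩, by ring⟩

end Chain

end ExtBridge

namespace ExtBridge
open Abelian IsLocalRing
variable {R : Type} [CommRing R] (ω : ModuleCat.{0} R) {S : Type} [CommRing S] [Algebra R S]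

/-- The sum of the image of `R` and an ideal of `S`. -/
def imageSup (A : Ideal S) : Submodule R S :=
  LinearMap.range (Algebra.linearMap R S) ⊔ A.restrictScalars R

lemma le_imageSup (A : Ideal S) : A.restrictScalars R ≤ imageSup A := le_sup_right

lemma imageSup_mono {A A' : Ideal S} (h : A ≤ A') : imageSup (R := R) A ≤ imageSup A' :=
  sup_le_sup_left (fun _ hx => h hx) _

variable (I : Ideal R) (A : ℕ → Ideal S) (hI : ∀ t, (A t).comap (algebraMap R S) = I ^ t)

include hI in
lemma pow_le_comap (t : ℕ) :
    I ^ t ≤ ((A t).restrictScalars R).comap (Algebra.linearMap R S) := by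
  rw [← hI]; exact fun _ h => h

/-- The sequence `R/I^t → S/A_t → C_t`. -/
def quotSeq (t : ℕ) : ShortComplex (ModuleCat.{0} R) :=
  ShortComplex.mk
    (ModuleCat.ofHom (Submodule.mapQ (I ^ t) ((A t).restrictScalars R) (Algebra.linearMap R S)
      (pow_le_comap I A hI t)))
    (ModuleCat.ofHom (Submodule.factor (le_imageSup (R := R) (A t)))) (by
      refine ModuleCat.hom_ext (LinearMap.ext fun x => ?_)
      obtain ⟨x, rfl⟩ := Submodule.Quotient.mk_surjective _ x
      change Submodule.Quotient.mk (algebraMap R S x) = 0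
      rw [Submodule.Quotient.mk_eq_zero]
      exact Submodule.mem_sup_left ⟨x, rfl⟩)

lemma quotSeq_shortExact (t : ℕ) : (quotSeq I A hI t).ShortExact := by
  refine @ShortComplex.ShortExact.mk _ _ _ _ ?_ ?_ ?_
  · rw [ShortComplex.moduleCat_exact_iff]
    intro s hs
    obtain ⟨s, rfl⟩ := Submodule.Quotient.mk_surjective _ s
    replace hs : (Submodule.Quotient.mk s : S ⧸ imageSup (R := R) (A t)) = 0 := hs
    rw [Submodule.Quotient.mk_eq_zero] at hs
    obtain ⟨_, ⟨r, rfl⟩, a, ha, rfl⟩ := Submodule.mem_sup.1 hs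
    refine ⟨Submodule.Quotient.mk r, ?_⟩
    change (Submodule.Quotient.mk (algebraMap R S r) : S ⧸ (A t).restrictScalars R) = _
    rw [Submodule.Quotient.eq]
    simpa using ha
  · rw [ModuleCat.mono_iff_injective, injective_iff_map_eq_zero]
    intro r hr
    obtain ⟨r, rfl⟩ := Submodule.Quotient.mk_surjective _ r
    replace hr : (Submodule.Quotient.mk (algebraMap R S r) : S ⧸ (A t).restrictScalars R) = 0 := hr
    rw [Submodule.Quotient.mk_eq_zero] at hr
    refine (Submodule.Quotient.mk_eq_zero _).2 ?_
    rw [← hI]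
    exact hr
  · rw [ModuleCat.epi_iff_surjective]
    exact Submodule.factor_surjective (le_imageSup (R := R) (A t))

variable (hA : Antitone A)

/-- The morphism between the sequences `R/I^t → S/A_t → C_t`. -/
def quotSeqMap {t s : ℕ} (h : t ≤ s) : quotSeq I A hI s ⟶ quotSeq I A hI t where
  τ₁ := powProj I h
  τ₂ := ModuleCat.ofHom (Submodule.factor (fun _ hx => hA h hx))
  τ₃ := ModuleCat.ofHom (Submodule.factor (imageSup_mono (hA h)))
  comm₁₂ := by
    refine ModuleCat.hom_ext (LinearMap.ext fun x => ?_)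
    obtain ⟨x, rfl⟩ := Submodule.Quotient.mk_surjective _ x
    rfl
  comm₂₃ := by
    refine ModuleCat.hom_ext (LinearMap.ext fun x => ?_)
    obtain ⟨x, rfl⟩ := Submodule.Quotient.mk_surjective _ x
    rfl

/-- The connecting map from the extension groups of `R/I^t` to those of `C_t`. -/
def connecting (t p : ℕ) :
    Abelian.Ext (quotSeq I A hI t).X₁ ω (p+1) →ₗ[R] Abelian.Ext (quotSeq I A hI t).X₃ ω (p+2) :=
  (quotSeq_shortExact I A hI t).extClass.precompOfLinear R ω (show 1 + (p+1) = p+2 by omega)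

lemma connecting_bijective (t p : ℕ)
    [Subsingleton (Abelian.Ext (quotSeq I A hI t).X₂ ω (p+1))]
    [Subsingleton (Abelian.Ext (quotSeq I A hI t).X₂ ω (p+2))] :
    Function.Bijective (connecting ω I A hI t p) := by
  constructor
  · rw [injective_iff_map_eq_zero]
    intro x hx
    obtain ⟨y, rfl⟩ := Abelian.Ext.contravariant_sequence_exact₁ (quotSeq_shortExact I A hI t) ω x
      (show 1 + (p+1) = p+2 by omega) hx
    rw [Subsingleton.elim y 0, Abelian.Ext.comp_zero]
  · intro x
    obtain ⟨y, rfl⟩ := Abelian.Ext.contravariant_sequence_exact₃ (quotSeq_shortExact I A hI t) ω x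
      (Subsingleton.elim _ _) (show 1 + (p+1) = p+2 by omega)
    exact ⟨y, rfl⟩

lemma connecting_naturality {t s : ℕ} (h : t ≤ s) (p : ℕ)
    (x : Abelian.Ext (quotSeq I A hI t).X₁ ω (p+1)) :
    connecting ω I A hI s p ((Abelian.Ext.mk₀ (powProj I h)).comp x (zero_add _)) =
      (Abelian.Ext.mk₀ (quotSeqMap I A hI hA h).τ₃).comp (connecting ω I A hI t p x)
        (zero_add _) := by
  have h1 := ShortComplex.ShortExact.extClass_naturality (quotSeq_shortExact I A hI s)
    (quotSeq_shortExact I A hI t) (quotSeqMap I A hI hA h)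
  change (quotSeq_shortExact I A hI s).extClass.comp
    ((Abelian.Ext.mk₀ (quotSeqMap I A hI hA h).τ₁).comp x (zero_add _))
      (show 1 + (p+1) = p+2 by omega) =
      (Abelian.Ext.mk₀ (quotSeqMap I A hI hA h).τ₃).comp
        ((quotSeq_shortExact I A hI t).extClass.comp x (show 1 + (p+1) = p+2 by omega)) (zero_add _)
  rw [← Abelian.Ext.comp_assoc (h₁₂ := add_zero 1) (h := by omega), h1, Abelian.Ext.comp_assoc]
  all_goals omega

lemma IsFiniteLength.ker {L L' : Type} [AddCommGroup L] [Module R L] [AddCommGroup L']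
    [Module R L'] (hL : IsFiniteLength R L) (f : L →ₗ[R] L') :
    IsFiniteLength R (LinearMap.ker f) :=
  hL.of_injective (LinearMap.ker f).injective_subtype

variable [IsLocalRing R]

/-- A surjection from a module of finite length is injective on top extension groups. -/
lemma mk₀_comp_injective_of_isFiniteLength {p : ℕ}
    (h : ∀ i, i ≠ p+2 → Subsingleton (Abelian.Ext (ModuleCat.of R (ResidueField R)) ω i))
    {L L' : Type} [AddCommGroup L] [Module R L] [AddCommGroup L']
    [Module R L'] (hL : IsFiniteLength R L) (f : L →ₗ[R] L') (hf : Function.Surjective f) :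
    Function.Injective (fun x : Abelian.Ext (ModuleCat.of R L') ω (p+2) =>
      (Abelian.Ext.mk₀ (ModuleCat.ofHom f)).comp x (zero_add _)) := by
  have := subsingleton_ext_of_isFiniteLength ω h (p+1) (by omega) (IsFiniteLength.ker hL f)
  exact @mk₀_comp_injective _ _ _ _ (shortExact_of_surjective f hf) (p+1) this

/-- A surjection from `L` onto `k^N` gives an embedding of `k^N` into the top extension group. -/
lemma exists_embedding_ext {p N : ℕ}
    (h : ∀ i, i ≠ p+2 → Subsingleton (Abelian.Ext (ModuleCat.of R (ResidueField R)) ω i))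
    (e : Abelian.Ext (ModuleCat.of R (ResidueField R)) ω (p+2) ≃ₗ[R] ResidueField R)
    {L : Type} [AddCommGroup L] [Module R L] (hL : IsFiniteLength R L)
    (c : L →ₗ[R] (Fin N → ResidueField R)) (hc : Function.Surjective c) :
    ∃ f : (Fin N → ResidueField R) →ₗ[R] Abelian.Ext (ModuleCat.of R L) ω (p+2),
      Function.Injective f := by
  let l : (Fin N → ResidueField R) → (Fin N → ResidueField R) →ₗ[R] ResidueField R :=
    fun v => (Fintype.linearCombination (ResidueField R) v).restrictScalars R
  have l_apply : ∀ v w, l v w = ∑ i, w i * v i := fun v w => by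
    simp [l, Fintype.linearCombination_apply]
  let g : (Fin N → ResidueField R) →ₗ[R]
      (ModuleCat.of R L ⟶ ModuleCat.of R (ResidueField R)) :=
    { toFun := fun v => ModuleCat.ofHom (l v ∘ₗ c)
      map_add' := fun a b => by
        ext x; simp [l_apply, mul_add, Finset.sum_add_distrib]
      map_smul' := fun a b => by
        ext x; simp [l_apply, Finset.smul_sum] }
  let f : (Fin N → ResidueField R) →ₗ[R] Abelian.Ext (ModuleCat.of R L) ω (p+2) :=
    { toFun := fun v => (Abelian.Ext.mk₀ (g v)).comp (e.symm 1) (zero_add _)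
      map_add' := fun a b => by
        rw [map_add, Abelian.Ext.mk₀_add, Abelian.Ext.add_comp]
      map_smul' := fun a b => by
        rw [map_smul, Abelian.Ext.mk₀_smul, Abelian.Ext.smul_comp]; rfl }
  refine ⟨f, ?_⟩
  rw [injective_iff_map_eq_zero]
  intro v hv
  by_contra hne
  obtain ⟨i, hi⟩ := Function.ne_iff.1 hne
  have hsurj : Function.Surjective (l v ∘ₗ c) := by
    rw [LinearMap.coe_comp]
    refine Function.Surjective.comp (fun a => ⟨Pi.single i (a * (v i)⁻¹), ?_⟩) hc
    rw [l_apply, Finset.sum_eq_single i]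
    · simp [mul_assoc, inv_mul_cancel₀ hi]
    · intro j _ hj; simp [Pi.single_eq_of_ne hj]
    · simp
  have h0 : e.symm 1 = 0 := by
    apply mk₀_comp_injective_of_isFiniteLength ω h hL _ hsurj
    dsimp only
    rw [Abelian.Ext.comp_zero]
    exact hv
  exact one_ne_zero ((LinearEquiv.map_eq_zero_iff _).1 h0)

variable [IsNoetherianRing R]

include hI hA in
/-- Local cohomology of a canonical module contains large powers of the residue field when the
modules `C_t = S / (R + A_t)` have large quotients. -/
theorem exists_embedding_localCohomology {p : ℕ} (hω : IsCanonicalModule R (p+2) ω)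
    (hfin : ∀ t, Module.Finite R (S ⧸ (A t).restrictScalars R))
    (hchain : ∀ t i, (i = p+1 ∨ i = p+2) →
      (∀ i, i ≠ p+2 → Subsingleton (Abelian.Ext (ModuleCat.of R (ResidueField R)) ω i)) →
      Module.Finite R ω →
      Subsingleton (Abelian.Ext (ModuleCat.of R (S ⧸ (A t).restrictScalars R)) ω i))
    (hcond : ∀ t, ∃ c, ∀ r ∈ maximalIdeal R ^ c, ∀ s : S, r • s ∈ imageSup (R := R) (A t))
    (N : ℕ) (t : ℕ) (c : S →ₗ[R] (Fin N → ResidueField R)) (hc : Function.Surjective c)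
    (hct : imageSup (A t) ≤ LinearMap.ker c) :
    ∃ f : (Fin N → ResidueField R) →ₗ[R] ((localCohomology I (p+1)).obj ω),
      Function.Injective f := by
  obtain ⟨hω1, hω2, ⟨e⟩⟩ := hω
  have h : ∀ i, i ≠ p+2 →
      Subsingleton (Abelian.Ext (ModuleCat.of R (ResidueField R)) ω i) := by
    intro i hi
    have := hω2 i hi
    cases i with
    | zero =>
      have e1 := extZeroEquiv (ModuleCat.of R (ResidueField R)) ω
      have e2 := Abelian.Ext.linearEquiv₀ (R := R) (X := ModuleCat.of R (ResidueField R)) (Y := ω)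
      exact (e2.trans e1.symm).toEquiv.subsingleton
    | succ i => exact (extEquiv (ModuleCat.of R (ResidueField R)) ω i).symm.toEquiv.subsingleton
  have e' := (extEquiv (ModuleCat.of R (ResidueField R)) ω (p+1)).symm.trans e
  have hlen : ∀ t, IsFiniteLength R (S ⧸ imageSup (R := R) (A t)) := by
    intro t
    have := hfin t
    have := Module.Finite.of_surjective (Submodule.factor (le_imageSup (R := R) (A t)))
      (Submodule.factor_surjective _)
    obtain ⟨c, hc⟩ := hcond t
    refine isFiniteLength_of_pow_smul_eq_zero c fun r hr x => ?_
    obtain ⟨x, rfl⟩ := Submodule.Quotient.mk_surjective _ x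
    rw [← Submodule.Quotient.mk_smul, Submodule.Quotient.mk_eq_zero]
    exact hc r hr x
  have hbij : ∀ t, Function.Bijective (connecting ω I A hI t p) := fun t => by
    have : Subsingleton (Abelian.Ext (quotSeq I A hI t).X₂ ω (p+1)) :=
      hchain t (p+1) (Or.inl rfl) h hω1
    have : Subsingleton (Abelian.Ext (quotSeq I A hI t).X₂ ω (p+2)) :=
      hchain t (p+2) (Or.inr rfl) h hω1
    exact connecting_bijective ω I A hI t p
  obtain ⟨f₁, hf₁⟩ := exists_ext_to_localCohomology I ω p t fun s hs x y hxy => by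
    have h3 : Function.Injective (fun x : Abelian.Ext (quotSeq I A hI t).X₃ ω (p+2) =>
        (Abelian.Ext.mk₀ (quotSeqMap I A hI hA hs).τ₃).comp x (zero_add _)) :=
      mk₀_comp_injective_of_isFiniteLength ω h (hlen s) _ (Submodule.factor_surjective _)
    apply (hbij t).1
    apply h3
    exact (connecting_naturality ω I A hI hA hs p x).symm.trans
      ((congrArg (connecting ω I A hI s p) hxy).trans (connecting_naturality ω I A hI hA hs p y))
  obtain ⟨f₂, hf₂⟩ := exists_embedding_ext ω h e' (hlen t)
    (Submodule.liftQ _ c hct) (fun v => by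
      obtain ⟨s, rfl⟩ := hc v
      exact ⟨Submodule.Quotient.mk s, rfl⟩)
  let g := LinearEquiv.ofBijective _ (hbij t)
  exact ⟨f₁ ∘ₗ g.symm.toLinearMap ∘ₗ f₂, hf₁.comp (g.symm.injective.comp hf₂)⟩

end ExtBridge

namespace PowerSeriesSupport
variable {K : Type} [Field K] {τ : Type}

/-- The ideal of power series supported on an upward closed set of exponents. -/
def supportIdeal (U : UpperSet (τ →₀ ℕ)) : Ideal (MvPowerSeries τ K) where
  carrier := {f | ∀ e, e ∉ U → coeff e f = 0}
  zero_mem' := fun e _ => map_zero _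
  add_mem' := fun hf hg e he => by rw [map_add, hf e he, hg e he, add_zero]
  smul_mem' := fun c f hf e he => by
    classical
    rw [smul_eq_mul, coeff_mul]
    refine Finset.sum_eq_zero fun p hp => ?_
    rw [hf p.2, mul_zero]
    exact fun h => he (U.upper (Finset.HasAntidiagonal.mem_antidiagonal.1 hp ▸ le_add_self) h)

lemma mem_supportIdeal {U : UpperSet (τ →₀ ℕ)} {f : MvPowerSeries τ K} :
    f ∈ supportIdeal U ↔ ∀ e, e ∉ U → coeff e f = 0 := Iff.rfl

/-- The part of a power series supported on a set of exponents. -/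
def restrict (U : Set (τ →₀ ℕ)) (f : MvPowerSeries τ K) : MvPowerSeries τ K :=
  U.indicator f

lemma coeff_restrict_of_mem {U : Set (τ →₀ ℕ)} {e} (he : e ∈ U) (f : MvPowerSeries τ K) :
    coeff e (restrict U f) = coeff e f := Set.indicator_of_mem he _

lemma coeff_restrict_of_notMem {U : Set (τ →₀ ℕ)} {e} (he : e ∉ U) (f : MvPowerSeries τ K) :
    coeff e (restrict U f) = 0 := Set.indicator_of_notMem he _

lemma restrict_add_restrict_compl (U : Set (τ →₀ ℕ)) (f : MvPowerSeries τ K) :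
    restrict U f + restrict Uᶜ f = f := Set.indicator_self_add_compl U f

lemma supportIdeal_sup_span_X {U V : UpperSet (τ →₀ ℕ)} (s : τ)
    (h : ∀ e, e ∈ V ↔ e ∈ U ∨ 1 ≤ e s) :
    (supportIdeal V : Ideal (MvPowerSeries τ K)) = supportIdeal U ⊔ Ideal.span {X s} := by
  apply le_antisymm
  · intro f hf
    rw [← restrict_add_restrict_compl (U : Set (τ →₀ ℕ)) f]
    refine Submodule.add_mem_sup (fun e he => coeff_restrict_of_notMem he f) ?_
    refine Ideal.mem_span_singleton.2 (X_dvd_iff.2 fun e he => ?_)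
    by_cases heU : e ∈ U
    · exact coeff_restrict_of_notMem (Set.notMem_compl_iff.2 heU) f
    · rw [coeff_restrict_of_mem heU]
      exact hf e fun hV => ((h e).1 hV).elim heU (by omega)
  · refine sup_le (fun f hf e he => hf e fun h' => he ((h e).2 (Or.inl h'))) ?_
    rw [Ideal.span_singleton_le_iff_mem]
    intro e he
    classical
    rw [coeff_X, if_neg]
    rintro rfl
    exact he ((h _).2 (Or.inr (by simp)))

lemma mem_supportIdeal_of_X_mul_mem {U : UpperSet (τ →₀ ℕ)} (s : τ)
    (h : ∀ e, e + Finsupp.single s 1 ∈ U → e ∈ U) {f : MvPowerSeries τ K}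
    (hf : X s * f ∈ supportIdeal U) : f ∈ supportIdeal U := by
  intro e he
  have := hf (Finsupp.single s 1 + e) (fun h' => he (h e (add_comm e _ ▸ h')))
  rwa [X, coeff_add_monomial_mul, one_mul] at this

/-- The upward closed set of exponents on which an additive function is at least `t`. -/
def levelSet (g : (τ →₀ ℕ) →+ ℕ) (t : ℕ) : UpperSet (τ →₀ ℕ) where
  carrier := {e | t ≤ g e}
  upper' := fun a b hab h => by
    obtain ⟨c, rfl⟩ := le_iff_exists_add.1 hab
    simp only [Set.mem_ofPred_eq, map_add] at h ⊢
    omega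

lemma mem_levelSet {g : (τ →₀ ℕ) →+ ℕ} {t : ℕ} {e} : e ∈ levelSet g t ↔ t ≤ g e := Iff.rfl

lemma supportIdeal_levelSet_pow_le (g : (τ →₀ ℕ) →+ ℕ) (t : ℕ) :
    (supportIdeal (levelSet g 1) : Ideal (MvPowerSeries τ K)) ^ t ≤
      supportIdeal (levelSet g t) := by
  induction t with
  | zero => exact fun f _ e he => absurd (Nat.zero_le _) he
  | succ t ih =>
    rw [pow_succ, Ideal.mul_le]
    intro f hf f' hf' e he
    classical
    rw [coeff_mul]
    refine Finset.sum_eq_zero fun p hp => ?_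
    rw [Finset.HasAntidiagonal.mem_antidiagonal] at hp
    rw [mem_levelSet, ← hp, map_add] at he
    by_cases h1 : t ≤ g p.1
    · rw [hf' p.2 (by rw [mem_levelSet]; omega), mul_zero]
    · rw [ih hf p.1 h1, zero_mul]

lemma mem_span_X_pow [Fintype τ] (N : ℕ) (f : MvPowerSeries τ K)
    (hf : ∀ e : τ →₀ ℕ, e.degree < N → coeff e f = 0) :
    f ∈ (Ideal.span (Set.range (X : τ → MvPowerSeries τ K))) ^ N := by
  classical
  induction N generalizing f with
  | zero => simp
  | succ N ih =>
    cases isEmpty_or_nonempty τ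
    · have : f = 0 := by
        ext e
        rw [Subsingleton.elim e 0, hf 0 (by simp), map_zero]
      rw [this]
      exact zero_mem _
    have hc : ∀ e : τ →₀ ℕ, e ≠ 0 → ∃ s, e s ≠ 0 := fun e he => by
      obtain ⟨s, hs⟩ := Finsupp.ne_iff.1 he
      exact ⟨s, hs⟩
    choose! c hc using hc
    let g : τ → MvPowerSeries τ K := fun s e =>
      if c (Finsupp.single s 1 + e) = s then coeff (Finsupp.single s 1 + e) f else 0
    have hg : ∀ s e, coeff e (g s) =
        if c (Finsupp.single s 1 + e) = s then coeff (Finsupp.single s 1 + e) f else 0 :=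
      fun s e => rfl
    have hXg : ∀ s e, coeff e (X s * g s) =
        if e s ≠ 0 ∧ c e = s then coeff e f else 0 := fun s e => by
      by_cases hs : e s = 0
      · rw [if_neg (fun h => h.1 hs)]
        exact X_dvd_iff.1 (Dvd.intro _ rfl) e hs
      · obtain ⟨e', rfl⟩ : ∃ e', e = Finsupp.single s 1 + e' := by
          refine le_iff_exists_add.1 (Finsupp.single_le_iff.2 ?_)
          omega
        rw [X, coeff_add_monomial_mul, one_mul, hg]
        simp
    have hsum : f = ∑ s, X s * g s := by
      ext e
      rw [map_sum]
      simp only [hXg]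
      by_cases he : e = 0
      · subst he
        rw [hf 0 (by simp)]
        simp
      · rw [Finset.sum_eq_single (c e), if_pos ⟨hc e he, rfl⟩]
        · intro s _ hs
          exact if_neg fun h => hs h.2.symm
        · simp
    rw [hsum, pow_succ']
    refine Ideal.sum_mem _ fun s _ => Ideal.mul_mem_mul (Ideal.subset_span ⟨s, rfl⟩) (ih _ ?_)
    intro e he
    rw [hg, hf _ (by rw [map_add, Finsupp.degree_single]; omega), ite_self]

lemma exists_sum_monomial (F : Finset (τ →₀ ℕ)) (f : MvPowerSeries τ K)
    (hf : ∀ e ∉ F, coeff e f = 0) : f = ∑ e ∈ F, monomial e (coeff e f) := by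
  classical
  ext e
  rw [map_sum]
  simp only [coeff_monomial, Finset.sum_ite_eq]
  split_ifs with h
  · rfl
  · exact hf e h

end PowerSeriesSupport

namespace DetExponents
variable {m n : ℕ}

/-- The exponent of the image of a variable. -/
def weight (s : Fin m × Fin n) : Fin m ⊕ Fin (n - 1) →₀ ℕ :=
  Finsupp.single (Sum.inl s.1) 1 +
    if h : (s.2 : ℕ) < n - 1 then Finsupp.single (Sum.inr ⟨s.2, h⟩) 1 else 0

/-- The effect on exponents of the monomial map. -/
def proj : (Fin m × Fin n →₀ ℕ) →+ (Fin m ⊕ Fin (n - 1) →₀ ℕ) where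
  toFun d := ∑ s, d s • weight s
  map_zero' := by simp
  map_add' := fun a b => by simp [add_smul, Finset.sum_add_distrib]

lemma proj_single (s : Fin m × Fin n) (k : ℕ) : proj (Finsupp.single s k) = k • weight s := by
  change ∑ s', Finsupp.single s k s' • weight s' = _
  rw [Finset.sum_eq_single s]
  · simp
  · intro b _ hb; rw [Finsupp.single_eq_of_ne hb, zero_smul]
  · simp

/-- The degree in the left variables. -/
def degL : (Fin m ⊕ Fin (n - 1) →₀ ℕ) →+ ℕ where
  toFun e := ∑ i, e (Sum.inl i)
  map_zero' := by simp
  map_add' := fun a b => by simp [Finset.sum_add_distrib]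

/-- The degree in the right variables. -/
def degR : (Fin m ⊕ Fin (n - 1) →₀ ℕ) →+ ℕ where
  toFun e := ∑ i, e (Sum.inr i)
  map_zero' := by simp
  map_add' := fun a b => by simp [Finset.sum_add_distrib]

lemma degL_single_inl (i : Fin m) (k : ℕ) :
    degL (n := n) (Finsupp.single (Sum.inl i) k) = k := by
  simp [degL, Finsupp.single_apply]

lemma degL_single_inr (i : Fin (n-1)) (k : ℕ) :
    degL (m := m) (n := n) (Finsupp.single (Sum.inr i) k) = 0 := by
  simp [degL]

lemma degR_single_inl (i : Fin m) (k : ℕ) :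
    degR (n := n) (Finsupp.single (Sum.inl i) k) = 0 := by
  simp [degR]

lemma degR_single_inr (i : Fin (n-1)) (k : ℕ) :
    degR (m := m) (n := n) (Finsupp.single (Sum.inr i) k) = k := by
  simp [degR, Finsupp.single_apply]

lemma degree_eq (e : Fin m ⊕ Fin (n - 1) →₀ ℕ) : e.degree = degL e + degR e := by
  rw [Finsupp.degree_eq_sum, Fintype.sum_sum_type]
  rfl

lemma degL_weight (s : Fin m × Fin n) : degL (weight s) = 1 := by
  unfold weight
  split_ifs <;> simp [degL_single_inl, degL_single_inr]

lemma degR_weight (s : Fin m × Fin n) :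
    degR (weight s) = if (s.2 : ℕ) < n - 1 then 1 else 0 := by
  unfold weight
  split_ifs <;> simp [degR_single_inl, degR_single_inr]

lemma degL_proj (d : Fin m × Fin n →₀ ℕ) : degL (proj d) = d.degree := by
  change degL (∑ s, d s • weight s) = _
  simp [map_sum, degL_weight, Finsupp.degree_eq_sum]

lemma degR_proj_le (d : Fin m × Fin n →₀ ℕ) : degR (proj d) ≤ degL (proj d) := by
  change degR (∑ s, d s • weight s) ≤ degL (∑ s, d s • weight s)
  rw [map_sum, map_sum]
  refine Finset.sum_le_sum fun s _ => ?_
  rw [map_nsmul, map_nsmul, degL_weight, degR_weight]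
  exact nsmul_le_nsmul_right (by split_ifs <;> simp) _

lemma exists_le_of_degL_pos {e : Fin m ⊕ Fin (n - 1) →₀ ℕ} (h : 0 < degL e) :
    ∃ i, Finsupp.single (Sum.inl i) 1 ≤ e := by
  replace h : ∑ i, e (Sum.inl i) ≠ 0 := h.ne'
  obtain ⟨i, _, hi⟩ := Finset.exists_ne_zero_of_sum_ne_zero h
  exact ⟨i, Finsupp.single_le_iff.2 (by omega)⟩

lemma exists_le_of_degR_pos {e : Fin m ⊕ Fin (n - 1) →₀ ℕ} (h : 0 < degR e) :
    ∃ j, Finsupp.single (Sum.inr j) 1 ≤ e := by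
  replace h : ∑ i, e (Sum.inr i) ≠ 0 := h.ne'
  obtain ⟨i, _, hi⟩ := Finset.exists_ne_zero_of_sum_ne_zero h
  exact ⟨i, Finsupp.single_le_iff.2 (by omega)⟩

lemma exists_proj_eq (hn : 1 ≤ n) (e : Fin m ⊕ Fin (n - 1) →₀ ℕ) (he : degR e ≤ degL e) :
    ∃ d, proj d = e := by
  induction hk : degL e generalizing e with
  | zero =>
    have : e = 0 := by
      rw [← Finsupp.degree_eq_zero_iff, degree_eq]; omega
    exact ⟨0, by rw [this, map_zero]⟩
  | succ k ih =>
    obtain ⟨i, hi⟩ := exists_le_of_degL_pos (e := e) (by omega)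
    obtain ⟨e, rfl⟩ := le_iff_exists_add.1 hi
    rw [map_add, map_add, degR_single_inl, degL_single_inl] at he
    rw [map_add, degL_single_inl] at hk
    by_cases h0 : degR e = 0
    · obtain ⟨d, rfl⟩ := ih e (by omega) (by omega)
      refine ⟨Finsupp.single (i, ⟨n-1, by omega⟩) 1 + d, ?_⟩
      rw [map_add, proj_single, one_smul, weight, dif_neg (by simp), add_zero]
    · obtain ⟨j, hj⟩ := exists_le_of_degR_pos (e := e) (by omega)
      obtain ⟨e, rfl⟩ := le_iff_exists_add.1 hj
      rw [map_add, degL_single_inr, zero_add] at hk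
      rw [map_add, map_add, degL_single_inr, degR_single_inr] at he
      obtain ⟨d, rfl⟩ := ih e (by omega) (by omega)
      refine ⟨Finsupp.single (i, ⟨j, by omega⟩) 1 + d, ?_⟩
      rw [map_add, proj_single, one_smul, weight, dif_pos (by simp), add_assoc]

/-- The number of entries in each column. -/
def colSum (j : Fin n) : (Fin m × Fin n →₀ ℕ) →+ ℕ where
  toFun d := ∑ i, d (i, j)
  map_zero' := by simp
  map_add' := fun a b => by simp [Finset.sum_add_distrib]

/-- The number of entries in each row. -/
def rowSum (i : Fin m) : (Fin m × Fin n →₀ ℕ) →+ ℕ where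
  toFun d := ∑ j, d (i, j)
  map_zero' := by simp
  map_add' := fun a b => by simp [Finset.sum_add_distrib]

lemma proj_apply_inl (d : Fin m × Fin n →₀ ℕ) (i : Fin m) :
    proj d (Sum.inl i) = rowSum i d := by
  induction d using Finsupp.induction_linear with
  | zero => simp
  | add f g hf hg => simp [hf, hg]
  | single s k =>
    rw [proj_single, Finsupp.smul_apply]
    change k • _ = ∑ j, Finsupp.single s k (i, j)
    have : weight s (Sum.inl i) = if s.1 = i then 1 else 0 := by
      unfold weight
      split_ifs <;> simp_all
    rw [this]
    obtain ⟨a, b⟩ := s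
    by_cases h : a = i
    · subst h
      simp [Finsupp.single_apply]
    · simp [h]

lemma proj_apply_inr (d : Fin m × Fin n →₀ ℕ) (j : Fin (n - 1)) :
    proj d (Sum.inr j) = colSum ⟨j, by omega⟩ d := by
  induction d using Finsupp.induction_linear with
  | zero => simp
  | add f g hf hg => simp [hf, hg]
  | single s k =>
    rw [proj_single, Finsupp.smul_apply]
    change k • _ = ∑ i, Finsupp.single s k (i, _)
    have : weight s (Sum.inr j) = if s.2 = ⟨j, by omega⟩ then 1 else 0 := by
      unfold weight
      obtain ⟨a, b, hb⟩ := s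
      obtain ⟨j, hj⟩ := j
      simp only [Fin.mk.injEq]
      by_cases h : b = j
      · subst h
        simp [hj]
      · rw [if_neg h]
        split_ifs <;> simp [h]
    rw [this]
    generalize (⟨j, by omega⟩ : Fin n) = l
    obtain ⟨a, b⟩ := s
    by_cases h : b = l
    · subst h
      simp [Finsupp.single_apply]
    · simp [h]

lemma degree_eq_sum_colSum (d : Fin m × Fin n →₀ ℕ) : d.degree = ∑ j, colSum j d := by
  rw [Finsupp.degree_eq_sum, Fintype.sum_prod_type_right]
  rfl

lemma rowSum_eq_of_proj_eq {d d' : Fin m × Fin n →₀ ℕ} (h : proj d = proj d') (i : Fin m) :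
    rowSum i d = rowSum i d' := by
  rw [← proj_apply_inl, ← proj_apply_inl, h]

lemma colSum_eq_of_proj_eq {d d' : Fin m × Fin n →₀ ℕ} (h : proj d = proj d') (j : Fin n) :
    colSum j d = colSum j d' := by
  have h1 : ∀ j : Fin n, (j : ℕ) < n - 1 → colSum j d = colSum j d' := fun j hj => by
    have := congrArg (fun e => e (Sum.inr ⟨j, hj⟩)) h
    simpa only [proj_apply_inr] using this
  by_cases hj : (j : ℕ) < n - 1
  · exact h1 j hj
  · have h2 : ∑ j, colSum j d = ∑ j, colSum j d' := by
      rw [← degree_eq_sum_colSum, ← degree_eq_sum_colSum, ← degL_proj, ← degL_proj, h]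
    rw [← Finset.add_sum_erase _ _ (Finset.mem_univ j),
      ← Finset.add_sum_erase Finset.univ (fun j => colSum j d') (Finset.mem_univ j),
      Finset.sum_congr rfl (g := fun j => colSum j d')] at h2
    · exact Nat.add_right_cancel h2
    · intro k hk
      refine h1 k ?_
      have := Fin.val_ne_of_ne (Finset.ne_of_mem_erase hk)
      omega

lemma exists_single_le_of_rowSum {d : Fin m × Fin n →₀ ℕ} {i : Fin m} (h : rowSum i d ≠ 0) :
    ∃ j, Finsupp.single (i, j) 1 ≤ d := by
  replace h : ∑ j, d (i, j) ≠ 0 := h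
  obtain ⟨j, _, hj⟩ := Finset.exists_ne_zero_of_sum_ne_zero h
  exact ⟨j, Finsupp.single_le_iff.2 (by omega)⟩

lemma exists_single_le_of_colSum {d : Fin m × Fin n →₀ ℕ} {j : Fin n} (h : colSum j d ≠ 0) :
    ∃ i, Finsupp.single (i, j) 1 ≤ d := by
  replace h : ∑ i, d (i, j) ≠ 0 := h
  obtain ⟨i, _, hj⟩ := Finset.exists_ne_zero_of_sum_ne_zero h
  exact ⟨i, Finsupp.single_le_iff.2 (by omega)⟩

lemma weight_add_weight (i k : Fin m) (j l : Fin n) :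
    weight (i, j) + weight (k, l) = weight (i, l) + weight (k, j) := by
  unfold weight
  abel

/-- A monoid homomorphism compatible with the exchange relations depends only on the
projected exponent. -/
lemma map_eq_of_proj_eq {M : Type} [CommMonoid M] (f : Multiplicative (Fin m × Fin n →₀ ℕ) →* M)
    (x : Fin m × Fin n → M) (hf : ∀ s d, f (.ofAdd (Finsupp.single s 1 + d)) = x s * f (.ofAdd d))
    (hx : ∀ i k j l, x (i, j) * x (k, l) = x (i, l) * x (k, j))
    (d d' : Fin m × Fin n →₀ ℕ) (h : proj d = proj d') :
    f (.ofAdd d) = f (.ofAdd d') := by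
  induction hk : d.degree generalizing d d' with
  | zero =>
    have hk' := hk
    rw [← degL_proj, h, degL_proj] at hk'
    rw [Finsupp.degree_eq_zero_iff] at hk hk'
    rw [hk, hk']
  | succ N ih =>
    have hd : d ≠ 0 := by rintro rfl; simp at hk
    obtain ⟨⟨i, j⟩, hs⟩ := Finsupp.ne_iff.1 hd
    have hs' : Finsupp.single (i, j) 1 ≤ d :=
      Finsupp.single_le_iff.2 (Nat.one_le_iff_ne_zero.2 hs)
    obtain ⟨d, rfl⟩ := le_iff_exists_add.1 hs'
    rw [map_add, Finsupp.degree_single] at hk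
    have key : ∀ d', proj (Finsupp.single (i, j) 1 + d) = proj (Finsupp.single (i, j) 1 + d') →
        f (.ofAdd (Finsupp.single (i, j) 1 + d)) = f (.ofAdd (Finsupp.single (i, j) 1 + d')) := by
      intro d' h
      rw [map_add, map_add] at h
      rw [hf, hf, ih d d' (add_left_cancel h) (by omega)]
    have hrow : rowSum i d' ≠ 0 := by
      rw [← rowSum_eq_of_proj_eq h, map_add]
      have : rowSum i (Finsupp.single (i, j) 1) ≠ 0 := by simp [rowSum, Finsupp.single_apply]
      omega
    have hcol : colSum j d' ≠ 0 := by
      rw [← colSum_eq_of_proj_eq h, map_add]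
      have : colSum j (Finsupp.single (i, j) 1) ≠ 0 := by simp [colSum, Finsupp.single_apply]
      omega
    obtain ⟨l, hl⟩ := exists_single_le_of_rowSum hrow
    obtain ⟨k, hk'⟩ := exists_single_le_of_colSum hcol
    obtain ⟨d', rfl⟩ := le_iff_exists_add.1 hl
    by_cases hlj : l = j
    · subst hlj
      exact key d' h
    · have hk2 : Finsupp.single (k, j) 1 ≤ d' := by
        rw [Finsupp.single_le_iff] at hk' ⊢
        rw [Finsupp.add_apply, Finsupp.single_eq_of_ne (by simp [Ne.symm hlj])] at hk'
        omega
      obtain ⟨d', rfl⟩ := le_iff_exists_add.1 hk2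
      rw [key (Finsupp.single (k, l) 1 + d'), hf, hf, hf, hf, ← mul_assoc, hx, mul_assoc]
      rw [h]
      simp only [map_add, proj_single, one_smul]
      rw [← add_assoc, ← add_assoc, weight_add_weight]

end DetExponents

namespace DetMap
open DetExponents PowerSeriesSupport IsLocalRing

lemma hasSubst_monomial_weight :
    HasSubst (fun s : Fin m × Fin n => (monomial (weight s) (1 : 𝕜))) := by
  classical
  refine hasSubst_of_constantCoeff_zero fun s => ?_
  rw [← coeff_zero_eq_constantCoeff_apply, coeff_monomial, if_neg]
  intro h
  have := degL_weight s
  rw [← h, map_zero] at this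
  omega

/-- The monomial homomorphism between power series rings. -/
def phiP : DetP 𝕜 m n →ₐ[𝕜] DetS 𝕜 m n := substAlgHom (hasSubst_monomial_weight 𝕜 m n)

lemma phiP_X (s : Fin m × Fin n) : phiP 𝕜 m n (X s) = monomial (weight s) 1 :=
  substAlgHom_X _ s

lemma coeff_phiP (f : DetP 𝕜 m n) (e) [DecidableEq (Fin m ⊕ Fin (n - 1) →₀ ℕ)] :
    coeff e (phiP 𝕜 m n f) = ∑ᶠ d, if e = proj d then coeff d f else 0 := by
  rw [phiP, coe_substAlgHom, coeff_subst (hasSubst_monomial_weight 𝕜 m n)]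
  refine finsum_congr fun d => ?_
  rw [Finsupp.prod_fintype _ _ (by simp)]
  simp only [monomial_pow, one_pow, prod_monomial, Finset.prod_const_one]
  change coeff d f • coeff e (monomial (proj d) 1) = _
  rw [coeff_monomial]
  simp

lemma coeff_phiP_eq_zero (f : DetP 𝕜 m n) {e : Fin m ⊕ Fin (n - 1) →₀ ℕ}
    (he : degL e < degR e) : coeff e (phiP 𝕜 m n f) = 0 := by
  classical
  rw [coeff_phiP]
  refine finsum_eq_zero_of_forall_eq_zero fun d => if_neg ?_
  rintro rfl
  exact absurd (degR_proj_le d) (by omega)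

lemma exists_phiP_eq (hn : 1 ≤ n) (f : DetS 𝕜 m n)
    (hf : ∀ e, degL e < degR e → coeff e f = 0) : ∃ g, phiP 𝕜 m n g = f := by
  classical
  choose! D hD using exists_proj_eq (m := m) hn
  let g : DetP 𝕜 m n := fun d => if D (proj d) = d then coeff (proj d) f else 0
  have hg : ∀ d, coeff d g = if D (proj d) = d then coeff (proj d) f else 0 := fun _ => rfl
  refine ⟨g, ?_⟩
  ext e
  by_cases he : degR e ≤ degL e
  · rw [coeff_phiP, finsum_eq_single _ (D e), if_pos (hD e he).symm, hg, hD e he, if_pos rfl]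
    intro d hd
    split_ifs with h
    · rw [hg, ← h, if_neg hd.symm]
    · rfl
  · rw [coeff_phiP_eq_zero _ _ _ _ (by omega), hf e (by omega)]

lemma phiP_eq_zero_of_mem (f : DetP 𝕜 m n) (hf : f ∈ detI2 𝕜 m n) : phiP 𝕜 m n f = 0 := by
  have : detI2 𝕜 m n ≤ RingHom.ker (phiP 𝕜 m n) := by
    refine Ideal.span_le.2 ?_
    rintro _ ⟨i, k, j, l, _, _, rfl⟩
    rw [SetLike.mem_coe, RingHom.mem_ker, map_sub, map_mul, map_mul]
    simp only [phiP_X, monomial_mul_monomial, weight_add_weight i k j l, sub_self]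
  exact this hf

/-- The homomorphism from the determinantal ring to the power series ring. -/
def phi : DetR 𝕜 m n →ₐ[𝕜] DetS 𝕜 m n :=
  Ideal.Quotient.liftₐ (detI2 𝕜 m n) (phiP 𝕜 m n) (phiP_eq_zero_of_mem 𝕜 m n)

variable {𝕜 m n}

lemma coeff_phi_eq_zero (r : DetR 𝕜 m n) {e : Fin m ⊕ Fin (n - 1) →₀ ℕ}
    (he : degL e < degR e) : coeff e (phi 𝕜 m n r) = 0 := by
  obtain ⟨f, rfl⟩ := Ideal.Quotient.mk_surjective r
  exact coeff_phiP_eq_zero _ _ _ f he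

lemma exists_phi_eq (hn : 1 ≤ n) (f : DetS 𝕜 m n)
    (hf : ∀ e, degL e < degR e → coeff e f = 0) : ∃ g, phi 𝕜 m n g = f := by
  obtain ⟨g, hg⟩ := exists_phiP_eq 𝕜 m n hn f hf
  exact ⟨Ideal.Quotient.mk _ g, hg⟩

lemma phi_detx (i : Fin m) (j : Fin n) :
    phi 𝕜 m n (detx 𝕜 m n i j) = monomial (weight (i, j)) 1 := phiP_X 𝕜 m n (i, j)

lemma coeff_zero_phi_algebraMap (u : 𝕜) :
    coeff 0 (phi 𝕜 m n (algebraMap 𝕜 (DetR 𝕜 m n) u)) = u := by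
  rw [AlgHom.commutes, MvPowerSeries.algebraMap_apply, coeff_zero_C]
  rfl

variable [IsLocalRing (DetR 𝕜 m n)]

lemma mem_maximalIdeal_of_coeff_zero (r : DetR 𝕜 m n) (h : coeff 0 (phi 𝕜 m n r) = 0) :
    r ∈ maximalIdeal (DetR 𝕜 m n) := by
  rw [mem_maximalIdeal, mem_nonunits_iff]
  intro hr
  have := ((hr.map (phi 𝕜 m n)).map (constantCoeff (σ := Fin m ⊕ Fin (n-1)) (R := 𝕜)))
  rw [← coeff_zero_eq_constantCoeff_apply, h] at this
  exact not_isUnit_zero this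

lemma sub_mem_maximalIdeal (r : DetR 𝕜 m n) :
    r - algebraMap 𝕜 (DetR 𝕜 m n) (coeff 0 (phi 𝕜 m n r)) ∈ maximalIdeal (DetR 𝕜 m n) := by
  apply mem_maximalIdeal_of_coeff_zero
  rw [map_sub, map_sub, coeff_zero_phi_algebraMap, sub_self]

lemma coeff_zero_of_mem_maximalIdeal (r : DetR 𝕜 m n) (h : r ∈ maximalIdeal (DetR 𝕜 m n)) :
    coeff 0 (phi 𝕜 m n r) = 0 := by
  by_contra hne
  have h1 := (Submodule.sub_mem_iff_right _ h).1 (sub_mem_maximalIdeal r)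
  exact h1 ((IsUnit.mk0 _ hne).map (algebraMap 𝕜 (DetR 𝕜 m n)))

lemma phi_mem_of_mem_maximalIdeal (r : DetR 𝕜 m n) (h : r ∈ maximalIdeal (DetR 𝕜 m n)) :
    phi 𝕜 m n r ∈ supportIdeal (levelSet degL 1) := by
  intro e he
  rw [mem_levelSet] at he
  by_cases h0 : degR e = 0
  · have : e = 0 := by
      rw [← Finsupp.degree_eq_zero_iff, degree_eq]; omega
    rw [this]
    exact coeff_zero_of_mem_maximalIdeal r h
  · exact coeff_phi_eq_zero r (by omega)

lemma phi_mem_of_mem_maximalIdeal_pow (t : ℕ) (r : DetR 𝕜 m n)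
    (h : r ∈ maximalIdeal (DetR 𝕜 m n) ^ t) :
    phi 𝕜 m n r ∈ supportIdeal (levelSet degL t) := by
  refine supportIdeal_levelSet_pow_le degL t ?_
  have h1 : maximalIdeal (DetR 𝕜 m n) ≤
      (supportIdeal (levelSet degL 1)).comap (phi 𝕜 m n).toRingHom :=
    fun r hr => phi_mem_of_mem_maximalIdeal r hr
  exact Ideal.le_comap_pow _ t (Ideal.pow_right_mono h1 t h)

/-- The class of a monomial. -/
def mon (d : Fin m × Fin n →₀ ℕ) : DetR 𝕜 m n := Ideal.Quotient.mk _ (monomial d 1)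

omit [IsLocalRing (DetR 𝕜 m n)]

lemma mon_add (d d' : Fin m × Fin n →₀ ℕ) : mon (𝕜 := 𝕜) (d + d') = mon d * mon d' := by
  rw [mon, mon, mon, ← map_mul, monomial_mul_monomial, one_mul]

lemma mon_zero : mon (𝕜 := 𝕜) (0 : Fin m × Fin n →₀ ℕ) = 1 := rfl

lemma mon_single (s : Fin m × Fin n) : mon (𝕜 := 𝕜) (Finsupp.single s 1) = detx 𝕜 m n s.1 s.2 :=
  rfl

lemma detx_mul_detx (i k : Fin m) (j l : Fin n) :
    detx 𝕜 m n i j * detx 𝕜 m n k l = detx 𝕜 m n i l * detx 𝕜 m n k j := by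
  have key : ∀ (i k : Fin m) (j l : Fin n), i < k → j < l →
      detx 𝕜 m n i j * detx 𝕜 m n k l = detx 𝕜 m n i l * detx 𝕜 m n k j := by
    intro i k j l h1 h2
    simp only [detx, ← map_mul]
    rw [Ideal.Quotient.eq]
    exact Ideal.subset_span ⟨i, k, j, l, h1, h2, rfl⟩
  rcases lt_trichotomy i k with h1 | rfl | h1 <;> rcases lt_trichotomy j l with h2 | rfl | h2
  · exact key _ _ _ _ h1 h2
  · rfl
  · exact (key _ _ _ _ h1 h2).symm
  · exact mul_comm _ _
  · rfl
  · exact mul_comm _ _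
  · rw [mul_comm, ← key _ _ _ _ h1 h2, mul_comm]
  · rfl
  · rw [mul_comm, key _ _ _ _ h1 h2, mul_comm]

lemma mon_eq_of_proj_eq (d d' : Fin m × Fin n →₀ ℕ) (h : proj d = proj d') :
    mon (𝕜 := 𝕜) d = mon d' := by
  refine map_eq_of_proj_eq (M := DetR 𝕜 m n) ⟨⟨fun d => mon d.toAdd, mon_zero⟩, fun a b => mon_add _ _⟩
    (fun s => detx 𝕜 m n s.1 s.2) (fun s d => ?_) (fun i k j l => detx_mul_detx i k j l) d d' h
  exact (mon_add _ _).trans (by rw [mon_single]; rfl)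

lemma mul_mem_pow_add {A : Type} [CommRing A] {I : Ideal A} {a b : A} {k l : ℕ}
    (ha : a ∈ I ^ k) (hb : b ∈ I ^ l) : a * b ∈ I ^ (k + l) := by
  rw [pow_add]
  exact Ideal.mul_mem_mul ha hb

lemma mon_mem (d : Fin m × Fin n →₀ ℕ) : mon d ∈ detJ 𝕜 m n ^ degR (proj d) := by
  induction d using Finsupp.induction_linear with
  | zero => simp
  | add f g hf hg =>
    rw [mon_add, map_add, map_add]
    exact mul_mem_pow_add hf hg
  | single s k =>
    have : mon (Finsupp.single s k) = detx 𝕜 m n s.1 s.2 ^ k := by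
      induction k with
      | zero => rw [Finsupp.single_zero, mon_zero, pow_zero]
      | succ k ih => rw [Finsupp.single_add, mon_add, ih, mon_single, pow_succ]
    rw [this, proj_single, map_nsmul, degR_weight]
    split_ifs with h
    · rw [smul_eq_mul, mul_one]
      have hs : detx 𝕜 m n s.1 s.2 ∈ detJ 𝕜 m n := Ideal.subset_span ⟨s.1, s.2, h, rfl⟩
      exact Ideal.pow_mem_pow hs k
    · simp

end DetMap

namespace DetMap
open DetExponents PowerSeriesSupport IsLocalRing

lemma mem_of_forall_mem_sup_pow {A : Type} [CommRing A] [IsNoetherianRing A] [IsLocalRing A]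
    (J : Ideal A) (x : A) (h : ∀ N, x ∈ J ⊔ maximalIdeal A ^ N) : x ∈ J := by
  have h0 := Ideal.iInf_pow_smul_eq_bot_of_isLocalRing (M := A ⧸ J) (maximalIdeal A)
    (Ideal.IsPrime.ne_top inferInstance)
  have h1 : Ideal.Quotient.mk J x ∈ (⨅ i : ℕ, maximalIdeal A ^ i • ⊤ : Submodule A (A ⧸ J)) := by
    rw [Submodule.mem_iInf]
    intro N
    obtain ⟨a, ha, b, hb, rfl⟩ := Submodule.mem_sup.1 (h N)
    rw [map_add, Ideal.Quotient.eq_zero_iff_mem.2 ha, zero_add]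
    have : Ideal.Quotient.mk J b = b • (1 : A ⧸ J) := by
      rw [Algebra.smul_def, mul_one]; rfl
    rw [this]
    exact Submodule.smul_mem_smul hb trivial
  rw [h0] at h1
  exact Ideal.Quotient.eq_zero_iff_mem.1 h1

variable {𝕜 m n}

lemma finite_degree_lt (N : ℕ) : {d : Fin m × Fin n →₀ ℕ | d.degree < N}.Finite :=
  (Finsupp.finite_of_degree_le N).subset fun d hd => show d.degree ≤ N from Nat.le_of_lt hd

lemma mk_monomial (d : Fin m × Fin n →₀ ℕ) (a : 𝕜) :
    Ideal.Quotient.mk (detI2 𝕜 m n) (monomial d a) = algebraMap 𝕜 (DetR 𝕜 m n) a * mon d := by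
  change _ = Ideal.Quotient.mk _ (algebraMap 𝕜 (DetP 𝕜 m n) a) * Ideal.Quotient.mk _ _
  rw [← map_mul, ← Algebra.smul_def, ← map_smul, smul_eq_mul, mul_one]

lemma sum_mem_pow (t N : ℕ) (f : DetP 𝕜 m n)
    (hf : phiP 𝕜 m n f ∈ supportIdeal (levelSet degR t)) :
    ∑ d ∈ (finite_degree_lt (m := m) (n := n) N).toFinset,
      algebraMap 𝕜 (DetR 𝕜 m n) (coeff d f) * mon d ∈ detJ 𝕜 m n ^ t := by
  classical
  set F := (finite_degree_lt (m := m) (n := n) N).toFinset with hF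
  rw [← Finset.sum_fiberwise_of_maps_to (t := F.image proj)
    (fun d hd => Finset.mem_image_of_mem _ hd)]
  refine Ideal.sum_mem _ fun e he => ?_
  obtain ⟨d₀, hd₀, rfl⟩ := Finset.mem_image.1 he
  have h1 : ∀ d ∈ F.filter (fun d => proj d = proj d₀),
      algebraMap 𝕜 (DetR 𝕜 m n) (coeff d f) * mon d =
        algebraMap 𝕜 (DetR 𝕜 m n) (coeff d f) * mon d₀ := fun d hd => by
    rw [mon_eq_of_proj_eq d d₀ (Finset.mem_filter.1 hd).2]
  rw [Finset.sum_congr rfl h1, ← Finset.sum_mul, ← map_sum]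
  by_cases ht : t ≤ degR (proj d₀)
  · exact Ideal.mul_mem_left _ _ (Ideal.pow_le_pow_right ht (mon_mem d₀))
  · have h2 := hf (proj d₀) ht
    rw [coeff_phiP, finsum_eq_sum_of_support_subset (s := F.filter (fun d => proj d = proj d₀)),
      Finset.sum_congr rfl (g := fun d => coeff d f)] at h2
    · rw [h2, map_zero, zero_mul]
      exact zero_mem _
    · intro d hd
      exact if_pos (Finset.mem_filter.1 hd).2.symm
    · intro d hd
      have h3 : proj d₀ = proj d := by
        by_contra h
        exact hd (if_neg h)
      rw [Finset.mem_coe, Finset.mem_filter]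
      refine ⟨?_, h3.symm⟩
      rw [hF, Set.Finite.mem_toFinset] at hd₀ ⊢
      change d.degree < N
      rw [← degL_proj, ← h3, degL_proj]
      exact hd₀

variable [IsLocalRing (DetR 𝕜 m n)]

lemma detx_mem_maximalIdeal (i : Fin m) (j : Fin n) :
    detx 𝕜 m n i j ∈ maximalIdeal (DetR 𝕜 m n) := by
  classical
  apply mem_maximalIdeal_of_coeff_zero
  rw [phi_detx, coeff_monomial, if_neg]
  intro h
  have := degL_weight (i, j)
  rw [← h, map_zero] at this
  omega

lemma mk_mem_maximalIdeal_pow (N : ℕ) (f : DetP 𝕜 m n)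
    (hf : ∀ d : Fin m × Fin n →₀ ℕ, d.degree < N → coeff d f = 0) :
    Ideal.Quotient.mk (detI2 𝕜 m n) f ∈ maximalIdeal (DetR 𝕜 m n) ^ N := by
  have h1 := mem_span_X_pow N f hf
  have h2 : Ideal.span (Set.range (X : Fin m × Fin n → DetP 𝕜 m n)) ≤
      (maximalIdeal (DetR 𝕜 m n)).comap (Ideal.Quotient.mk (detI2 𝕜 m n)) := by
    refine Ideal.span_le.2 ?_
    rintro _ ⟨s, rfl⟩
    exact detx_mem_maximalIdeal s.1 s.2
  exact Ideal.le_comap_pow _ N (Ideal.pow_right_mono h2 N h1)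

lemma comap_supportIdeal (t : ℕ) :
    (supportIdeal (levelSet degR t)).comap (phi 𝕜 m n).toRingHom = detJ 𝕜 m n ^ t := by
  apply le_antisymm
  · intro r hr
    obtain ⟨f, rfl⟩ := Ideal.Quotient.mk_surjective r
    refine mem_of_forall_mem_sup_pow _ _ fun N => ?_
    set F := (finite_degree_lt (m := m) (n := n) N).toFinset with hF
    have h1 := sum_mem_pow t N f hr
    have h2 : Ideal.Quotient.mk (detI2 𝕜 m n) (f - ∑ d ∈ F, monomial d (coeff d f)) ∈
        maximalIdeal (DetR 𝕜 m n) ^ N := by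
      classical
      refine mk_mem_maximalIdeal_pow N _ fun d hd => ?_
      rw [map_sub, map_sum]
      simp only [coeff_monomial, Finset.sum_ite_eq]
      rw [if_pos (by rw [hF, Set.Finite.mem_toFinset]; exact hd), sub_self]
    rw [map_sub, map_sum] at h2
    simp only [mk_monomial] at h2
    have := Submodule.add_mem_sup h1 h2
    rwa [add_sub_cancel] at this
  · have h1 : detJ 𝕜 m n ≤ (supportIdeal (levelSet degR 1)).comap (phi 𝕜 m n).toRingHom := by
      refine Ideal.span_le.2 ?_
      rintro _ ⟨i, j, hj, rfl⟩ e he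
      change coeff e (phi 𝕜 m n _) = 0
      classical
      rw [phi_detx, coeff_monomial, if_neg]
      rintro rfl
      exact he (by rw [mem_levelSet, degR_weight, if_pos hj])
    exact fun r hr => supportIdeal_levelSet_pow_le degR t
      (Ideal.le_comap_pow _ t (Ideal.pow_right_mono h1 t hr))

end DetMap

namespace DetMap
open DetExponents PowerSeriesSupport IsLocalRing ExtBridge

variable {𝕜 m n}

instance : Algebra (DetR 𝕜 m n) (DetS 𝕜 m n) := (phi 𝕜 m n).toRingHom.toAlgebra

lemma smul_eq_phi_mul (r : DetR 𝕜 m n) (f : DetS 𝕜 m n) : r • f = phi 𝕜 m n r * f := rfl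

lemma mem_imageSup (hn : 1 ≤ n) (t : ℕ) (f : DetS 𝕜 m n)
    (hf : ∀ e, degL e < degR e → degR e < t → coeff e f = 0) :
    f ∈ imageSup (R := DetR 𝕜 m n) (supportIdeal (levelSet degR t)) := by
  let U : Set (Fin m ⊕ Fin (n-1) →₀ ℕ) := {e | t ≤ degR e}
  rw [← restrict_add_restrict_compl U f, add_comm]
  refine Submodule.add_mem_sup ?_ fun e he => coeff_restrict_of_notMem he f
  refine exists_phi_eq hn _ fun e he => ?_
  by_cases hU : e ∈ U
  · exact coeff_restrict_of_notMem (Set.notMem_compl_iff.2 hU) f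
  · rw [coeff_restrict_of_mem hU]
    exact hf e he (not_le.1 hU)

lemma finite_quotient (hn : 1 ≤ n) (t : ℕ) : Module.Finite (DetR 𝕜 m n)
    (DetS 𝕜 m n ⧸ (supportIdeal (levelSet degR t) : Ideal (DetS 𝕜 m n)).restrictScalars
      (DetR 𝕜 m n)) := by
  classical
  have hfin : {e : Fin m ⊕ Fin (n-1) →₀ ℕ | degL e < degR e ∧ degR e < t}.Finite :=
    (Finsupp.finite_of_degree_le (2 * t)).subset fun e he => by
      change e.degree ≤ 2 * t
      have h1 : degL e < degR e ∧ degR e < t := he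
      rw [degree_eq]; omega
  set F := hfin.toFinset with hF
  set q := Submodule.mkQ ((supportIdeal (levelSet degR t) : Ideal (DetS 𝕜 m n)).restrictScalars
      (DetR 𝕜 m n))
  let G : Finset (DetS 𝕜 m n) := insert 1 (F.image fun e => monomial e 1)
  refine ⟨⟨G.image q, ?_⟩⟩
  rw [eq_top_iff]
  rintro x -
  obtain ⟨f, rfl⟩ := Submodule.mkQ_surjective _ x
  rw [Finset.coe_image, Submodule.span_image]
  have h1 : restrict (F : Set (Fin m ⊕ Fin (n-1) →₀ ℕ)) f ∈
      Submodule.span (DetR 𝕜 m n) (G : Set (DetS 𝕜 m n)) := by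
    rw [exists_sum_monomial F (restrict F f) fun e he => coeff_restrict_of_notMem he f]
    refine Submodule.sum_mem _ fun e he => ?_
    have : monomial e (coeff e (restrict F f)) =
        algebraMap 𝕜 (DetR 𝕜 m n) (coeff e (restrict F f)) • monomial e (1 : 𝕜) := by
      rw [smul_eq_phi_mul, AlgHom.commutes, ← Algebra.smul_def, ← map_smul, smul_eq_mul, mul_one]
    rw [this]
    exact Submodule.smul_mem _ _ (Submodule.subset_span
      (Finset.mem_insert_of_mem (Finset.mem_image_of_mem _ he)))
  have h2 : restrict (F : Set (Fin m ⊕ Fin (n-1) →₀ ℕ))ᶜ f ∈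
      imageSup (R := DetR 𝕜 m n) (supportIdeal (levelSet degR t)) := by
    refine mem_imageSup hn t _ fun e h1 h2 => coeff_restrict_of_notMem ?_ f
    rw [Set.notMem_compl_iff, hF, Set.Finite.coe_toFinset]
    exact ⟨h1, h2⟩
  rw [← restrict_add_restrict_compl (F : Set (Fin m ⊕ Fin (n-1) →₀ ℕ)) f, map_add]
  refine Submodule.add_mem _ (Submodule.mem_map_of_mem h1) ?_
  obtain ⟨_, ⟨r, rfl⟩, a, ha, hra⟩ := Submodule.mem_sup.1 h2
  refine ⟨algebraMap _ _ r, ?_, ?_⟩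
  · rw [Algebra.algebraMap_eq_smul_one]
    exact Submodule.smul_mem _ _ (Submodule.subset_span (Finset.mem_insert_self _ _))
  · have hqa : q a = 0 := (Submodule.Quotient.mk_eq_zero _).2 ha
    rw [← hra, map_add, hqa, add_zero]
    rfl

/-- Exponents of right degree at least `t`, or involving one of the first `j` left variables. -/
def chainSet (t j : ℕ) : UpperSet (Fin m ⊕ Fin (n - 1) →₀ ℕ) where
  carrier := {e | t ≤ degR e ∨ ∃ i : Fin m, (i : ℕ) < j ∧ 1 ≤ e (Sum.inl i)}
  upper' := fun a b hab h => by
    rcases h with h | ⟨i, hi, h⟩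
    · exact Or.inl ((levelSet degR t).upper hab h)
    · exact Or.inr ⟨i, hi, h.trans (hab _)⟩

lemma mem_chainSet {t j : ℕ} {e : Fin m ⊕ Fin (n - 1) →₀ ℕ} : e ∈ chainSet t j ↔
    t ≤ degR e ∨ ∃ i : Fin m, (i : ℕ) < j ∧ 1 ≤ e (Sum.inl i) := Iff.rfl

lemma chainSet_zero (t : ℕ) : chainSet (m := m) (n := n) t 0 = levelSet degR t := by
  ext e
  change (_ ∨ _) ↔ _
  simp [mem_levelSet]

lemma phi_detx_last (hn : 1 ≤ n) (i : Fin m) :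
    phi 𝕜 m n (detx 𝕜 m n i ⟨n - 1, by omega⟩) = X (Sum.inl i) := by
  rw [phi_detx, weight, dif_neg (by simp), add_zero]
  rfl

lemma coeff_smul_of_degL_eq_zero (r : DetR 𝕜 m n) (f : DetS 𝕜 m n)
    {e : Fin m ⊕ Fin (n - 1) →₀ ℕ} (he : degL e = 0) :
    coeff e (r • f) = coeff 0 (phi 𝕜 m n r) * coeff e f := by
  classical
  rw [smul_eq_phi_mul, coeff_mul, Finset.sum_eq_single (0, e)]
  · rintro ⟨a, b⟩ hab hne
    rw [Finset.HasAntidiagonal.mem_antidiagonal] at hab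
    dsimp only at hab ⊢
    rw [coeff_phi_eq_zero, zero_mul]
    rw [← hab, map_add] at he
    by_contra h0
    have : a = 0 := by
      rw [← Finsupp.degree_eq_zero_iff, degree_eq]; omega
    subst this
    rw [zero_add] at hab
    exact hne (by rw [hab])
  · simp

variable [IsLocalRing (DetR 𝕜 m n)]

lemma subsingleton_ext_quotient (hn : 1 ≤ n) {d : ℕ} (ω : ModuleCat.{0} (DetR 𝕜 m n))
    [Module.Finite (DetR 𝕜 m n) ω]
    (h : ∀ i, i ≠ d →
      Subsingleton (Abelian.Ext (ModuleCat.of (DetR 𝕜 m n) (ResidueField (DetR 𝕜 m n))) ω i))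
    (t i : ℕ) (hi : d < i + m) :
    Subsingleton (Abelian.Ext (ModuleCat.of (DetR 𝕜 m n) (DetS 𝕜 m n ⧸
      (supportIdeal (levelSet degR t) : Ideal (DetS 𝕜 m n)).restrictScalars
        (DetR 𝕜 m n))) ω i) := by
  rw [← chainSet_zero]
  have hfin : Module.Finite (DetR 𝕜 m n)
    (DetS 𝕜 m n ⧸ (supportIdeal (chainSet t 0) : Ideal (DetS 𝕜 m n)).restrictScalars
      (DetR 𝕜 m n)) := by
    rw [chainSet_zero]
    exact finite_quotient hn t
  refine subsingleton_ext_of_chain ω h m 1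
    (fun j => (supportIdeal (chainSet t j) : Ideal (DetS 𝕜 m n)))
    (fun j => if hj : j < m then detx 𝕜 m n ⟨j, hj⟩ ⟨n - 1, by omega⟩ else 0)
    (fun j hj => ?_) (fun j hj => ?_) (fun j hj s hs => ?_) (fun r hr => ?_) i hi
  · rw [dif_pos hj]
    change _ = _ ⊔ Ideal.span {phi 𝕜 m n _}
    rw [phi_detx_last hn]
    refine supportIdeal_sup_span_X _ fun e => ?_
    rw [mem_chainSet, mem_chainSet, or_assoc]
    refine or_congr_right ⟨?_, ?_⟩
    · rintro ⟨i, hi, he⟩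
      rcases Nat.lt_succ_iff_lt_or_eq.1 hi with hi | hi
      · exact Or.inl ⟨i, hi, he⟩
      · refine Or.inr ?_
        rwa [← (Fin.ext hi : i = ⟨j, hj⟩)]
    · rintro (⟨i, hi, he⟩ | he)
      · exact ⟨i, by omega, he⟩
      · exact ⟨⟨j, hj⟩, Nat.lt_succ_self j, he⟩
  · rw [dif_pos hj]
    exact detx_mem_maximalIdeal _ _
  · rw [dif_pos hj] at hs
    change phi 𝕜 m n _ * s ∈ _ at hs
    rw [phi_detx_last hn] at hs
    refine mem_supportIdeal_of_X_mul_mem _ (fun e he => ?_) hs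
    rw [mem_chainSet] at he ⊢
    rw [map_add, degR_single_inl, add_zero] at he
    refine he.imp_right ?_
    rintro ⟨i, hi, h1⟩
    refine ⟨i, hi, ?_⟩
    rwa [Finsupp.add_apply, Finsupp.single_eq_of_ne, add_zero] at h1
    intro h2
    rw [Sum.inl.injEq] at h2
    rw [h2] at hi
    exact lt_irrefl _ hi
  · rw [pow_one] at hr
    intro e he
    refine phi_mem_of_mem_maximalIdeal r hr e fun h1 => he ?_
    obtain ⟨i, hi⟩ := exists_le_of_degL_pos (e := e) h1
    exact mem_chainSet.2 (Or.inr ⟨i, i.2, Finsupp.single_le_iff.1 hi⟩)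

lemma smul_mem_imageSup (hn : 1 ≤ n) (t : ℕ) (r : DetR 𝕜 m n)
    (hr : r ∈ maximalIdeal (DetR 𝕜 m n) ^ t) (s : DetS 𝕜 m n) :
    r • s ∈ imageSup (R := DetR 𝕜 m n) (supportIdeal (levelSet degR t)) := by
  refine mem_imageSup hn t _ fun e h1 h2 => ?_
  have h3 := Ideal.mul_mem_right s _ (phi_mem_of_mem_maximalIdeal_pow t r hr)
  exact h3 e fun h4 => absurd (mem_levelSet.1 h4) (by omega)

lemma residue_eq (r : DetR 𝕜 m n) :
    residue (DetR 𝕜 m n) (algebraMap 𝕜 _ (coeff 0 (phi 𝕜 m n r))) = residue _ r := by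
  rw [← sub_eq_zero, ← map_sub, residue_eq_zero_iff, ← neg_sub, neg_mem_iff]
  exact sub_mem_maximalIdeal r

/-- The residues of the coefficients of the first powers of a right variable. -/
def coeffMap (j : Fin (n - 1)) (N : ℕ) :
    DetS 𝕜 m n →ₗ[DetR 𝕜 m n] (Fin N → ResidueField (DetR 𝕜 m n)) where
  toFun f s := residue _ (algebraMap 𝕜 (DetR 𝕜 m n)
    (coeff (Finsupp.single (Sum.inr j) ((s : ℕ) + 1)) f))
  map_add' f g := by
    ext s
    simp only [map_add, Pi.add_apply]
  map_smul' r f := by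
    ext s
    rw [coeff_smul_of_degL_eq_zero _ _ (degL_single_inr _ _), map_mul, map_mul, residue_eq]
    rfl

lemma coeffMap_surjective (j : Fin (n - 1)) (N : ℕ) :
    Function.Surjective (coeffMap (𝕜 := 𝕜) (m := m) j N) := by
  intro v
  choose r hr using fun s => residue_surjective (v s)
  let f : DetS 𝕜 m n := fun e =>
    if h : e (Sum.inr j) - 1 < N then coeff 0 (phi 𝕜 m n (r ⟨_, h⟩)) else 0
  refine ⟨f, funext fun s => ?_⟩
  have : coeff (Finsupp.single (Sum.inr j) ((s : ℕ) + 1)) f = coeff 0 (phi 𝕜 m n (r s)) := by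
    change (if h : (Finsupp.single (Sum.inr j) ((s : ℕ) + 1) : _ →₀ ℕ) (Sum.inr j) - 1 < N
      then coeff 0 (phi 𝕜 m n (r ⟨_, h⟩)) else 0) = _
    simp
  change residue _ (algebraMap 𝕜 (DetR 𝕜 m n) (coeff _ f)) = _
  rw [this, residue_eq, hr]

lemma imageSup_le_ker_coeffMap (j : Fin (n - 1)) (N : ℕ) :
    imageSup (R := DetR 𝕜 m n) (supportIdeal (levelSet degR (N + 1))) ≤
      LinearMap.ker (coeffMap (𝕜 := 𝕜) (m := m) j N) := by
  refine sup_le ?_ ?_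
  · rintro _ ⟨r, rfl⟩
    refine LinearMap.mem_ker.2 (funext fun s => ?_)
    change residue _ (algebraMap 𝕜 (DetR 𝕜 m n) (coeff _ (phi 𝕜 m n r))) = 0
    rw [coeff_phi_eq_zero, map_zero, map_zero]
    rw [degL_single_inr, degR_single_inr]
    omega
  · intro f hf
    refine LinearMap.mem_ker.2 (funext fun s => ?_)
    change residue _ (algebraMap 𝕜 (DetR 𝕜 m n) (coeff _ f)) = 0
    rw [hf, map_zero, map_zero]
    rw [mem_levelSet, degR_single_inr]
    omega

lemma exists_embedding (hm : 2 ≤ m) (hn : 2 ≤ n) (ω : ModuleCat.{0} (DetR 𝕜 m n))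
    (hω : IsCanonicalModule (DetR 𝕜 m n) (m + n - 1) ω) (N : ℕ) :
    ∃ f : (Fin N → ResidueField (DetR 𝕜 m n)) →ₗ[DetR 𝕜 m n]
      ((localCohomology (detJ 𝕜 m n) (m + n - 2)).obj ω), Function.Injective f := by
  obtain ⟨p, hp⟩ : ∃ p, m + n = p + 3 := ⟨m + n - 3, by omega⟩
  rw [show m + n - 2 = p + 1 by omega]
  rw [show m + n - 1 = p + 2 by omega] at hω
  refine exists_embedding_localCohomology ω (detJ 𝕜 m n)
    (fun t => (supportIdeal (levelSet degR t) : Ideal (DetS 𝕜 m n)))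
    (fun t => comap_supportIdeal t) ?_ hω (fun t => finite_quotient (by omega) t) ?_
    (fun t => ⟨t, fun r hr s => smul_mem_imageSup (by omega) t r hr s⟩) N (N + 1)
    (coeffMap ⟨0, by omega⟩ N) (coeffMap_surjective _ N) (imageSup_le_ker_coeffMap _ N)
  · intro s t hst f hf e he
    exact hf e fun h => he (hst.trans h)
  · intro t i hi h hfin
    exact subsingleton_ext_quotient (by omega) ω h t i (by omega)

end DetMap

/-- for any canonical module `ω_R` of `R`, the socle
`Hom_R(𝕜, H^0_𝔪(H^{m+n-2}_I(ω_R)))` is an infinite-dimensional `𝕜`-vector space.  Since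
this module is annihilated by `𝔪`, being infinite dimensional over `𝕜 = R/𝔪` is
equivalent to not being a finitely generated `R`-module. -/
theorem statement14 [IsLocalRing (DetR 𝕜 m n)] (hm : 2 ≤ m) (hn : 2 ≤ n)
    (ω : ModuleCat (DetR 𝕜 m n)) (hω : IsCanonicalModule (DetR 𝕜 m n) (m + n - 1) ω) :
    ¬ Module.Finite (DetR 𝕜 m n)
      (IsLocalRing.ResidueField (DetR 𝕜 m n) →ₗ[DetR 𝕜 m n]
        ((localCohomology (IsLocalRing.maximalIdeal (DetR 𝕜 m n)) 0).obj
          ((localCohomology (detJ 𝕜 m n) (m + n - 2)).obj ω))) := by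
  exact ExtBridge.not_finite_socle _ (DetMap.exists_embedding hm hn ω hω)
end
end

section
/- For every integer α ≥ 1 and any canonical module ω_R of R, there is an isomorphism of R-modules Ext^{n−1}_R(Ext^{n−1}_R(R/I^α, ω_R), ω_R) ≅ S/𝔞^α S, where S/𝔞^α S is an R-module via φ. -/
open CategoryTheory Opposite MvPowerSeries

set_option synthInstance.maxHeartbeats 1000000
set_option maxHeartbeats 1000000

noncomputable section

variable (𝕜 : Type) [Field 𝕜] (m n : ℕ)

section ExtComparison

/-- A surjection from the cocycles whose kernel is the submodule of coboundaries computes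
homology. -/
theorem ShortComplex.nonempty_homology_linearEquiv {A : Type} [CommRing A]
    (S : ShortComplex (ModuleCat.{0} A)) {E : Type} [AddCommGroup E] [Module A E]
    (l : LinearMap.ker S.g.hom →ₗ[A] E) (hl : Function.Surjective l)
    (hker : ∀ z, l z = 0 ↔ ∃ y, S.f.hom y = z) :
    Nonempty (S.homology ≃ₗ[A] E) := by
  have h : LinearMap.range S.moduleCatToCycles = LinearMap.ker l := by
    ext z
    rw [LinearMap.mem_ker, hker, LinearMap.mem_range]
    exact exists_congr fun y => Subtype.ext_iff
  exact ⟨S.moduleCatHomologyIso.toLinearEquiv ≪≫ₗ Submodule.quotEquivOfEq _ _ h ≪≫ₗ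
    l.quotKerEquivOfSurjective hl⟩

open CategoryTheory.ProjectiveResolution CochainComplex HomComplex in
theorem ProjectiveResolution.extMk_zero_eq_zero_iff {C : Type*} [Category* C] [Abelian C]
    [HasExt C] {X Y : C} (P : ProjectiveResolution X) (f : P.complex.X 0 ⟶ Y)
    (hf : P.complex.d 1 0 ≫ f = 0) : P.extMk f 1 rfl hf = 0 ↔ f = 0 := by
  refine ⟨fun h => ?_, fun h => by subst h; simp⟩
  rw [← P.extEquivCohomologyClass.apply_eq_iff_eq,
    extEquivCohomologyClass_extMk, extEquivCohomologyClass_zero,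
    CohomologyClass.mk_eq_zero_iff] at h
  rw [Cocycle.toSingleMk_mem_coboundaries_iff _ _ _ _ _ 1 (by lia)] at h
  obtain ⟨g, hg⟩ := h
  have hd : P.cochainComplex.d (-(0 : ℕ)) 1 = 0 := by
    refine (Limits.IsZero.eq_of_tgt ?_ _ _)
    exact P.cochainComplex.isZero_of_isStrictlyLE 0 1
  rw [hd, Limits.zero_comp, eq_comm, ← cancel_epi (P.cochainComplexXIso (-(0:ℕ)) 0 rfl).inv] at hg
  simpa using hg

open CategoryTheory.ProjectiveResolution in
theorem nonempty_ext_linearEquiv {A : Type} [CommRing A] (N Y : ModuleCat.{0} A) (i : ℕ) :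
    Nonempty ((((Ext A (ModuleCat.{0} A) i).obj (op N)).obj Y) ≃ₗ[A] Abelian.Ext N Y i) := by
  let P := projectiveResolution N
  let K := P.complex.linearYonedaObj A Y
  have hsmul : ∀ (r : A) (f : P.complex.X i ⟶ Y) (hf : P.complex.d (i + 1) i ≫ f = 0),
      P.extMk (r • f) (i + 1) rfl (by simp [hf]) = r • P.extMk f (i + 1) rfl hf := by
    intro r f hf
    simp [Abelian.Ext.smul_eq_comp_mk₀, P.extMk_comp_mk₀]
  have hnext : (ComplexShape.up ℕ).next i = i + 1 := by simp
  let S := K.sc' ((ComplexShape.up ℕ).prev i) i (i + 1)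
  let l : LinearMap.ker S.g.hom →ₗ[A] Abelian.Ext N Y i :=
    { toFun := fun z => P.extMk (z.1 : P.complex.X i ⟶ Y) (i + 1) rfl z.2
      map_add' := fun y z => (P.add_extMk _ _ _ _ _ _).symm
      map_smul' := fun r z => hsmul r z.1 z.2 }
  have hl : Function.Surjective l := fun e => by
    obtain ⟨f, hf, rfl⟩ := P.extMk_surjective e (i + 1) rfl
    exact ⟨⟨f, hf⟩, rfl⟩
  obtain ⟨e⟩ := ShortComplex.nonempty_homology_linearEquiv S l hl (fun z => by
    change P.extMk (z.1 : P.complex.X i ⟶ Y) (i + 1) rfl z.2 = 0 ↔ _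
    cases i with
    | zero =>
      refine (ProjectiveResolution.extMk_zero_eq_zero_iff P _ z.2).trans ?_
      have hf : S.f = 0 := by
        change K.d _ _ = 0
        apply K.shape
        simp
      rw [hf]
      constructor
      · intro h
        exact ⟨0, h.symm⟩
      · rintro ⟨y, hy⟩
        exact hy.symm
    | succ p =>
      refine (P.extMk_eq_zero_iff _ _ _ z.2 p rfl).trans ?_
      have hp : (ComplexShape.up ℕ).prev (p + 1) = p := by simp
      change _ ↔ ∃ y, (K.d _ _).hom y = _
      rw [hp]
      exact exists_congr fun g => Iff.rfl)
  exact ⟨(P.isoExt (R := A) i Y).toLinearEquiv ≪≫ₗ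
    (K.homologyIsoSc' _ i (i + 1) rfl hnext).toLinearEquiv ≪≫ₗ e⟩

end ExtComparison

section ExtModule

variable {R : Type} [CommRing R] (ω : ModuleCat.{0} R) (i : ℕ)

/-- The module `Ext^i_R(N, ω)`. -/
def ExtModule (N : Type) [AddCommGroup N] [Module R N] : Type :=
  Abelian.Ext (ModuleCat.of R N) ω i

namespace ExtModule

variable {N N' N'' : Type} [AddCommGroup N] [Module R N] [AddCommGroup N'] [Module R N']
  [AddCommGroup N''] [Module R N'']

instance : AddCommGroup (ExtModule ω i N) :=
  inferInstanceAs (AddCommGroup (Abelian.Ext (ModuleCat.of R N) ω i))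

/-- The additive contravariant functoriality of `Ext^i_R(-, ω)`. -/
def mapAdd (f : N →ₗ[R] N') : ExtModule ω i N' →+ ExtModule ω i N :=
  (Abelian.Ext.mk₀ (ModuleCat.ofHom f)).precomp ω (zero_add i)

theorem mapAdd_id (x : ExtModule ω i N) : mapAdd ω i (LinearMap.id : N →ₗ[R] N) x = x :=
  Abelian.Ext.mk₀_id_comp (C := ModuleCat.{0} R) x

theorem mapAdd_comp (g : N' →ₗ[R] N'') (f : N →ₗ[R] N') (x : ExtModule ω i N'') :
    mapAdd ω i (g ∘ₗ f) x = mapAdd ω i f (mapAdd ω i g x) :=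
  (Abelian.Ext.mk₀_comp_mk₀_assoc (ModuleCat.ofHom f) (ModuleCat.ofHom g) _).symm

theorem mapAdd_add (f g : N →ₗ[R] N') (x : ExtModule ω i N') :
    mapAdd ω i (f + g) x = mapAdd ω i f x + mapAdd ω i g x := by
  have h : Abelian.Ext.mk₀ (ModuleCat.ofHom (f + g)) =
      Abelian.Ext.mk₀ (ModuleCat.ofHom f) + Abelian.Ext.mk₀ (ModuleCat.ofHom g) :=
    Abelian.Ext.mk₀_add (ModuleCat.ofHom f) (ModuleCat.ofHom g)
  exact (congrArg (fun t => Abelian.Ext.precomp t ω (zero_add i) x) h).trans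
    (Abelian.Ext.add_comp _ _ _ (zero_add i))

theorem mapAdd_zero (x : ExtModule ω i N') : mapAdd ω i (0 : N →ₗ[R] N') x = 0 := by
  simpa using mapAdd_add ω i (0 : N →ₗ[R] N') 0 x

/-- If `N` is a module over an `R`-algebra `S`, then so is `Ext^i_R(N, ω)`. -/
instance instModuleAlgebra {S : Type} [CommRing S] [Algebra R S] [Module S N]
    [IsScalarTower R S N] : Module S (ExtModule ω i N) where
  smul s x := mapAdd ω i (Algebra.lsmul R R N s) x
  one_smul x := by
    change mapAdd ω i (Algebra.lsmul R R N 1) x = x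
    rw [_root_.map_one]
    exact mapAdd_id ω i x
  mul_smul s t x := by
    change mapAdd ω i (Algebra.lsmul R R N (s * t)) x = mapAdd ω i _ (mapAdd ω i _ x)
    rw [mul_comm, _root_.map_mul, ← mapAdd_comp]
    rfl
  smul_zero s := map_zero _
  smul_add s := map_add _
  add_smul s t x := by
    change mapAdd ω i (Algebra.lsmul R R N (s + t)) x = mapAdd ω i _ x + mapAdd ω i _ x
    rw [map_add, mapAdd_add]
  zero_smul x := by
    change mapAdd ω i (Algebra.lsmul R R N 0) x = 0
    rw [map_zero, mapAdd_zero]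

instance : Module R (ExtModule ω i N) :=
  inferInstanceAs (Module R (Abelian.Ext (ModuleCat.of R N) ω i))

instance [IsNoetherianRing R] [Module.Finite R N] [Module.Finite R ω] :
    Module.Finite R (ExtModule ω i N) :=
  inferInstanceAs (Module.Finite R (Abelian.Ext (ModuleCat.of R N) ω i))

theorem nonempty_ext_linearEquiv (N : Type) [AddCommGroup N] [Module R N] :
    Nonempty ((((Ext R (ModuleCat.{0} R) i).obj (op (ModuleCat.of R N))).obj ω) ≃ₗ[R]
      ExtModule ω i N) :=
  _root_.nonempty_ext_linearEquiv (ModuleCat.of R N) ω i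

/-- The contravariant functoriality of `Ext^i_R(-, ω)`. -/
def map (f : N →ₗ[R] N') : ExtModule ω i N' →ₗ[R] ExtModule ω i N where
  toFun := mapAdd ω i f
  map_add' := map_add _
  map_smul' r x := Abelian.Ext.comp_smul _ (show Abelian.Ext (ModuleCat.of R N') ω i from x)
    (zero_add i) r

@[simp]
theorem map_id : map ω i (LinearMap.id : N →ₗ[R] N) = LinearMap.id := by
  ext x
  exact mapAdd_id ω i x

theorem map_comp_apply (g : N' →ₗ[R] N'') (f : N →ₗ[R] N') (x : ExtModule ω i N'') :
    map ω i (g ∘ₗ f) x = map ω i f (map ω i g x) :=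
  mapAdd_comp ω i g f x

theorem map_comp (g : N' →ₗ[R] N'') (f : N →ₗ[R] N') :
    map ω i (g ∘ₗ f) = map ω i f ∘ₗ map ω i g := by
  ext x
  exact mapAdd_comp ω i g f x

theorem map_add (f g : N →ₗ[R] N') : map ω i (f + g) = map ω i f + map ω i g := by
  ext x
  exact mapAdd_add ω i f g x

theorem map_smul (r : R) (f : N →ₗ[R] N') : map ω i (r • f) = r • map ω i f := by
  ext x
  have h : Abelian.Ext.mk₀ (ModuleCat.ofHom (r • f)) = r • Abelian.Ext.mk₀ (ModuleCat.ofHom f) :=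
    Abelian.Ext.mk₀_smul r (ModuleCat.ofHom f)
  exact (congrArg (fun t => Abelian.Ext.precomp t ω (zero_add i) x) h).trans
    (Abelian.Ext.smul_comp _ _ (zero_add i) r)

theorem map_zero : map ω i (0 : N →ₗ[R] N') = 0 := by
  simpa using map_smul ω i 0 (0 : N →ₗ[R] N')

/-- Linear equivalences induce linear equivalences on `Ext`. -/
def congr (e : N ≃ₗ[R] N') : ExtModule ω i N' ≃ₗ[R] ExtModule ω i N :=
  LinearEquiv.ofLinearMap (map ω i e.toLinearMap) (map ω i e.symm.toLinearMap)
    (by rw [← map_comp]; simp) (by rw [← map_comp]; simp)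

section LongExactSequence

/-- The short complex given by two composable linear maps. -/
abbrev shortComplex (f : N →ₗ[R] N') (g : N' →ₗ[R] N'') (h : Function.Exact f g) :
    ShortComplex (ModuleCat.{0} R) :=
  ShortComplex.mk (ModuleCat.ofHom f) (ModuleCat.ofHom g)
    (by ext x; exact h.apply_apply_eq_zero x)

variable {f : N →ₗ[R] N'} {g : N' →ₗ[R] N''}

theorem shortExact (hf : Function.Injective f) (h : Function.Exact f g)
    (hg : Function.Surjective g) : (shortComplex f g h).ShortExact where
  exact := (ShortComplex.ShortExact.moduleCat_exact_iff_function_exact _).2 h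
  mono_f := (ModuleCat.mono_iff_injective _).2 hf
  epi_g := (ModuleCat.epi_iff_surjective _).2 hg

theorem map_zero_injective (hg : Function.Surjective g) : Function.Injective (map ω 0 g) :=
  haveI : Epi (ModuleCat.ofHom g) := (ModuleCat.epi_iff_surjective _).2 hg
  Abelian.Ext.precomp_mk₀_injective_of_epi ω (ModuleCat.ofHom g)

theorem exact_map_map (hf : Function.Injective f) (h : Function.Exact f g)
    (hg : Function.Surjective g) : Function.Exact (map ω i g) (map ω i f) := by
  intro x
  refine ⟨fun hx => ?_, ?_⟩
  · obtain ⟨y, hy⟩ := Abelian.Ext.contravariant_sequence_exact₂ (shortExact hf h hg) ω x hx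
    exact ⟨y, hy⟩
  · rintro ⟨y, rfl⟩
    rw [← map_comp_apply, h.linearMap_comp_eq_zero, map_zero]
    rfl

variable (hf : Function.Injective f) (h : Function.Exact f g) (hg : Function.Surjective g)

/-- The connecting homomorphism of the contravariant long exact sequence. -/
def δ : ExtModule ω i N →ₗ[R] ExtModule ω (i + 1) N'' :=
  (shortExact hf h hg).extClass.precompOfLinear R ω (add_comm 1 i)

theorem exact_map_δ : Function.Exact (map ω i f) (δ ω i hf h hg) := by
  intro x
  refine ⟨fun hx => ?_, ?_⟩
  · obtain ⟨y, hy⟩ := Abelian.Ext.contravariant_sequence_exact₁ (shortExact hf h hg) ω x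
      (add_comm 1 i) hx
    exact ⟨y, hy⟩
  · rintro ⟨y, rfl⟩
    exact (shortExact hf h hg).extClass_comp_assoc (h := add_comm 1 i) _

theorem exact_δ_map : Function.Exact (δ ω i hf h hg) (map ω (i + 1) g) := by
  intro x
  refine ⟨fun hx => ?_, ?_⟩
  · obtain ⟨y, hy⟩ := Abelian.Ext.contravariant_sequence_exact₃ (shortExact hf h hg) ω x hx
      (add_comm 1 i)
    exact ⟨y, hy⟩
  · rintro ⟨y, rfl⟩
    exact (shortExact hf h hg).comp_extClass_assoc _ (add_comm 1 i)

theorem δ_naturality (a : N →ₗ[R] N) (b : N' →ₗ[R] N') (c : N'' →ₗ[R] N'')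
    (hab : b ∘ₗ f = f ∘ₗ a) (hbc : c ∘ₗ g = g ∘ₗ b) (x : ExtModule ω i N) :
    δ ω i hf h hg (map ω i a x) = map ω (i + 1) c (δ ω i hf h hg x) := by
  let φ : shortComplex f g h ⟶ shortComplex f g h :=
    ⟨ModuleCat.ofHom a, ModuleCat.ofHom b, ModuleCat.ofHom c,
      by ext x; exact (LinearMap.congr_fun hab x).symm,
      by ext x; exact (LinearMap.congr_fun hbc x).symm⟩
  have := ShortComplex.ShortExact.extClass_naturality (shortExact hf h hg) (shortExact hf h hg) φ
  have h2 := congrArg (fun t => Abelian.Ext.comp t (show Abelian.Ext (ModuleCat.of R N) ω i from x)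
    (add_comm 1 i)) this
  rw [Abelian.Ext.comp_assoc_of_second_deg_zero,
    Abelian.Ext.comp_assoc _ _ _ _ (add_comm 1 i) (by lia)] at h2
  exact h2

end LongExactSequence

section BaseAction

variable {S : Type} [CommRing S] [Algebra R S] [Module S N] [IsScalarTower R S N]
  [Module S N'] [IsScalarTower R S N']

theorem algebra_smul_def (s : S) (x : ExtModule ω i N) :
    s • x = map ω i (Algebra.lsmul R R N s) x := rfl

instance : IsScalarTower R S (ExtModule ω i N) :=
  IsScalarTower.of_algebraMap_smul fun r x => by
    rw [algebra_smul_def]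
    have : Algebra.lsmul R R N (algebraMap R S r) = r • LinearMap.id := by
      ext n; simp
    rw [this, map_smul, map_id, LinearMap.smul_apply, LinearMap.id_apply]

/-- The map induced on `Ext` by an `S`-linear map is `S`-linear. -/
def mapₛ (f : N →ₗ[S] N') : ExtModule ω i N' →ₗ[S] ExtModule ω i N where
  toFun := map ω i (f.restrictScalars R)
  map_add' := _root_.map_add _
  map_smul' s x := by
    simp only [algebra_smul_def, ← map_comp_apply, RingHom.id_apply]
    congr 2
    ext n
    simp

/-- `S`-linear equivalences induce `S`-linear equivalences on `Ext`. -/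
def congrₛ (e : N ≃ₗ[S] N') : ExtModule ω i N' ≃ₗ[S] ExtModule ω i N :=
  { mapₛ ω i e.toLinearMap, congr ω i (e.restrictScalars R) with }

end BaseAction

end ExtModule

end ExtModule

section FiniteLength

open IsLocalRing

theorem exists_linearEquiv_residueField_pi {R : Type} [CommRing R] [IsLocalRing R]
    (N : Type) [AddCommGroup N] [Module R N]
    [Module.Finite R N] (hN : ∀ r ∈ maximalIdeal R, ∀ x : N, r • x = 0) :
    ∃ q : ℕ, Nonempty (N ≃ₗ[R] (Fin q → ResidueField R)) := by
  have hT : Module.IsTorsionBySet R N (maximalIdeal R) := fun x r => hN r r.2 x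
  let _ : Module (ResidueField R) N := hT.module
  have : IsScalarTower R (ResidueField R) N :=
    IsScalarTower.of_algebraMap_smul fun r x => rfl
  have : Module.Finite (ResidueField R) N := Module.Finite.of_restrictScalars_finite R _ _
  exact ⟨_, ⟨(Module.finBasis (ResidueField R) N).equivFun.restrictScalars R⟩⟩

namespace ExtModule

variable {R : Type} [CommRing R] (ω : ModuleCat.{0} R) (d : ℕ)
variable {N N' N'' : Type} [AddCommGroup N] [Module R N] [AddCommGroup N'] [Module R N']
  [AddCommGroup N''] [Module R N'']

theorem map_sum {ι : Type*} (s : Finset ι) (i : ℕ) (f : ι → N →ₗ[R] N') :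
    map ω i (∑ j ∈ s, f j) = ∑ j ∈ s, map ω i (f j) := by
  classical
  induction s using Finset.induction_on with
  | empty => simp [map_zero]
  | insert a s ha ih => rw [Finset.sum_insert ha, Finset.sum_insert ha, map_add, ih]

theorem subsingleton_of_subsingleton (i : ℕ) [Subsingleton N] : Subsingleton (ExtModule ω i N) := by
  refine subsingleton_of_forall_eq 0 fun x => ?_
  have : (LinearMap.id : N →ₗ[R] N) = 0 := Subsingleton.elim _ _
  have h := map_id (N := N) ω i
  rw [this, map_zero] at h
  exact (LinearMap.congr_fun h x).symm

/-- Elements of `R` annihilating `N` annihilate `Ext^i_R(N, ω)`. -/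
theorem smul_eq_zero_of_forall (i : ℕ) (r : R) (h : ∀ x : N, r • x = 0) (x : ExtModule ω i N) :
    r • x = 0 := by
  have h0 : r • (LinearMap.id : N →ₗ[R] N) = 0 := by ext y; exact h y
  have := map_smul ω i r (LinearMap.id : N →ₗ[R] N)
  rw [h0, map_zero, map_id] at this
  exact (LinearMap.congr_fun this x).symm

theorem algebra_smul_eq_zero_of_forall {S : Type} [CommRing S] [Algebra R S] [Module S N]
    [IsScalarTower R S N] (i : ℕ) (s : S) (h : ∀ x : N, s • x = 0) (x : ExtModule ω i N) :
    s • x = 0 := by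
  have h0 : Algebra.lsmul R R N s = 0 := by ext y; exact h y
  rw [algebra_smul_def, h0, map_zero]
  rfl

variable [IsLocalRing R]

theorem subsingleton_of_smul_eq_zero {i : ℕ} (hω : Subsingleton (ExtModule ω i (ResidueField R)))
    [Module.Finite R N] (hN : ∀ r ∈ maximalIdeal R, ∀ x : N, r • x = 0) :
    Subsingleton (ExtModule ω i N) := by
  obtain ⟨q, ⟨e⟩⟩ := exists_linearEquiv_residueField_pi N hN
  refine ((congr ω i e).toEquiv.subsingleton_congr).1 (subsingleton_of_forall_eq 0 fun x => ?_)
  have hid : (LinearMap.id : (Fin q → ResidueField R) →ₗ[R] _) =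
      ∑ j, LinearMap.single R (fun _ => ResidueField R) j ∘ₗ LinearMap.proj j :=
    by
      refine LinearMap.ext fun y => ?_
      rw [LinearMap.sum_apply]
      exact (Finset.univ_sum_single y).symm
  have h := LinearMap.congr_fun (map_id (N := Fin q → ResidueField R) ω i) x
  rw [hid, map_sum, LinearMap.sum_apply] at h
  rw [← LinearMap.id_apply (R := R) x, ← h]
  refine Finset.sum_eq_zero fun j _ => ?_
  rw [map_comp_apply, Subsingleton.elim (map ω i (LinearMap.single R _ j) x) 0, _root_.map_zero]

theorem subsingleton_of_pow_smul_eq_zero [IsNoetherianRing R] {i : ℕ}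
    (hω : Subsingleton (ExtModule ω i (ResidueField R)))
    [Module.Finite R N] (t : ℕ) (hN : ∀ r ∈ maximalIdeal R ^ t, ∀ x : N, r • x = 0) :
    Subsingleton (ExtModule ω i N) := by
  induction t generalizing N with
  | zero =>
    have : Subsingleton N := subsingleton_of_forall_eq 0 fun x => by
      simpa using hN 1 (by simp) x
    exact subsingleton_of_subsingleton ω i
  | succ t ih =>
    let M : Submodule R N := maximalIdeal R • ⊤
    have h1 : Subsingleton (ExtModule ω i M) := by
      refine ih fun r hr x => ?_
      obtain ⟨x, hx⟩ := x
      refine Subtype.ext ?_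
      change r • x = 0
      refine Submodule.smul_induction_on hx (fun a ha y _ => ?_) fun y z hy hz => ?_
      · rw [smul_smul]
        exact hN _ (by rw [pow_succ]; exact Ideal.mul_mem_mul hr ha) y
      · rw [smul_add, hy, hz, add_zero]
    have h2 : Subsingleton (ExtModule ω i (N ⧸ M)) := by
      refine subsingleton_of_smul_eq_zero ω hω fun r hr x => ?_
      obtain ⟨x, rfl⟩ := M.mkQ_surjective x
      rw [← _root_.map_smul]
      exact (Submodule.Quotient.mk_eq_zero _).2 (Submodule.smul_mem_smul hr trivial)
    refine subsingleton_of_forall_eq 0 fun x => ?_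
    obtain ⟨y, rfl⟩ := (exact_map_map ω i (f := M.subtype) (g := M.mkQ) M.subtype_injective
      (LinearMap.exact_subtype_mkQ M) M.mkQ_surjective x).1 (Subsingleton.elim _ _)
    rw [Subsingleton.elim y 0, _root_.map_zero]

/-- A map whose kernel and cokernel have finite length induces an isomorphism on `Ext^i_R(-, ω)` in
degrees where all the relevant groups of the residue field vanish. -/
theorem nonempty_linearEquiv_of_pow_smul [IsNoetherianRing R] {i : ℕ}
    (hω : ∀ j ≤ i + 1, Subsingleton (ExtModule ω j (ResidueField R)))
    [Module.Finite R N] [Module.Finite R N'] (f : N →ₗ[R] N') (t : ℕ)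
    (hker : ∀ r ∈ maximalIdeal R ^ t, ∀ x : N, f x = 0 → r • x = 0)
    (hcoker : ∀ r ∈ maximalIdeal R ^ t, ∀ y : N', ∃ x, f x = r • y) :
    Nonempty (ExtModule ω i N' ≃ₗ[R] ExtModule ω i N) := by
  have hK : ∀ j ≤ i + 1, Subsingleton (ExtModule ω j (LinearMap.ker f)) := fun j hj =>
    subsingleton_of_pow_smul_eq_zero ω (hω j hj) t fun r hr x =>
      Subtype.ext (hker r hr x.1 x.2)
  have hC : ∀ j ≤ i + 1, Subsingleton (ExtModule ω j (N' ⧸ LinearMap.range f)) := fun j hj =>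
    subsingleton_of_pow_smul_eq_zero ω (hω j hj) t fun r hr y => by
      obtain ⟨y, rfl⟩ := Submodule.mkQ_surjective _ y
      rw [← _root_.map_smul]
      exact (Submodule.Quotient.mk_eq_zero _).2 (hcoker r hr y)
  have hg : Function.Surjective f.rangeRestrict := f.surjective_rangeRestrict
  have hex : Function.Exact (LinearMap.ker f).subtype f.rangeRestrict := fun x => by
    simp [← LinearMap.mem_ker]
  have hinj := (LinearMap.ker f).subtype_injective
  have hinj' := (LinearMap.range f).subtype_injective
  have hex' := LinearMap.exact_subtype_mkQ (LinearMap.range f)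
  have hg' := (LinearMap.range f).mkQ_surjective
  have b1 : Function.Bijective (map ω i f.rangeRestrict) := by
    refine ⟨?_, fun x => ?_⟩
    · cases i with
      | zero => exact map_zero_injective ω hg
      | succ i =>
        refine (injective_iff_map_eq_zero _).2 fun x hx => ?_
        obtain ⟨y, rfl⟩ := (exact_δ_map ω i hinj hex hg x).1 hx
        have := hK i (by lia)
        rw [Subsingleton.elim y 0, _root_.map_zero]
    · have := hK i (by lia)
      exact (exact_map_map ω i hinj hex hg x).1 (Subsingleton.elim _ _)
  have b2 : Function.Bijective (map ω i (LinearMap.range f).subtype) := by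
    refine ⟨(injective_iff_map_eq_zero _).2 fun x hx => ?_, fun x => ?_⟩
    · obtain ⟨y, rfl⟩ := (exact_map_map ω i hinj' hex' hg' x).1 hx
      have := hC i (by lia)
      rw [Subsingleton.elim y 0, _root_.map_zero]
    · have := hC (i + 1) le_rfl
      exact (exact_map_δ ω i hinj' hex' hg' x).1 (Subsingleton.elim _ _)
  exact ⟨LinearEquiv.ofBijective _ b2 ≪≫ₗ LinearEquiv.ofBijective _ b1⟩

/-- Biduality with respect to `Ext^d_R(-, ω)` for finite modules killed by the maximal ideal. -/
theorem nonempty_linearEquiv_bidual {S : Type} [CommRing S] [Algebra R S] [Module S N]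
    [IsScalarTower R S N]
    (e : ExtModule ω d (ResidueField R) ≃ₗ[R] ResidueField R)
    [Module.Finite R N] (hN : ∀ r ∈ maximalIdeal R, ∀ x : N, r • x = 0) :
    Nonempty (N ≃ₗ[S] ExtModule ω d (ExtModule ω d N)) := by
  let e₂ : ExtModule ω d (ExtModule ω d (ResidueField R)) ≃ₗ[R] ResidueField R :=
    (congr ω d e).symm ≪≫ₗ e
  let u := e₂.symm 1
  have hgen : ∀ w : ExtModule ω d (ExtModule ω d (ResidueField R)), ∃ r : R, w = r • u := by
    intro w
    obtain ⟨r, hr⟩ := residue_surjective (e₂ w)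
    refine ⟨r, e₂.injective ?_⟩
    rw [_root_.map_smul, e₂.apply_symm_apply, ← hr, Algebra.smul_def, mul_one]
    rfl
  have hfaithful : ∀ r : R, r • u = 0 → residue R r = 0 := by
    intro r hr
    have := congrArg e₂ hr
    rw [_root_.map_smul, e₂.apply_symm_apply, Algebra.smul_def, mul_one, _root_.map_zero] at this
    exact this
  let ev : N → ResidueField R →ₗ[R] N := fun x =>
    Submodule.liftQ (maximalIdeal R) (LinearMap.toSpanSingleton R N x) fun r hr => hN r hr x
  have hev : ∀ x r, ev x (residue R r) = r • x := fun x r => rfl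
  have hext : ∀ {M : Type} [AddCommGroup M] [Module R M] (a b : ResidueField R →ₗ[R] M),
      (∀ r, a (residue R r) = b (residue R r)) → a = b := fun a b h => by
    ext x
    obtain ⟨r, rfl⟩ := residue_surjective x
    exact h r
  let η : N →ₗ[S] ExtModule ω d (ExtModule ω d N) :=
    { toFun := fun x => map ω d (map ω d (ev x)) u
      map_add' := fun x y => by
        rw [← LinearMap.add_apply, ← map_add, ← map_add]
        congr 3
        exact hext _ _ fun r => by simp [hev]
      map_smul' := fun s x => by
        have h1 : ev (s • x) = Algebra.lsmul R R N s ∘ₗ ev x :=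
          hext _ _ fun r => by
            change r • s • x = s • r • x
            rw [← algebraMap_smul S r, ← algebraMap_smul S r, smul_smul, smul_smul, mul_comm]
        rw [h1, map_comp, map_comp_apply]
        rfl }
  have hη : ∀ x, η x = map ω d (map ω d (ev x)) u := fun x => rfl
  obtain ⟨q, ⟨c⟩⟩ := exists_linearEquiv_residueField_pi N hN
  let ι : Fin q → ResidueField R →ₗ[R] N := fun j =>
    c.symm.toLinearMap ∘ₗ LinearMap.single R (fun _ => ResidueField R) j
  let π : Fin q → N →ₗ[R] ResidueField R := fun j => LinearMap.proj j ∘ₗ c.toLinearMap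
  have hid : (LinearMap.id : N →ₗ[R] N) = ∑ j, ι j ∘ₗ π j := by
    ext x
    apply c.injective
    ext j
    simp [ι, π, LinearMap.sum_apply, Pi.single_apply]
  refine ⟨LinearEquiv.ofBijective η ⟨(injective_iff_map_eq_zero _).2 fun x hx => ?_, fun w => ?_⟩⟩
  · apply c.injective
    rw [_root_.map_zero]
    ext j
    obtain ⟨r, hr⟩ := residue_surjective (c x j)
    rw [Pi.zero_apply, ← hr]
    refine hfaithful r ?_
    have h1 : π j ∘ₗ ev x = r • LinearMap.id := hext _ _ fun r' => by
      simp only [LinearMap.comp_apply, hev, LinearMap.smul_apply, LinearMap.id_apply,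
        LinearEquiv.coe_coe, LinearMap.proj_apply, _root_.map_smul, π, ← hr]
      rw [Algebra.smul_def, Algebra.smul_def, mul_comm]
      rfl
    have h2 : map ω d (map ω d (π j)) (η x) = r • u := by
      rw [hη, ← map_comp_apply, ← map_comp, h1, map_smul, map_smul, map_id, map_id]
      rfl
    rw [← h2, hx, _root_.map_zero]
  · choose r hr using fun j => hgen (map ω d (map ω d (π j)) w)
    refine ⟨∑ j, ι j (residue R (r j)), ?_⟩
    rw [_root_.map_sum]
    have h1 : ∀ j, η (ι j (residue R (r j))) = map ω d (map ω d (ι j ∘ₗ π j)) w := by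
      intro j
      have h3 : ev (ι j (residue R (r j))) = r j • ι j := hext _ _ fun r' => by
        rw [hev, LinearMap.smul_apply, ← (ι j).map_smul, ← (ι j).map_smul]
        refine congrArg (ι j) ?_
        rw [Algebra.smul_def, Algebra.smul_def, mul_comm]
        rfl
      rw [hη, h3, map_comp, map_comp_apply, hr j, map_smul, map_smul, _root_.map_smul]
      rfl
    rw [Finset.sum_congr rfl fun j _ => h1 j, ← LinearMap.sum_apply, ← map_sum, ← map_sum, ← hid,
      map_id, map_id]
    rfl

end ExtModule

end FiniteLength

section Reduction

open IsLocalRing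

variable {R S : Type} [CommRing R] [IsLocalRing R] [CommRing S] [Algebra R S]

/-- `IsReduction S N₀ xs N` says that the list `xs` of elements of the maximal ideal of `R` is
weakly regular on the `S`-module `N`, with `N ⧸ (xs) N` isomorphic to `N₀` over `S`. -/
inductive IsReduction (S : Type) [CommRing S] [Algebra R S] (N₀ : Type) [AddCommGroup N₀]
    [Module R N₀] [Module S N₀] [IsScalarTower R S N₀] :
    List R → ∀ (N : Type) [AddCommGroup N] [Module R N] [Module S N] [IsScalarTower R S N], Prop
  | nil (N : Type) [AddCommGroup N] [Module R N] [Module S N] [IsScalarTower R S N]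
      (e : N ≃ₗ[S] N₀) : IsReduction S N₀ [] N
  | cons (x : R) (xs : List R) (N N₁ : Type) [AddCommGroup N] [Module R N] [Module S N]
      [IsScalarTower R S N] [AddCommGroup N₁] [Module R N₁] [Module S N₁] [IsScalarTower R S N₁]
      (hx : x ∈ maximalIdeal R) (hreg : ∀ y : N, x • y = 0 → y = 0) (π : N →ₗ[S] N₁)
      (hπ : Function.Surjective π) (hker : ∀ y, π y = 0 ↔ ∃ z, x • z = y)
      (h : IsReduction S N₀ xs N₁) : IsReduction S N₀ (x :: xs) N

namespace IsReduction

variable {N N' N₀ N₀' : Type} [AddCommGroup N] [Module R N] [Module S N] [IsScalarTower R S N]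
  [AddCommGroup N'] [Module R N'] [Module S N'] [IsScalarTower R S N']
  [AddCommGroup N₀] [Module R N₀] [Module S N₀] [IsScalarTower R S N₀]
  [AddCommGroup N₀'] [Module R N₀'] [Module S N₀'] [IsScalarTower R S N₀']
  {xs : List R}

theorem _root_.Module.subsingleton_of_mem_maximalIdeal {R M : Type} [CommRing R] [IsLocalRing R]
    [AddCommGroup M] [Module R M] [Module.Finite R M] {x : R} (hx : x ∈ maximalIdeal R)
    (h : ∀ y : M, ∃ z, x • z = y) : Subsingleton M := by
  have : (⊤ : Submodule R M) = ⊥ := by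
    refine Submodule.eq_bot_of_le_smul_of_le_jacobson_bot (maximalIdeal R) ⊤
      Module.Finite.fg_top (fun y _ => ?_) (maximalIdeal_le_jacobson _)
    obtain ⟨z, rfl⟩ := h y
    exact Submodule.smul_mem_smul hx trivial
  exact (Submodule.subsingleton_iff R).1 (subsingleton_of_bot_eq_top this.symm)

theorem congr_base (h : IsReduction S N₀ xs N) (e : N₀ ≃ₗ[S] N₀') : IsReduction S N₀' xs N := by
  induction h with
  | nil N e' => exact .nil N (e' ≪≫ₗ e)
  | cons x xs N N₁ hx hreg π hπ hker h ih => exact .cons x xs N N₁ hx hreg π hπ hker ih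

theorem exists_surjective (h : IsReduction S N₀ xs N) :
    ∃ p : N →ₗ[S] N₀, Function.Surjective p ∧
      ∀ y, p y = 0 → y ∈ maximalIdeal R • (⊤ : Submodule R N) := by
  induction h with
  | nil N e =>
    refine ⟨e.toLinearMap, e.surjective, fun y hy => ?_⟩
    rw [e.map_eq_zero_iff.1 hy]
    exact zero_mem _
  | cons x xs N N₁ hx hreg π hπ hker h ih =>
    obtain ⟨p, hp, hk⟩ := ih
    refine ⟨p ∘ₗ π, hp.comp hπ, fun y hy => ?_⟩
    have hy' := hk (π y) hy
    have htop : (⊤ : Submodule R N₁) = (⊤ : Submodule R N).map (π.restrictScalars R) := by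
      rw [Submodule.map_top]
      exact (LinearMap.range_eq_top (f := π.restrictScalars R).2 hπ).symm
    rw [htop, ← Submodule.map_smul''] at hy'
    obtain ⟨z, hz, hzy⟩ := hy'
    obtain ⟨w, hw⟩ := (hker (y - z)).1 (by rw [map_sub, sub_eq_zero]; exact hzy.symm)
    rw [← sub_add_cancel y z, ← hw]
    exact add_mem (Submodule.smul_mem_smul hx trivial) hz

theorem injective_of_surjective [IsNoetherianRing R] [Module.Finite R N]
    (h : IsReduction S N₀ xs N) (h' : IsReduction S N₀' xs N')
    (h₀ : ∀ g : N₀ →ₗ[S] N₀', Function.Surjective g → Function.Injective g)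
    (g : N →ₗ[S] N') (hg : Function.Surjective g) : Function.Injective g := by
  rename_i hfin
  revert hfin
  induction h generalizing N' with
  | nil N e =>
    intro
    cases h' with
    | nil _ e' =>
      have := h₀ (e'.toLinearMap ∘ₗ g ∘ₗ e.symm.toLinearMap)
        (e'.surjective.comp (hg.comp e.symm.surjective))
      intro y z hyz
      refine e.injective (this ?_)
      simp [hyz]
  | cons x xs N N₁ hx hreg π hπ hker h ih =>
    intro
    cases h' with
    | cons _ _ _ N₁' _ hreg' π' hπ' hker' h' =>
      have : Module.Finite R N₁ := Module.Finite.of_surjective (π.restrictScalars R) hπ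
      have hle : LinearMap.ker π ≤ LinearMap.ker (π' ∘ₗ g) := fun y hy => by
        obtain ⟨z, rfl⟩ := (hker y).1 hy
        rw [LinearMap.mem_ker, LinearMap.comp_apply, hker']
        exact ⟨g z, ((g.restrictScalars R).map_smul x z).symm⟩
      let g₁ : N₁ →ₗ[S] N₁' := (LinearMap.ker π).liftQ (π' ∘ₗ g) hle ∘ₗ
        (π.quotKerEquivOfSurjective hπ).symm.toLinearMap
      have hg₁ : ∀ y, g₁ (π y) = π' (g y) := fun y => by
        have : (π.quotKerEquivOfSurjective hπ).symm (π y) = (LinearMap.ker π).mkQ y := by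
          rw [LinearEquiv.symm_apply_eq]
          rfl
        change (LinearMap.ker π).liftQ (π' ∘ₗ g) hle _ = _
        rw [LinearEquiv.coe_coe, this]
        rfl
      have hinj : Function.Injective g₁ := by
        refine ih h' g₁ fun y => ?_
        obtain ⟨y, rfl⟩ := hπ' y
        obtain ⟨y, rfl⟩ := hg y
        exact ⟨π y, hg₁ y⟩
      have hsub : Subsingleton (LinearMap.ker (g.restrictScalars R)) := by
        refine Module.subsingleton_of_mem_maximalIdeal hx fun ⟨y, hy⟩ => ?_
        have hy : g y = 0 := hy
        have h1 : π y = 0 := hinj (by rw [hg₁, hy, map_zero, map_zero])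
        obtain ⟨z, rfl⟩ := (hker y).1 h1
        exact ⟨⟨z, hreg' _ (((g.restrictScalars R).map_smul x z).symm.trans hy)⟩, rfl⟩
      refine (injective_iff_map_eq_zero g).2 fun y hy => ?_
      exact congrArg Subtype.val (Subsingleton.elim
        (⟨y, hy⟩ : LinearMap.ker (g.restrictScalars R)) 0)

open ExtModule in
/-- If `N` reduces to a module of finite length, then `Ext^i_R(N, ω)` is concentrated in a single
degree, where it reduces to the dual of the reduction of `N`. -/
theorem extModule [IsNoetherianRing R] (ω : ModuleCat.{0} R) [Module.Finite R ω] {d e : ℕ}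
    (hω : ∀ i ≠ d, Subsingleton (ExtModule ω i (ResidueField R)))
    [Module.Finite R N] [Module.Finite R N₀]
    (hN₀ : ∀ r ∈ maximalIdeal R, ∀ y : N₀, r • y = 0)
    (h : IsReduction S N₀ xs N) (hd : d = e + xs.length) :
    (∀ i ≠ e, Subsingleton (ExtModule ω i N)) ∧
      IsReduction S (ExtModule ω d N₀) xs (ExtModule ω e N) := by
  rename_i hfin hfin₀
  revert hfin
  induction h generalizing e with
  | nil N f =>
    intro
    obtain rfl : d = e := by simpa using hd
    refine ⟨fun i hi => ?_, .nil _ (congrₛ ω d f).symm⟩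
    have := subsingleton_of_smul_eq_zero ω (hω i hi) hN₀
    exact (congrₛ ω i f).symm.injective.subsingleton
  | cons x xs N N₁ hx hreg π hπ hker h ih =>
    intro
    have : Module.Finite R N₁ := Module.Finite.of_surjective (π.restrictScalars R) hπ
    obtain ⟨ih₁, ih₂⟩ := ih (e := e + 1) (by rw [hd, List.length_cons]; lia)
    let f : N →ₗ[R] N := x • LinearMap.id
    let g : N →ₗ[R] N₁ := π.restrictScalars R
    have hf : Function.Injective f := (injective_iff_map_eq_zero f).2 hreg
    have hfg : Function.Exact f g := hker
    have hmap : ∀ i, ∀ y : ExtModule ω i N, map ω i f y = x • y := fun i y => by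
      rw [ExtModule.map_smul, ExtModule.map_id]
      rfl
    have hzero : ∀ i ≠ e, Subsingleton (ExtModule ω i N) := fun i hi => by
      refine Module.subsingleton_of_mem_maximalIdeal hx fun y => ?_
      have := ih₁ (i + 1) (by lia)
      obtain ⟨z, hz⟩ := (exact_map_δ ω i hf hfg hπ y).1 (Subsingleton.elim _ _)
      exact ⟨z, (hmap i z).symm.trans hz⟩
    refine ⟨hzero, ?_⟩
    let D : ExtModule ω e N →ₗ[S] ExtModule ω (e + 1) N₁ :=
      { δ ω e hf hfg hπ with
        map_smul' := fun s y => by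
          refine δ_naturality ω e hf hfg hπ (Algebra.lsmul R R N s) (Algebra.lsmul R R N s)
            (Algebra.lsmul R R N₁ s) ?_ ?_ y
          · ext y
            change s • x • y = x • s • y
            rw [← algebraMap_smul S x, ← algebraMap_smul S x, smul_smul, smul_smul, mul_comm]
          · ext y
            exact (π.map_smul s y).symm }
    refine .cons x xs _ (ExtModule ω (e + 1) N₁) hx (fun y hy => ?_) D (fun y => ?_)
      (fun y => ?_) ih₂
    · rw [← hmap] at hy
      obtain ⟨z, rfl⟩ := (exact_map_map ω e hf hfg hπ y).1 hy
      have := ih₁ e (by lia)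
      rw [Subsingleton.elim z 0, _root_.map_zero]
    · have := hzero (e + 1) (by lia)
      exact (exact_δ_map ω e hf hfg hπ y).1 (Subsingleton.elim _ _)
    · refine (exact_map_δ ω e hf hfg hπ y).trans ⟨?_, ?_⟩
      · rintro ⟨z, rfl⟩
        exact ⟨z, (hmap e z).symm⟩
      · rintro ⟨z, rfl⟩
        exact ⟨z, hmap e z⟩

/-- Biduality for a finite cyclic `S`-module which is Cohen-Macaulay over `R`. -/
theorem nonempty_linearEquiv_bidual [IsNoetherianRing R] (ω : ModuleCat.{0} R) [Module.Finite R ω]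
    {d e : ℕ} (hω : ∀ i ≠ d, Subsingleton (ExtModule ω i (ResidueField R)))
    (hω' : Nonempty (ExtModule ω d (ResidueField R) ≃ₗ[R] ResidueField R))
    (J : Ideal S) [Module.Finite R (S ⧸ J)] (hN₀ : ∀ r ∈ maximalIdeal R, ∀ y : N₀, r • y = 0)
    (h : IsReduction S N₀ xs (S ⧸ J)) (hd : d = e + xs.length) :
    Nonempty ((S ⧸ J) ≃ₗ[S] ExtModule ω e (ExtModule ω e (S ⧸ J))) := by
  obtain ⟨p, hp, -⟩ := h.exists_surjective
  have : Module.Finite R N₀ := Module.Finite.of_surjective (p.restrictScalars R) hp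
  have h₁ := (h.extModule ω hω hN₀ hd).2
  have h₂ := (h₁.extModule ω hω
    (fun r hr => ExtModule.smul_eq_zero_of_forall ω d r (hN₀ r hr)) hd).2
  obtain ⟨b⟩ := ExtModule.nonempty_linearEquiv_bidual (S := S) ω d hω'.some hN₀
  have h₃ := h₂.congr_base b.symm
  obtain ⟨p', hp', hk'⟩ := h₃.exists_surjective
  obtain ⟨u, hu⟩ := hp' (p 1)
  have hJ : ∀ s ∈ J, ∀ y : ExtModule ω e (ExtModule ω e (S ⧸ J)), s • y = 0 := fun s hs =>
    ExtModule.algebra_smul_eq_zero_of_forall ω e s <|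
      ExtModule.algebra_smul_eq_zero_of_forall ω e s fun y => by
        obtain ⟨y, rfl⟩ := Ideal.Quotient.mk_surjective y
        rw [Algebra.smul_def, Ideal.Quotient.algebraMap_eq, Ideal.Quotient.eq_zero_iff_mem.2 hs,
          zero_mul]
  let g : (S ⧸ J) →ₗ[S] ExtModule ω e (ExtModule ω e (S ⧸ J)) :=
    Submodule.liftQ J (LinearMap.toSpanSingleton S _ u) fun s hs => hJ s hs u
  have hgs : ∀ s : S, g (Ideal.Quotient.mk J s) = s • u := fun s => rfl
  have hsurj : Function.Surjective g := by
    suffices LinearMap.range (g.restrictScalars R) = ⊤ from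
      LinearMap.range_eq_top (f := g.restrictScalars R).1 this
    refine top_le_iff.1 (Submodule.le_of_le_smul_of_le_jacobson_bot (I := maximalIdeal R)
      Module.Finite.fg_top (maximalIdeal_le_jacobson _) fun y _ => ?_)
    obtain ⟨s, hs⟩ : ∃ s : S, p (Ideal.Quotient.mk J s) = p' y := by
      obtain ⟨t, ht⟩ := hp (p' y)
      obtain ⟨s, rfl⟩ := Ideal.Quotient.mk_surjective t
      exact ⟨s, ht⟩
    have h4 : p' (y - s • u) = 0 := by
      rw [map_sub, map_smul, hu, ← map_smul, ← hs, sub_eq_zero, Algebra.smul_def, mul_one]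
      rfl
    rw [← add_sub_cancel (s • u) y]
    exact Submodule.add_mem_sup ⟨Ideal.Quotient.mk J s, hgs s⟩ (hk' _ h4)
  refine ⟨LinearEquiv.ofBijective g ⟨h.injective_of_surjective h₃ (fun c hc => ?_) g hsurj, hsurj⟩⟩
  exact IsNoetherian.injective_of_surjective_endomorphism (c.restrictScalars R) hc

end IsReduction

end Reduction

section Biduality

open IsLocalRing

theorem IsCanonicalModule.nonempty_ext_ext_linearEquiv {R S : Type} [CommRing R] [IsLocalRing R]
    [IsNoetherianRing R] [CommRing S] [Algebra R S] {d e : ℕ} {ω : ModuleCat.{0} R}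
    (hω : IsCanonicalModule R d ω) {J : Ideal S} [Module.Finite R (S ⧸ J)]
    {N₀ : Type} [AddCommGroup N₀] [Module R N₀] [Module S N₀] [IsScalarTower R S N₀]
    (hN₀ : ∀ r ∈ maximalIdeal R, ∀ y : N₀, r • y = 0) {xs : List R}
    (h : IsReduction S N₀ xs (S ⧸ J)) (hd : d = e + xs.length) (hxs : 2 ≤ xs.length)
    {M : Type} [AddCommGroup M] [Module R M] [Module.Finite R M] (f : M →ₗ[R] S ⧸ J) (t : ℕ)
    (hker : ∀ r ∈ maximalIdeal R ^ t, ∀ x : M, f x = 0 → r • x = 0)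
    (hcoker : ∀ r ∈ maximalIdeal R ^ t, ∀ y : S ⧸ J, ∃ x, f x = r • y) :
    Nonempty ((((Ext R (ModuleCat R) e).obj (op (((Ext R (ModuleCat R) e).obj
      (op (ModuleCat.of R M))).obj ω))).obj ω) ≃ₗ[R] (S ⧸ J)) := by
  obtain ⟨hfin, hω₁, ⟨c⟩⟩ := hω
  have hω₂ : ∀ i ≠ d, Subsingleton (ExtModule ω i (ResidueField R)) := fun i hi => by
    obtain ⟨a⟩ := ExtModule.nonempty_ext_linearEquiv ω i (ResidueField R)
    have := hω₁ i hi
    exact a.symm.injective.subsingleton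
  obtain ⟨a⟩ := ExtModule.nonempty_ext_linearEquiv ω d (ResidueField R)
  obtain ⟨b⟩ := ExtModule.nonempty_linearEquiv_of_pow_smul ω (i := e)
    (fun j hj => hω₂ j (by lia)) f t hker hcoker
  obtain ⟨D⟩ := h.nonempty_linearEquiv_bidual ω hω₂ ⟨a.symm ≪≫ₗ c⟩ J hN₀ hd
  obtain ⟨a₁⟩ := ExtModule.nonempty_ext_linearEquiv ω e M
  obtain ⟨a₂⟩ := _root_.nonempty_ext_linearEquiv
    (((Ext R (ModuleCat R) e).obj (op (ModuleCat.of R M))).obj ω) ω e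
  let E : Type := ((Ext R (ModuleCat R) e).obj (op (ModuleCat.of R M))).obj ω
  let c₂ : ExtModule ω e (ExtModule ω e (S ⧸ J)) ≃ₗ[R] ExtModule ω e E :=
    ExtModule.congr ω e (a₁ ≪≫ₗ b.symm)
  exact ⟨a₂ ≪≫ₗ c₂.symm ≪≫ₗ (D.restrictScalars R).symm⟩

end Biduality

namespace MvPowerSeries

variable {σ τ k : Type} [Field k]

/-- The ideal of power series whose coefficients vanish on a lower set of exponents. -/
def coeffIdeal (k : Type) [Field k] (L : Set (σ →₀ ℕ)) (hL : IsLowerSet L) :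
    Ideal (MvPowerSeries σ k) where
  carrier := {f | ∀ e ∈ L, coeff e f = 0}
  add_mem' hf hg e he := by rw [_root_.map_add, hf e he, hg e he, add_zero]
  zero_mem' e _ := _root_.map_zero _
  smul_mem' g f hf e he := by
    classical
    rw [smul_eq_mul, coeff_mul]
    refine Finset.sum_eq_zero fun p hp => ?_
    rw [hf p.2 (hL (Finset.HasAntidiagonal.mem_antidiagonal.1 hp ▸ le_add_self) he), mul_zero]

theorem mem_coeffIdeal {L : Set (σ →₀ ℕ)} {hL : IsLowerSet L} {f : MvPowerSeries σ k} :
    f ∈ coeffIdeal k L hL ↔ ∀ e ∈ L, coeff e f = 0 := Iff.rfl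

theorem coeff_X_mul_ite (e : σ →₀ ℕ) (s : σ) (f : MvPowerSeries σ k) :
    coeff e (X s * f) = if e s = 0 then 0 else coeff (e - Finsupp.single s 1) f := by
  classical
  rw [X, coeff_monomial_mul, one_mul]
  simp only [Finsupp.single_le_iff, Nat.one_le_iff_ne_zero, ite_not]

theorem isLowerSet_sum_lt (T : Finset σ) (α : ℕ) :
    IsLowerSet {e : σ →₀ ℕ | ∑ t ∈ T, e t < α} := fun _ _ hle h =>
  (Finset.sum_le_sum fun t _ => hle t).trans_lt h

theorem span_X_image_le (T : Finset σ) :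
    Ideal.span (X '' (T : Set σ)) ≤ coeffIdeal k _ (isLowerSet_sum_lt T 1) := by
  classical
  refine Ideal.span_le.2 ?_
  rintro _ ⟨t, ht, rfl⟩ e he
  rw [coeff_X, if_neg]
  rintro rfl
  have h1 := Finset.single_le_sum (f := fun s => Finsupp.single t 1 s) (fun _ _ => Nat.zero_le _) ht
  have h2 : ∑ s ∈ T, Finsupp.single t 1 s < 1 := he
  simp only [Finsupp.single_eq_same] at h1
  exact absurd (h1.trans_lt h2) (lt_irrefl 1)

/-- A power series lies in the `α`-th power of the ideal generated by a finite set of variables if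
and only if all its monomials have degree at least `α` in these variables. -/
theorem mem_span_X_image_pow_iff (T : Finset σ) (α : ℕ) (f : MvPowerSeries σ k) :
    f ∈ Ideal.span (X '' (T : Set σ)) ^ α ↔ ∀ e, ∑ t ∈ T, e t < α → coeff e f = 0 := by
  classical
  constructor
  · intro hf
    induction α generalizing f with
    | zero => simp
    | succ α ih =>
      rw [pow_succ] at hf
      refine Submodule.mul_induction_on hf (fun p hp q hq e he => ?_) fun p q hp hq e he => by
        rw [_root_.map_add, hp e he, hq e he, add_zero]
      rw [coeff_mul]
      refine Finset.sum_eq_zero fun x hx => ?_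
      rw [← Finset.HasAntidiagonal.mem_antidiagonal.1 hx] at he
      simp only [Finsupp.add_apply, Finset.sum_add_distrib] at he
      by_cases h1 : ∑ t ∈ T, x.1 t < α
      · rw [ih p hp _ h1, zero_mul]
      · rw [span_X_image_le T hq x.2 (show ∑ t ∈ T, x.2 t < 1 by lia), mul_zero]
  · induction α generalizing f with
    | zero => simp
    | succ α ih =>
      intro hf
      let c : (σ →₀ ℕ) → σ → Prop := fun e t => ∃ h : ∃ t ∈ T, e t ≠ 0, h.choose = t
      let g : σ → MvPowerSeries σ k := fun t e =>
        if c (e + Finsupp.single t 1) t then coeff (e + Finsupp.single t 1) f else 0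
      have hg : ∀ t e, coeff e (g t) =
        if c (e + Finsupp.single t 1) t then coeff (e + Finsupp.single t 1) f else 0 :=
        fun _ _ => rfl
      have hfg : f = ∑ t ∈ T, X t * g t := by
        ext e
        simp only [_root_.map_sum, coeff_X_mul_ite, hg]
        have hterm : ∀ t, (if e t = 0 then 0 else
            if c (e - Finsupp.single t 1 + Finsupp.single t 1) t then
              coeff (e - Finsupp.single t 1 + Finsupp.single t 1) f else 0) =
            if e t = 0 then 0 else if c e t then coeff e f else 0 := fun t => by
          by_cases h0 : e t = 0
          · rw [if_pos h0, if_pos h0]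
          · rw [tsub_add_cancel_of_le (Finsupp.single_le_iff.2 (Nat.one_le_iff_ne_zero.2 h0))]
        rw [Finset.sum_congr rfl fun t _ => hterm t]
        by_cases h : ∃ t ∈ T, e t ≠ 0
        · rw [Finset.sum_eq_single_of_mem h.choose h.choose_spec.1, if_neg h.choose_spec.2,
            if_pos ⟨h, rfl⟩]
          intro t _ ht
          rw [if_neg (c := c e t) fun ⟨_, h'⟩ => ht h'.symm, ite_self]
        · push Not at h
          rw [hf e (by rw [Finset.sum_eq_zero h]; lia)]
          exact (Finset.sum_eq_zero fun t ht => if_pos (h t ht)).symm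
      rw [hfg, pow_succ']
      refine sum_mem fun t ht => Ideal.mul_mem_mul (Ideal.subset_span ⟨t, ht, rfl⟩)
        (ih _ fun e he => ?_)
      rw [hg, hf, ite_self]
      simp only [Finsupp.add_apply, Finset.sum_add_distrib]
      have : ∑ s ∈ T, Finsupp.single t 1 s = 1 := by
        rw [Finset.sum_eq_single_of_mem t ht fun s _ hs => Finsupp.single_eq_of_ne hs,
          Finsupp.single_eq_same]
      lia

theorem constantCoeff_eq_zero_iff_mem_span [Fintype σ] (f : MvPowerSeries σ k) :
    constantCoeff f = 0 ↔ f ∈ Ideal.span (Set.range (X : σ → MvPowerSeries σ k)) := by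
  have := mem_span_X_image_pow_iff Finset.univ 1 f
  rw [pow_one, Finset.coe_univ, Set.image_univ] at this
  rw [this, ← coeff_zero_eq_constantCoeff_apply]
  refine ⟨fun h e he => ?_, fun h => h 0 (by simp)⟩
  have : e = 0 := by
    ext s
    simpa using Finset.sum_eq_zero_iff.1 (Nat.lt_one_iff.1 he) s (Finset.mem_univ s)
  rwa [this]

/-- Algebra homomorphisms between power series rings over a field mapping the variables to the
maximal ideal are determined by their values on the variables. -/
theorem algHom_ext_of_constantCoeff [Fintype σ] [Fintype τ]
    {f g : MvPowerSeries σ k →ₐ[k] MvPowerSeries τ k} (h₀ : ∀ s, constantCoeff (f (X s)) = 0)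
    (h : ∀ s, f (X s) = g (X s)) : f = g := by
  ext p e
  let N := e.degree + 1
  have hq : p - (truncTotal N p : MvPolynomial σ k) ∈
      Ideal.span (X '' ((Finset.univ : Finset σ) : Set σ)) ^ N := by
    rw [mem_span_X_image_pow_iff]
    intro x hx
    rw [_root_.map_sub, MvPolynomial.coeff_coe, coeff_truncTotal, sub_self]
    rwa [Finsupp.degree_eq_sum]
  have key : ∀ φ : MvPowerSeries σ k →ₐ[k] MvPowerSeries τ k,
      (∀ s, constantCoeff (φ (X s)) = 0) →
        coeff e (φ p) = coeff e (φ (truncTotal N p : MvPolynomial σ k)) := by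
    intro φ hφ
    rw [← sub_eq_zero, ← _root_.map_sub, ← _root_.map_sub]
    have h1 : (Ideal.span (X '' ((Finset.univ : Finset σ) : Set σ))).map φ ≤
        Ideal.span (X '' ((Finset.univ : Finset τ) : Set τ)) := by
      rw [Ideal.map_span, Ideal.span_le]
      rintro _ ⟨_, ⟨s, -, rfl⟩, rfl⟩
      rw [Finset.coe_univ, Set.image_univ]
      exact (constantCoeff_eq_zero_iff_mem_span _).1 (hφ s)
    refine (mem_span_X_image_pow_iff _ N _).1 (Ideal.pow_right_mono h1 N ?_) e ?_
    · rw [← Ideal.map_pow]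
      exact Ideal.mem_map_of_mem φ hq
    · rw [← Finsupp.degree_eq_sum]
      exact Nat.lt_succ_self _
  rw [key f h₀, key g fun s => h s ▸ h₀ s]
  have : f.comp (MvPolynomial.coeToMvPowerSeries.algHom k) =
      g.comp (MvPolynomial.coeToMvPowerSeries.algHom k) :=
    MvPolynomial.algHom_ext fun s => by simpa using! h s
  have h2 := AlgHom.congr_fun this (truncTotal N p)
  simp only [AlgHom.comp_apply, MvPolynomial.coeToMvPowerSeries.algHom_apply,
    Algebra.algebraMap_self, map_id, RingHom.id_apply] at h2
  rw [h2]

theorem sub_rename_killCompl_mem_span (i : σ ↪ τ) (T : Finset τ)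
    (hT : ∀ t, t ∉ T → t ∈ Set.range i) (f : MvPowerSeries τ k) :
    f - rename i (killCompl i f) ∈ Ideal.span (X '' (T : Set τ)) := by
  rw [← pow_one (Ideal.span _), mem_span_X_image_pow_iff]
  intro e he
  have : e ∈ Set.range (Finsupp.embDomain i) := by
    rw [Finsupp.mem_range_embDomain_iff]
    intro t ht
    refine hT t fun h => ?_
    exact (Finsupp.mem_support_iff.1 ht) (Finset.sum_eq_zero_iff.1 (Nat.lt_one_iff.1 he) t h)
  obtain ⟨x, rfl⟩ := this
  rw [_root_.map_sub, coeff_embDomain_rename, coeff_killCompl, sub_self]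

end MvPowerSeries

/-- If every element of `B` is congruent modulo `J` to an element of the subring `D ∋ z`, and `z`
multiplies generators of `J` into `D` modulo `J ^ 2`, then some power of `z` multiplies `B` into `D`
modulo any given power of `J`. -/
theorem Ideal.exists_pow_mul_sub_mem_pow {B : Type} [CommRing B] {s : Set B} {D : Subring B} {z : B}
    (hz : z ∈ D) (h₀ : ∀ b, ∃ q ∈ D, b - q ∈ Ideal.span s)
    (h₁ : ∀ g ∈ s, ∃ q ∈ D, z * g - q ∈ Ideal.span s ^ 2) (β : ℕ) :
    ∃ N, ∀ b, ∃ q ∈ D, z ^ N * b - q ∈ Ideal.span s ^ β := by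
  set J := Ideal.span s with hJ
  have hone : ∀ t ∈ J, ∃ q ∈ D, z * t - q ∈ J ^ 2 := by
    intro t ht
    induction ht using Submodule.span_induction with
    | mem g hg => exact h₁ g hg
    | zero => exact ⟨0, D.zero_mem, by simp⟩
    | add x y _ _ hx hy =>
      obtain ⟨p, hp, hp'⟩ := hx
      obtain ⟨q, hq, hq'⟩ := hy
      refine ⟨p + q, D.add_mem hp hq, ?_⟩
      convert! add_mem hp' hq' using 1
      ring
    | smul r g hg ih =>
      obtain ⟨c, hc, hc'⟩ := h₀ r
      obtain ⟨q, hq, hq'⟩ := ih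
      refine ⟨c * q, D.mul_mem hc hq, ?_⟩
      have h2 : (r - c) * (z * g) ∈ J ^ 2 := by
        rw [pow_two]
        exact Ideal.mul_mem_mul hc' (Ideal.mul_mem_left _ _ hg)
      convert! add_mem h2 (Ideal.mul_mem_left _ c hq') using 1
      rw [smul_eq_mul]
      ring
  have hgr : ∀ β, ∀ s ∈ J ^ β, ∃ q ∈ D, z ^ β * s - q ∈ J ^ (β + 1) := by
    intro β
    induction β with
    | zero => simpa using h₀
    | succ β ih =>
      intro s hs
      rw [pow_succ] at hs
      refine Submodule.mul_induction_on hs (fun x hx y hy => ?_) fun x y hx hy => ?_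
      · obtain ⟨p, hp, hp'⟩ := ih x hx
        obtain ⟨q, hq, hq'⟩ := hone y hy
        refine ⟨p * q, D.mul_mem hp hq, ?_⟩
        have hpJ : p ∈ J ^ β := by
          rw [← sub_sub_cancel (z ^ β * x) p]
          exact sub_mem (Ideal.mul_mem_left _ _ hx) (Ideal.pow_le_pow_right (Nat.le_succ β) hp')
        have h2 : (z ^ β * x - p) * (z * y) ∈ J ^ (β + 1 + 1) := by
          rw [pow_succ]
          exact Ideal.mul_mem_mul hp' (Ideal.mul_mem_left _ _ hy)
        have h3 : p * (z * y - q) ∈ J ^ (β + 1 + 1) := by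
          rw [add_assoc, pow_add]
          exact Ideal.mul_mem_mul hpJ hq'
        convert! add_mem h2 h3 using 1
        ring
      · obtain ⟨p, hp, hp'⟩ := hx
        obtain ⟨q, hq, hq'⟩ := hy
        refine ⟨p + q, D.add_mem hp hq, ?_⟩
        convert! add_mem hp' hq' using 1
        ring
  induction β with
  | zero => exact ⟨0, fun b => ⟨0, D.zero_mem, by simp⟩⟩
  | succ β ih =>
    obtain ⟨N, hN⟩ := ih
    refine ⟨β + N, fun b => ?_⟩
    obtain ⟨q, hq, hq'⟩ := hN b
    obtain ⟨p, hp, hp'⟩ := hgr β _ hq'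
    refine ⟨z ^ β * q + p, D.add_mem (D.mul_mem (D.pow_mem hz β) hq) hp, ?_⟩
    convert! hp' using 1
    ring

/-- If `R → B ⧸ J` is surjective and `J` is finitely generated, then `B ⧸ J ^ α` is a finite
`R`-module. -/
theorem Ideal.finite_quotient_pow_of_exists_sub_mem {R B : Type} [CommRing R] [CommRing B]
    [Algebra R B] {J : Ideal B} (hJ : J.FG) (h : ∀ b, ∃ r, b - algebraMap R B r ∈ J) (α : ℕ) :
    Module.Finite R (B ⧸ J ^ α) := by
  have key : ∀ β, ∃ W : Submodule R B, W.FG ∧ ∀ b, ∃ w ∈ W, b - w ∈ J ^ β := by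
    intro β
    induction β with
    | zero => exact ⟨⊥, Submodule.fg_bot, fun b => ⟨0, zero_mem _, by simp⟩⟩
    | succ β ih =>
      obtain ⟨W, hW, hb⟩ := ih
      obtain ⟨T, hT⟩ := hJ.pow (n := β)
      refine ⟨W ⊔ Submodule.span R T, hW.sup (Submodule.fg_span T.finite_toSet), fun b => ?_⟩
      have hs : ∀ s ∈ J ^ β, ∃ w ∈ Submodule.span R (T : Set B), s - w ∈ J ^ (β + 1) := by
        intro s hs
        rw [← hT] at hs
        induction hs using Submodule.span_induction with
        | mem g hg => exact ⟨g, Submodule.subset_span hg, by simp⟩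
        | zero => exact ⟨0, zero_mem _, by simp⟩
        | add x y _ _ hx hy =>
          obtain ⟨p, hp, hp'⟩ := hx
          obtain ⟨q, hq, hq'⟩ := hy
          exact ⟨p + q, add_mem hp hq, by convert! add_mem hp' hq' using 1; ring⟩
        | smul c g hg ih =>
          obtain ⟨r, hr⟩ := h c
          obtain ⟨w, hw, hw'⟩ := ih
          refine ⟨r • w, Submodule.smul_mem _ _ hw, ?_⟩
          have h2 : g * (c - algebraMap R B r) ∈ J ^ (β + 1) := by
            rw [pow_succ]
            exact Ideal.mul_mem_mul (hT ▸ hg) hr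
          convert! add_mem h2 (Ideal.mul_mem_left _ (algebraMap R B r) hw') using 1
          rw [smul_eq_mul, Algebra.smul_def]
          ring
      obtain ⟨w, hw, hw'⟩ := hb b
      obtain ⟨v, hv, hv'⟩ := hs _ hw'
      exact ⟨w + v, add_mem (Submodule.mem_sup_left hw) (Submodule.mem_sup_right hv),
        by rwa [← sub_sub]⟩
  obtain ⟨W, hW, hb⟩ := key α
  have : Module.Finite R W := Module.Finite.iff_fg.2 hW
  refine Module.Finite.of_surjective
    (((J ^ α).mkQ.restrictScalars R) ∘ₗ W.subtype) fun y => ?_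
  obtain ⟨b, rfl⟩ := Ideal.Quotient.mk_surjective y
  obtain ⟨w, hw, hw'⟩ := hb b
  exact ⟨⟨w, hw⟩, (Ideal.Quotient.eq.2 hw').symm⟩

namespace MvPowerSeries

section Reduction

variable {σ k : Type} [Field k]

theorem X_mul_mem_coeffIdeal_iff {L : Set (σ →₀ ℕ)} {hL : IsLowerSet L} {s : σ}
    (hs : ∀ e ∈ L, e + Finsupp.single s 1 ∈ L) (f : MvPowerSeries σ k) :
    X s * f ∈ coeffIdeal k L hL ↔ f ∈ coeffIdeal k L hL := by
  refine ⟨fun h e he => ?_, fun h => Ideal.mul_mem_left _ _ h⟩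
  have := h _ (hs e he)
  rwa [coeff_X_mul_ite, if_neg (by simp), add_tsub_cancel_right] at this

theorem mem_coeffIdeal_iff_exists_X_mul_sub_mem {L L' : Set (σ →₀ ℕ)} {hL : IsLowerSet L}
    {hL' : IsLowerSet L'} {s : σ} (hs : ∀ e, e ∈ L' ↔ e ∈ L ∧ e s = 0) (f : MvPowerSeries σ k) :
    f ∈ coeffIdeal k L' hL' ↔ ∃ g, X s * g - f ∈ coeffIdeal k L hL := by
  constructor
  · intro h
    let g : MvPowerSeries σ k := fun e => coeff (e + Finsupp.single s 1) f
    have hg : ∀ e, coeff e g = coeff (e + Finsupp.single s 1) f := fun _ => rfl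
    refine ⟨g, fun e he => ?_⟩
    rw [_root_.map_sub, coeff_X_mul_ite, hg]
    split_ifs with h0
    · rw [h e ((hs e).2 ⟨he, h0⟩), sub_zero]
    · rw [tsub_add_cancel_of_le (Finsupp.single_le_iff.2 (Nat.one_le_iff_ne_zero.2 h0)), sub_self]
  · rintro ⟨g, hg⟩ e he
    obtain ⟨he, h0⟩ := (hs e).1 he
    have := hg e he
    rwa [_root_.map_sub, coeff_X_mul_ite, if_pos h0, zero_sub, neg_eq_zero] at this

theorem isReduction_cons_coeffIdeal {R : Type} [CommRing R] [IsLocalRing R]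
    [Algebra R (MvPowerSeries σ k)] {N₀ : Type} [AddCommGroup N₀] [Module R N₀]
    [Module (MvPowerSeries σ k) N₀] [IsScalarTower R (MvPowerSeries σ k) N₀]
    {L L' : Set (σ →₀ ℕ)} {hL : IsLowerSet L} {hL' : IsLowerSet L'} {s : σ}
    (hs : ∀ e ∈ L, e + Finsupp.single s 1 ∈ L) (hs' : ∀ e, e ∈ L' ↔ e ∈ L ∧ e s = 0)
    {x : R} (hx : x ∈ IsLocalRing.maximalIdeal R)
    (hxs : algebraMap R (MvPowerSeries σ k) x = X s) {xs : List R}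
    (h : IsReduction (MvPowerSeries σ k) N₀ xs (MvPowerSeries σ k ⧸ coeffIdeal k L' hL')) :
    IsReduction (MvPowerSeries σ k) N₀ (x :: xs) (MvPowerSeries σ k ⧸ coeffIdeal k L hL) := by
  have hle : coeffIdeal k L hL ≤ coeffIdeal k L' hL' := fun f hf e he => hf e ((hs' e).1 he).1
  have hsmul : ∀ f : MvPowerSeries σ k, x • Ideal.Quotient.mk (coeffIdeal k L hL) f =
      Ideal.Quotient.mk (coeffIdeal k L hL) (X s * f) := fun f => by
    rw [← hxs, ← Algebra.smul_def]
    rfl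
  refine .cons x xs _ _ hx (fun y hy => ?_) (Submodule.factor hle)
    (Submodule.factor_surjective hle) (fun y => ?_) h
  · obtain ⟨f, rfl⟩ := Ideal.Quotient.mk_surjective y
    rw [hsmul, Ideal.Quotient.eq_zero_iff_mem, X_mul_mem_coeffIdeal_iff hs] at hy
    exact Ideal.Quotient.eq_zero_iff_mem.2 hy
  · obtain ⟨f, rfl⟩ := Ideal.Quotient.mk_surjective y
    refine Ideal.Quotient.eq_zero_iff_mem.trans
      ((mem_coeffIdeal_iff_exists_X_mul_sub_mem (hL := hL) hs' f).trans ⟨?_, ?_⟩)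
    · rintro ⟨g, hg⟩
      exact ⟨Ideal.Quotient.mk _ g, by rw [hsmul]; exact Ideal.Quotient.eq.2 hg⟩
    · rintro ⟨z, hz⟩
      obtain ⟨g, rfl⟩ := Ideal.Quotient.mk_surjective z
      rw [hsmul] at hz
      exact ⟨g, Ideal.Quotient.eq.1 hz⟩

end Reduction

section Sum

variable {σ τ k : Type} [Field k]

theorem embDomain_inl_inr (w : σ →₀ ℕ) (j : τ) :
    Finsupp.embDomain (.inl : σ ↪ σ ⊕ τ) w (Sum.inr j) = 0 :=
  Finsupp.embDomain_of_notMem_range _ _ _ (by simp)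

theorem embDomain_inr_inr (v : τ →₀ ℕ) (j : τ) :
    Finsupp.embDomain (.inr : τ ↪ σ ⊕ τ) v (Sum.inr j) = v j :=
  Finsupp.embDomain_apply_self .inr v j

theorem coeff_sumElim_eval₂ [Finite σ] [Finite τ] (s : σ) (p : MvPolynomial τ (MvPowerSeries σ k))
    (w : σ →₀ ℕ) (v : τ →₀ ℕ) :
    coeff (Finsupp.embDomain .inl w + Finsupp.embDomain .inr v)
      (p.eval₂ (rename (R := k) (Function.Embedding.inl : σ ↪ σ ⊕ τ)).toRingHom
        fun j => X (Sum.inr j) * X (Sum.inl s)) =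
      coeff w (p.coeff v * X s ^ v.degree) := by
  classical
  induction p using MvPolynomial.induction_on' with
  | monomial u c =>
    rw [MvPolynomial.eval₂_monomial]
    have h1 : (u.prod fun j e => ((X (Sum.inr j) : MvPowerSeries (σ ⊕ τ) k) * X (Sum.inl s)) ^ e) =
        rename (Function.Embedding.inl : σ ↪ σ ⊕ τ) (X s ^ u.degree) *
          monomial (Finsupp.embDomain Function.Embedding.inr u) 1 := by
      rw [monomial_eq', Finsupp.prod_embDomain, _root_.map_one, one_mul]
      simp only [mul_pow, Finsupp.prod_mul, _root_.map_pow, rename_X]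
      rw [mul_comm]
      congr 1
      rw [Finsupp.prod, Finset.prod_pow_eq_pow_sum]
      rfl
    rw [h1]
    change coeff _ (rename _ c * _) = _
    rw [← mul_assoc, ← _root_.map_mul, MvPolynomial.coeff_monomial]
    by_cases huv : u = v
    · subst huv
      rw [coeff_add_mul_monomial, mul_one, coeff_embDomain_rename, if_pos rfl]
    · rw [if_neg huv, zero_mul, _root_.map_zero, coeff_mul_monomial]
      split_ifs with hle
      · rw [mul_one]
        refine coeff_rename_eq_zero (Function.Embedding.inl : σ ↪ σ ⊕ τ) _ fun hmem => ?_
        obtain ⟨y, hy⟩ := hmem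
        refine huv (Finsupp.ext fun j => ?_)
        have h2 := DFunLike.congr_fun hy (Sum.inr j)
        have h3 := hle (Sum.inr j)
        rw [Finsupp.mapDomain_of_notMem_range _ _ (by simp)] at h2
        simp only [Finsupp.tsub_apply, Finsupp.add_apply, embDomain_inl_inr,
          embDomain_inr_inr, zero_add] at h2 h3
        lia
      · rfl
  | add p q hp hq =>
    rw [MvPolynomial.eval₂_add, _root_.map_add, hp, hq, MvPolynomial.coeff_add, add_mul,
      _root_.map_add]

theorem coeff_eq_zero_of_eval₂_mem [Finite σ] [Fintype τ] (s : σ)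
    (p : MvPolynomial τ (MvPowerSeries σ k)) (α : ℕ)
    (h : p.eval₂ (rename (R := k) (Function.Embedding.inl : σ ↪ σ ⊕ τ)).toRingHom
        (fun j => X (Sum.inr j) * X (Sum.inl s)) ∈
      Ideal.span (X '' ((Finset.univ.map .inr : Finset (σ ⊕ τ)) : Set (σ ⊕ τ))) ^ α)
    {v : τ →₀ ℕ} (hv : v.degree < α) : p.coeff v = 0 := by
  classical
  have h1 : p.coeff v * X s ^ v.degree = 0 := by
    ext w
    rw [← coeff_sumElim_eval₂, (mem_span_X_image_pow_iff _ _ _).1 h, _root_.map_zero]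
    rw [Finset.sum_map]
    simpa only [Function.Embedding.inr_apply, Finsupp.add_apply, embDomain_inl_inr,
      embDomain_inr_inr, zero_add, ← Finsupp.degree_eq_sum] using hv
  refine (mul_eq_zero.1 h1).resolve_right (pow_ne_zero _ fun h0 => ?_)
  have := coeff_X (R := k) (Finsupp.single s 1) s
  rw [if_pos rfl, h0, _root_.map_zero] at this
  exact zero_ne_one this

end Sum

end MvPowerSeries

theorem MvPolynomial.eval₂_mem_pow_of_coeff_eq_zero {τ A B : Type} [CommRing A] [CommRing B]
    (f : A →+* B) {g : τ → B} {J : Ideal B} (hg : ∀ j, g j ∈ J) {p : MvPolynomial τ A} {α : ℕ}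
    (h : ∀ v : τ →₀ ℕ, v.degree < α → p.coeff v = 0) : p.eval₂ f g ∈ J ^ α := by
  rw [MvPolynomial.eval₂_eq]
  refine sum_mem fun v hv => Ideal.mul_mem_left _ _ ?_
  have hα : α ≤ v.degree := not_lt.1 fun hlt => MvPolynomial.mem_support_iff.1 hv (h v hlt)
  refine Ideal.pow_le_pow_right hα ?_
  rw [Finsupp.degree_apply, ← Finset.prod_pow_eq_pow_sum]
  exact Ideal.prod_mem_prod fun j _ => Ideal.pow_mem_pow (hg j) _

section Determinantal

variable {𝕜 m n}

/-- The index of the last column. -/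
def detLast (hn : 2 ≤ n) : Fin n := ⟨n - 1, by lia⟩

/-- The index of one of the first `n - 1` columns. -/
def detCol (j : Fin (n - 1)) : Fin n := Fin.castLE (Nat.sub_le n 1) j

theorem eq_detLast_or_eq_detCol (hn : 2 ≤ n) (j : Fin n) :
    j = detLast hn ∨ ∃ j', j = detCol j' := by
  by_cases h : (j : ℕ) < n - 1
  · exact .inr ⟨⟨j, h⟩, rfl⟩
  · exact .inl (Fin.ext (show (j : ℕ) = n - 1 by lia))

theorem detJ_eq_span : detJ 𝕜 m n =
    Ideal.span (Set.range fun p : Fin m × Fin (n - 1) => detx 𝕜 m n p.1 (detCol p.2)) := by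
  rw [detJ]
  congr 1
  ext x
  constructor
  · rintro ⟨i, j, hj, rfl⟩
    exact ⟨(i, ⟨j, hj⟩), rfl⟩
  · rintro ⟨p, rfl⟩
    exact ⟨p.1, detCol p.2, p.2.2, rfl⟩

theorem detx_mem_detJ (i : Fin m) (j : Fin (n - 1)) : detx 𝕜 m n i (detCol j) ∈ detJ 𝕜 m n :=
  Ideal.subset_span ⟨i, _, j.2, rfl⟩

theorem detx_mul_detx (i k : Fin m) (j l : Fin n) :
    detx 𝕜 m n i j * detx 𝕜 m n k l = detx 𝕜 m n i l * detx 𝕜 m n k j := by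
  have key : ∀ (i k : Fin m) (j l : Fin n), i < k → j < l →
      detx 𝕜 m n i j * detx 𝕜 m n k l = detx 𝕜 m n i l * detx 𝕜 m n k j :=
    fun i k j l hi hj => by
      refine sub_eq_zero.1 ?_
      simp only [detx, ← _root_.map_mul, ← _root_.map_sub]
      exact Ideal.Quotient.eq_zero_iff_mem.2 (Ideal.subset_span ⟨i, k, j, l, hi, hj, rfl⟩)
  rcases lt_trichotomy i k with hi | rfl | hi
  · rcases lt_trichotomy j l with hj | rfl | hj
    · exact key i k j l hi hj
    · rfl
    · exact (key i k l j hi hj).symm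
  · exact mul_comm _ _
  · rcases lt_trichotomy j l with hj | rfl | hj
    · have := key k i j l hi hj
      linear_combination -this
    · rfl
    · have := key k i l j hi hj
      linear_combination this

theorem detA_eq_span : detA 𝕜 m n = Ideal.span
    (X '' ((Finset.univ.map .inr : Finset (Fin m ⊕ Fin (n - 1))) : Set (Fin m ⊕ Fin (n - 1)))) := by
  rw [detA]
  congr 1
  ext x
  simp [Set.mem_image, eq_comm]

theorem maximalIdeal_detR_eq_span [IsLocalRing (DetR 𝕜 m n)] :
    IsLocalRing.maximalIdeal (DetR 𝕜 m n) =
      Ideal.span (Set.range fun p : Fin m × Fin n => detx 𝕜 m n p.1 p.2) := by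
  have hspan : Ideal.span (Set.range fun p : Fin m × Fin n => detx 𝕜 m n p.1 p.2) =
      (Ideal.span (Set.range X)).map (Ideal.Quotient.mk (detI2 𝕜 m n)) := by
    rw [Ideal.map_span, ← Set.range_comp]
    rfl
  have hle : detI2 𝕜 m n ≤ Ideal.span (Set.range X) := by
    refine Ideal.span_le.2 ?_
    rintro _ ⟨i, k, j, l, -, -, rfl⟩
    exact sub_mem (Ideal.mul_mem_right _ _ (Ideal.subset_span ⟨_, rfl⟩))
      (Ideal.mul_mem_right _ _ (Ideal.subset_span ⟨_, rfl⟩))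
  refine le_antisymm (fun r hr => ?_) (IsLocalRing.le_maximalIdeal fun htop => ?_)
  · obtain ⟨f, rfl⟩ := Ideal.Quotient.mk_surjective r
    rw [hspan]
    refine Ideal.mem_map_of_mem _ ((constantCoeff_eq_zero_iff_mem_span f).1 ?_)
    by_contra hf
    refine (IsLocalRing.mem_maximalIdeal _).1 hr (IsUnit.map _ ?_)
    exact isUnit_iff_constantCoeff.2 (isUnit_iff_ne_zero.2 hf)
  · rw [hspan, Ideal.eq_top_iff_one, ← _root_.map_one (Ideal.Quotient.mk (detI2 𝕜 m n)),
      Ideal.mem_map_iff_of_surjective _ Ideal.Quotient.mk_surjective] at htop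
    obtain ⟨f, hf, hf1⟩ := htop
    have h1 : (1 : DetP 𝕜 m n) ∈ Ideal.span (Set.range X) := by
      rw [← sub_sub_cancel f 1]
      exact sub_mem hf (hle (Ideal.Quotient.eq.1 hf1))
    rw [← constantCoeff_eq_zero_iff_mem_span, _root_.map_one] at h1
    exact one_ne_zero h1

theorem detx_mem_maximalIdeal [IsLocalRing (DetR 𝕜 m n)] (i : Fin m) (j : Fin n) :
    detx 𝕜 m n i j ∈ IsLocalRing.maximalIdeal (DetR 𝕜 m n) := by
  rw [maximalIdeal_detR_eq_span]
  exact Ideal.subset_span ⟨(i, j), rfl⟩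

/-- The homomorphism from the power series ring in the entries of the last column. -/
def detLastCol (hn : 2 ≤ n) : MvPowerSeries (Fin m) 𝕜 →ₐ[𝕜] DetR 𝕜 m n :=
  (Ideal.Quotient.mkₐ 𝕜 (detI2 𝕜 m n)).comp
    (rename (Function.Embedding.sectL (Fin m) (detLast hn)))

theorem detLastCol_X (hn : 2 ≤ n) (i : Fin m) :
    detLastCol hn (X i : MvPowerSeries (Fin m) 𝕜) = detx 𝕜 m n i (detLast hn) := by
  rw [detLastCol, AlgHom.comp_apply, rename_X]
  rfl

theorem exists_sub_detLastCol_mem_detJ (hn : 2 ≤ n) (r : DetR 𝕜 m n) :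
    ∃ a, r - detLastCol hn a ∈ detJ 𝕜 m n := by
  obtain ⟨f, rfl⟩ := Ideal.Quotient.mk_surjective r
  have h := sub_rename_killCompl_mem_span (Function.Embedding.sectL (Fin m) (detLast hn))
    (Finset.univ.filter fun p => p.2 ≠ detLast hn) (fun t ht => by
      rw [Finset.mem_filter, not_and, not_not] at ht
      exact ⟨t.1, Prod.ext rfl (ht (Finset.mem_univ _)).symm⟩) f
  refine ⟨killCompl (Function.Embedding.sectL (Fin m) (detLast hn)) f, ?_⟩
  have h' := Ideal.mem_map_of_mem (Ideal.Quotient.mk (detI2 𝕜 m n)) h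
  rw [_root_.map_sub, Ideal.map_span] at h'
  refine Ideal.span_le.2 ?_ h'
  rintro _ ⟨_, ⟨⟨i, j⟩, hij, rfl⟩, rfl⟩
  obtain rfl | ⟨j, rfl⟩ := eq_detLast_or_eq_detCol hn j
  · simp at hij
  · exact detx_mem_detJ i j

/-- Evaluation of polynomials over the power series ring in the last column at the entries of a
row of the first `n - 1` columns. -/
def detEval (hn : 2 ≤ n) (i : Fin m) :
    MvPolynomial (Fin (n - 1)) (MvPowerSeries (Fin m) 𝕜) →+* DetR 𝕜 m n :=
  MvPolynomial.eval₂Hom (detLastCol hn).toRingHom fun j => detx 𝕜 m n i (detCol j)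

theorem exists_pow_mul_sub_detEval_mem (hn : 2 ≤ n) (i : Fin m) (α : ℕ) :
    ∃ N, ∀ r, ∃ p, detx 𝕜 m n i (detLast hn) ^ N * r - detEval hn i p ∈ detJ 𝕜 m n ^ α := by
  have hC : ∀ a : MvPowerSeries (Fin m) 𝕜, detEval hn i (MvPolynomial.C a) = detLastCol hn a :=
    fun a => MvPolynomial.eval₂Hom_C _ _ _
  have hD := Ideal.exists_pow_mul_sub_mem_pow (D := (detEval hn i).range)
    (s := Set.range fun p : Fin m × Fin (n - 1) => detx 𝕜 m n p.1 (detCol p.2))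
    (z := detx 𝕜 m n i (detLast hn)) ⟨MvPolynomial.C (X i), by rw [hC, detLastCol_X]⟩
    (fun r => by
      obtain ⟨a, ha⟩ := exists_sub_detLastCol_mem_detJ hn r
      exact ⟨_, ⟨MvPolynomial.C a, hC a⟩, by rwa [← detJ_eq_span]⟩)
    (by
      rintro _ ⟨⟨k, j⟩, rfl⟩
      refine ⟨_, ⟨MvPolynomial.C (X k) * MvPolynomial.X j, rfl⟩, ?_⟩
      rw [_root_.map_mul, hC, detLastCol_X, detEval, MvPolynomial.eval₂Hom_X', sub_eq_zero.2]
      · exact zero_mem _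
      · rw [mul_comm (detx 𝕜 m n k _)]
        exact (detx_mul_detx _ _ _ _).symm) α
  obtain ⟨N, hN⟩ := hD
  refine ⟨N, fun r => ?_⟩
  obtain ⟨_, ⟨p, rfl⟩, hp⟩ := hN r
  exact ⟨p, by rwa [detJ_eq_span]⟩

end Determinantal

namespace IsDetPhi

variable {𝕜 m n} {φ : DetR 𝕜 m n →ₐ[𝕜] DetS 𝕜 m n}

theorem apply_detx_detLast (hφ : IsDetPhi 𝕜 m n φ) (hn : 2 ≤ n) (i : Fin m) :
    φ (detx 𝕜 m n i (detLast hn)) = X (Sum.inl i) := by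
  rw [hφ, dif_neg (show ¬((detLast hn : Fin n) : ℕ) < n - 1 from lt_irrefl (n - 1))]

theorem apply_detx_detCol (hφ : IsDetPhi 𝕜 m n φ) (i : Fin m) (j : Fin (n - 1)) :
    φ (detx 𝕜 m n i (detCol j)) = X (Sum.inr j) * X (Sum.inl i) := by
  rw [hφ, dif_pos (show ((detCol j : Fin n) : ℕ) < n - 1 from j.2)]
  rfl

theorem X_inl_dvd_apply_detx (hφ : IsDetPhi 𝕜 m n φ) (i : Fin m) (j : Fin n) :
    X (Sum.inl i) ∣ φ (detx 𝕜 m n i j) := by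
  rw [hφ]
  split_ifs
  · exact dvd_mul_left _ _
  · exact dvd_rfl

theorem apply_mem_detA (hφ : IsDetPhi 𝕜 m n φ) {r : DetR 𝕜 m n} (hr : r ∈ detJ 𝕜 m n) :
    φ r ∈ detA 𝕜 m n := by
  rw [detJ_eq_span] at hr
  refine (Ideal.span_le (I := (detA 𝕜 m n).comap φ)).2 ?_ hr
  rintro _ ⟨p, rfl⟩
  rw [SetLike.mem_coe, Ideal.mem_comap, hφ.apply_detx_detCol]
  exact Ideal.mul_mem_right _ _ (Ideal.subset_span ⟨_, rfl⟩)

theorem apply_mem_detA_pow (hφ : IsDetPhi 𝕜 m n φ) {α : ℕ} {r : DetR 𝕜 m n}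
    (hr : r ∈ detJ 𝕜 m n ^ α) : φ r ∈ detA 𝕜 m n ^ α := by
  have h := Ideal.mem_map_of_mem φ hr
  rw [Ideal.map_pow] at h
  exact Ideal.pow_right_mono (Ideal.map_le_iff_le_comap.2 fun _ => hφ.apply_mem_detA) α h

theorem apply_detLastCol (hφ : IsDetPhi 𝕜 m n φ) (hn : 2 ≤ n) (a : MvPowerSeries (Fin m) 𝕜) :
    φ (detLastCol hn a) = rename (Function.Embedding.inl : Fin m ↪ Fin m ⊕ Fin (n - 1)) a := by
  have hX : ∀ i, φ.comp (detLastCol hn) (X i) = X (Sum.inl i) := fun i => by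
    rw [AlgHom.comp_apply, detLastCol_X, hφ.apply_detx_detLast]
  refine AlgHom.congr_fun (algHom_ext_of_constantCoeff (f := φ.comp (detLastCol hn))
    (fun i => ?_) fun i => ?_) a
  · rw [hX, constantCoeff_X]
  · rw [hX, rename_X]
    rfl

theorem apply_detEval (hφ : IsDetPhi 𝕜 m n φ) (hn : 2 ≤ n) (i : Fin m)
    (p : MvPolynomial (Fin (n - 1)) (MvPowerSeries (Fin m) 𝕜)) :
    φ (detEval hn i p) =
      p.eval₂ (rename (R := 𝕜) (Function.Embedding.inl : Fin m ↪ Fin m ⊕ Fin (n - 1))).toRingHom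
        fun j => X (Sum.inr j) * X (Sum.inl i) := by
  have h := MvPolynomial.hom_eval₂ p (detLastCol (𝕜 := 𝕜) (m := m) hn).toRingHom φ.toRingHom
    fun j => detx 𝕜 m n i (detCol j)
  have hcomp : φ.toRingHom.comp (detLastCol hn).toRingHom =
      (rename (R := 𝕜) (Function.Embedding.inl : Fin m ↪ Fin m ⊕ Fin (n - 1))).toRingHom :=
    RingHom.ext (hφ.apply_detLastCol hn)
  rw [hcomp] at h
  refine h.trans ?_
  congr 1
  exact funext fun j => hφ.apply_detx_detCol i j

theorem detEval_mem_detJ_pow (hφ : IsDetPhi 𝕜 m n φ) (hn : 2 ≤ n) (i : Fin m) {α : ℕ}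
    {p : MvPolynomial (Fin (n - 1)) (MvPowerSeries (Fin m) 𝕜)}
    (hp : φ (detEval hn i p) ∈ detA 𝕜 m n ^ α) : detEval hn i p ∈ detJ 𝕜 m n ^ α := by
  rw [hφ.apply_detEval, detA_eq_span] at hp
  exact MvPolynomial.eval₂_mem_pow_of_coeff_eq_zero _ (detx_mem_detJ i)
    fun v => coeff_eq_zero_of_eval₂_mem i p α hp

theorem exists_pow_mul_mem_detJ_pow (hφ : IsDetPhi 𝕜 m n φ) (hn : 2 ≤ n) (i : Fin m) (α : ℕ) :
    ∃ N, ∀ r, φ r ∈ detA 𝕜 m n ^ α → detx 𝕜 m n i (detLast hn) ^ N * r ∈ detJ 𝕜 m n ^ α := by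
  obtain ⟨N, hN⟩ := exists_pow_mul_sub_detEval_mem (𝕜 := 𝕜) hn i α
  refine ⟨N, fun r hr => ?_⟩
  obtain ⟨p, hp⟩ := hN r
  have h1 := hφ.apply_mem_detA_pow hp
  rw [_root_.map_sub, _root_.map_mul] at h1
  have h2 := sub_mem (Ideal.mul_mem_left _ (φ (detx 𝕜 m n i (detLast hn) ^ N)) hr) h1
  rw [sub_sub_cancel] at h2
  have h3 := add_mem hp (hφ.detEval_mem_detJ_pow hn i h2)
  rwa [sub_add_cancel] at h3

theorem exists_sub_apply_mem_detA (hφ : IsDetPhi 𝕜 m n φ) (hn : 2 ≤ n) (b : DetS 𝕜 m n) :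
    ∃ r, b - φ r ∈ detA 𝕜 m n := by
  refine ⟨detLastCol hn (killCompl .inl b), ?_⟩
  rw [hφ.apply_detLastCol, detA_eq_span]
  refine sub_rename_killCompl_mem_span .inl _ (fun t ht => ?_) b
  obtain i | j := t
  · exact ⟨i, rfl⟩
  · exact absurd (Finset.mem_map_of_mem .inr (Finset.mem_univ j)) ht

theorem exists_pow_mul_sub_apply_mem_detA_pow (hφ : IsDetPhi 𝕜 m n φ) (hn : 2 ≤ n) (i : Fin m)
    (α : ℕ) : ∃ N, ∀ b, ∃ r, φ (detx 𝕜 m n i (detLast hn) ^ N) * b - φ r ∈ detA 𝕜 m n ^ α := by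
  have hz := hφ.apply_detx_detLast hn i
  obtain ⟨N, hN⟩ := Ideal.exists_pow_mul_sub_mem_pow (D := φ.toRingHom.range)
    (s := {f : DetS 𝕜 m n | ∃ j : Fin (n - 1), f = X (Sum.inr j)}) (z := X (Sum.inl i)) ⟨_, hz⟩
    (fun b => by
      obtain ⟨r, hr⟩ := hφ.exists_sub_apply_mem_detA hn b
      exact ⟨_, ⟨r, rfl⟩, hr⟩)
    (by
      rintro _ ⟨j, rfl⟩
      refine ⟨_, ⟨detx 𝕜 m n i (detCol j), hφ.apply_detx_detCol i j⟩, ?_⟩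
      rw [mul_comm, sub_self]
      exact zero_mem _) α
  refine ⟨N, fun b => ?_⟩
  obtain ⟨_, ⟨r, rfl⟩, hr⟩ := hN b
  exact ⟨r, by rwa [_root_.map_pow, hz]⟩

end IsDetPhi

section DetLevel

variable {m}

/-- The exponents of total degree less than `α` in the `a_j` involving only the variables `x_i` for
`i` in the list `l`. -/
def detLevel (α : ℕ) (l : List (Fin m)) : Set ((Fin m ⊕ Fin (n - 1)) →₀ ℕ) :=
  {e | ∑ t ∈ Finset.univ.map .inr, e t < α ∧ ∀ i ∉ l, e (Sum.inl i) = 0}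

theorem isLowerSet_detLevel (α : ℕ) (l : List (Fin m)) : IsLowerSet (detLevel n α l) :=
  fun _ _ hle h => ⟨isLowerSet_sum_lt _ α hle h.1, fun i hi =>
    Nat.le_zero.1 ((hle _).trans_eq (h.2 i hi))⟩

variable {𝕜 n}

theorem coeffIdeal_detLevel_finRange (α : ℕ) :
    coeffIdeal 𝕜 _ (isLowerSet_detLevel n α (List.finRange m)) = detA 𝕜 m n ^ α := by
  ext f
  rw [detA_eq_span, mem_span_X_image_pow_iff, mem_coeffIdeal]
  exact ⟨fun h e he => h e ⟨he, fun i hi => absurd (List.mem_finRange i) hi⟩,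
    fun h e he => h e he.1⟩

theorem isReduction_detLevel [IsLocalRing (DetR 𝕜 m n)] [Algebra (DetR 𝕜 m n) (DetS 𝕜 m n)]
    (hn : 2 ≤ n)
    (hz : ∀ i, algebraMap (DetR 𝕜 m n) (DetS 𝕜 m n) (detx 𝕜 m n i (detLast hn)) = X (Sum.inl i))
    (α : ℕ) (l : List (Fin m)) (hl : l.Nodup) :
    IsReduction (DetS 𝕜 m n) (DetS 𝕜 m n ⧸ coeffIdeal 𝕜 _ (isLowerSet_detLevel n α []))
      (l.map fun i => detx 𝕜 m n i (detLast hn))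
      (DetS 𝕜 m n ⧸ coeffIdeal 𝕜 _ (isLowerSet_detLevel n α l)) := by
  induction l with
  | nil => exact .nil _ (LinearEquiv.refl _ _)
  | cons i l ih =>
    rw [List.nodup_cons] at hl
    refine isReduction_cons_coeffIdeal (s := Sum.inl i) ?_ ?_ (detx_mem_maximalIdeal i _) (hz i)
      (ih hl.2)
    · intro e he
      refine ⟨?_, fun k hk => ?_⟩
      · have := he.1
        rw [Finset.sum_map] at this ⊢
        simpa using this
      · have hki : k ≠ i := fun h => hk (h ▸ List.mem_cons_self)
        rw [Finsupp.add_apply, he.2 k hk, Finsupp.single_eq_of_ne (by simpa using hki), add_zero]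
    · intro e
      constructor
      · exact fun he => ⟨⟨he.1, fun k hk => he.2 k fun h => hk (List.mem_cons_of_mem i h)⟩,
          he.2 i hl.1⟩
      · rintro ⟨he, h0⟩
        refine ⟨he.1, fun k hk => ?_⟩
        by_cases hki : k = i
        · rw [hki, h0]
        · exact he.2 k (by simp [hki, hk])

theorem IsDetPhi.apply_mem_coeffIdeal_nil [IsLocalRing (DetR 𝕜 m n)]
    {φ : DetR 𝕜 m n →ₐ[𝕜] DetS 𝕜 m n} (hφ : IsDetPhi 𝕜 m n φ) (α : ℕ) {r : DetR 𝕜 m n}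
    (hr : r ∈ IsLocalRing.maximalIdeal (DetR 𝕜 m n)) :
    φ r ∈ coeffIdeal 𝕜 _ (isLowerSet_detLevel n α ([] : List (Fin m))) := by
  rw [maximalIdeal_detR_eq_span] at hr
  refine (Ideal.span_le (I := Ideal.comap φ (coeffIdeal 𝕜 _ (isLowerSet_detLevel n α [])))).2 ?_ hr
  rintro _ ⟨p, rfl⟩
  change φ _ ∈ coeffIdeal 𝕜 _ (isLowerSet_detLevel n α [])
  refine Ideal.mem_of_dvd _ (hφ.X_inl_dvd_apply_detx p.1 p.2) fun e he => ?_
  rw [← mul_one (X _), coeff_X_mul_ite, if_pos (he.2 p.1 List.not_mem_nil)]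

end DetLevel

theorem exists_maximalIdeal_pow_le {𝕜 : Type} [Field 𝕜] {m n : ℕ} [IsLocalRing (DetR 𝕜 m n)]
    (hn : 2 ≤ n) {α : ℕ} {K : Ideal (DetR 𝕜 m n)} (hJ : detJ 𝕜 m n ^ α ≤ K)
    (hz : ∀ i, ∃ N, detx 𝕜 m n i (detLast hn) ^ N ∈ K) :
    ∃ t, IsLocalRing.maximalIdeal (DetR 𝕜 m n) ^ t ≤ K := by
  refine Ideal.exists_pow_le_of_le_radical_of_fg ?_ (IsNoetherian.noetherian _)
  rw [maximalIdeal_detR_eq_span, Ideal.span_le]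
  rintro _ ⟨⟨i, j⟩, rfl⟩
  obtain rfl | ⟨j, rfl⟩ := eq_detLast_or_eq_detCol hn j
  · exact hz i
  · exact ⟨α, hJ (Ideal.pow_mem_pow (detx_mem_detJ i j) α)⟩

/-- for every `α ≥ 1` and any canonical module `ω_R` of `R`, there is an
isomorphism of `R`-modules `Ext^{n-1}_R(Ext^{n-1}_R(R/I^α, ω_R), ω_R) ≅ S/𝔞^α S`, where
`S/𝔞^α S` is an `R`-module via `φ`. -/
theorem statement15 [IsLocalRing (DetR 𝕜 m n)] (hm : 2 ≤ m) (hn : 2 ≤ n)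
    (ω : ModuleCat (DetR 𝕜 m n)) (hω : IsCanonicalModule (DetR 𝕜 m n) (m + n - 1) ω)
    (φ : DetR 𝕜 m n →ₐ[𝕜] DetS 𝕜 m n) (hφ : IsDetPhi 𝕜 m n φ) (α : ℕ) (hα : 1 ≤ α) :
    haveI : Algebra (DetR 𝕜 m n) (DetS 𝕜 m n) := φ.toRingHom.toAlgebra
    Nonempty
      ((((Ext (DetR 𝕜 m n) (ModuleCat (DetR 𝕜 m n)) (n - 1)).obj
          (op (((Ext (DetR 𝕜 m n) (ModuleCat (DetR 𝕜 m n)) (n - 1)).obj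
            (op (ModuleCat.of (DetR 𝕜 m n) (DetR 𝕜 m n ⧸ detJ 𝕜 m n ^ α)))).obj ω))).obj ω)
        ≃ₗ[DetR 𝕜 m n] (DetS 𝕜 m n ⧸ detA 𝕜 m n ^ α)) := by
  let : Algebra (DetR 𝕜 m n) (DetS 𝕜 m n) := φ.toRingHom.toAlgebra
  have hJA : ∀ r ∈ detJ 𝕜 m n ^ α, ∀ y : DetS 𝕜 m n ⧸ detA 𝕜 m n ^ α, r • y = 0 := by
    intro r hr y
    obtain ⟨b, rfl⟩ := Ideal.Quotient.mk_surjective y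
    exact Ideal.Quotient.eq_zero_iff_mem.2
      (Ideal.mul_mem_right b _ (hφ.apply_mem_detA_pow hr))
  have hfin : Module.Finite (DetR 𝕜 m n) (DetS 𝕜 m n ⧸ detA 𝕜 m n ^ α) :=
    Ideal.finite_quotient_pow_of_exists_sub_mem (IsNoetherian.noetherian _)
      (hφ.exists_sub_apply_mem_detA hn) α
  let f : (DetR 𝕜 m n ⧸ detJ 𝕜 m n ^ α) →ₗ[DetR 𝕜 m n] DetS 𝕜 m n ⧸ detA 𝕜 m n ^ α :=
    (detJ 𝕜 m n ^ α).liftQ ((detA 𝕜 m n ^ α).mkQ.restrictScalars (DetR 𝕜 m n) ∘ₗ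
      Algebra.linearMap (DetR 𝕜 m n) (DetS 𝕜 m n)) fun r hr =>
        Ideal.Quotient.eq_zero_iff_mem.2 (hφ.apply_mem_detA_pow hr)
  have hf : ∀ r, f (Ideal.Quotient.mk _ r) = Ideal.Quotient.mk _ (φ r) := fun _ => rfl
  have hsmul : ∀ r b, r • (Ideal.Quotient.mk (detA 𝕜 m n ^ α) b) = Ideal.Quotient.mk _ (φ r * b) :=
    fun _ _ => rfl
  obtain ⟨t₁, ht₁⟩ := exists_maximalIdeal_pow_le hn (α := α)
    (K := Module.annihilator (DetR 𝕜 m n) (LinearMap.ker f))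
    (fun r hr => by
      refine Module.mem_annihilator.2 fun ⟨x, _⟩ => Subtype.ext ?_
      obtain ⟨s, rfl⟩ := Ideal.Quotient.mk_surjective x
      exact Ideal.Quotient.eq_zero_iff_mem.2 (Ideal.mul_mem_right s _ hr))
    (fun i => by
      obtain ⟨N, hN⟩ := hφ.exists_pow_mul_mem_detJ_pow hn i α
      refine ⟨N, Module.mem_annihilator.2 fun ⟨x, hx⟩ => Subtype.ext ?_⟩
      obtain ⟨s, rfl⟩ := Ideal.Quotient.mk_surjective x
      rw [LinearMap.mem_ker, hf, Ideal.Quotient.eq_zero_iff_mem] at hx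
      exact Ideal.Quotient.eq_zero_iff_mem.2 (hN s hx))
  obtain ⟨t₂, ht₂⟩ := exists_maximalIdeal_pow_le hn (α := α)
    (K := Module.annihilator (DetR 𝕜 m n) ((DetS 𝕜 m n ⧸ detA 𝕜 m n ^ α) ⧸ LinearMap.range f))
    (fun r hr => by
      refine Module.mem_annihilator.2 fun x => ?_
      obtain ⟨y, rfl⟩ := Submodule.mkQ_surjective _ x
      rw [← _root_.map_smul, hJA r hr, _root_.map_zero])
    (fun i => by
      obtain ⟨N, hN⟩ := hφ.exists_pow_mul_sub_apply_mem_detA_pow hn i α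
      refine ⟨N, Module.mem_annihilator.2 fun x => ?_⟩
      obtain ⟨y, rfl⟩ := Submodule.mkQ_surjective _ x
      obtain ⟨b, rfl⟩ := Ideal.Quotient.mk_surjective y
      obtain ⟨r, hr⟩ := hN b
      rw [← _root_.map_smul, Submodule.mkQ_apply, Submodule.Quotient.mk_eq_zero]
      exact ⟨Ideal.Quotient.mk _ r, (Ideal.Quotient.eq.2 hr).symm⟩)
  have hred := isReduction_detLevel (𝕜 := 𝕜) hn (hφ.apply_detx_detLast hn) α (List.finRange m)
    (List.nodup_finRange m)
  rw [coeffIdeal_detLevel_finRange] at hred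
  refine hω.nonempty_ext_ext_linearEquiv (fun r hr y => ?_) hred ?_ ?_ f (t₁ + t₂) ?_ ?_
  · obtain ⟨b, rfl⟩ := Ideal.Quotient.mk_surjective y
    exact Ideal.Quotient.eq_zero_iff_mem.2
      (Ideal.mul_mem_right b _ (hφ.apply_mem_coeffIdeal_nil α hr))
  · rw [List.length_map, List.length_finRange]
    lia
  · rwa [List.length_map, List.length_finRange]
  · intro r hr x hx
    have := Module.mem_annihilator.1 (ht₁ (Ideal.pow_le_pow_right (Nat.le_add_right _ _) hr))
      ⟨x, hx⟩
    exact congrArg Subtype.val this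
  · intro r hr y
    have := Module.mem_annihilator.1 (ht₂ (Ideal.pow_le_pow_right (Nat.le_add_left _ _) hr))
      (Submodule.mkQ _ y)
    rw [← _root_.map_smul, Submodule.mkQ_apply, Submodule.Quotient.mk_eq_zero] at this
    exact this
end
end
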